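/- arXiv:2102.02195 — 2 statements merged into one kernel-verified Lean document; each statement's English description precedes it below -/
import Mathlib

section
/- For a generic entire function f ∈ End(ℂ): every point of the Fatou set F_f either lies in the basin of attraction of an attracting cycle of f or lies in a dynamically bounded wandering Fatou component of f; moreover, every Fatou component of f is a disc, i.e., biholomorphic to the open unit disc in ℂ. (Theorem 3.1 of the paper.) -/
open Function Topology Filter Metric

noncomputable section

/-- The space `End(ℂ)` of entire functions, topologized as a subspace of `C(ℂ, ℂ)` with the
compact-open topology. -/
abbrev Ent := {f : C(ℂ, ℂ) // Differentiable ℂ ⇑f}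

/-- The underlying function of an entire endomorphism. -/
def eapp1 (f : Ent) : ℂ → ℂ := ⇑f.1

/-- A sequence of maps diverges locally uniformly to infinity on `U`. -/
def DivLocUnifOn1 (F : ℕ → ℂ → ℂ) (U : Set ℂ) : Prop :=
  ∀ L ⊆ U, IsCompact L → ∀ K : Set ℂ, IsCompact K →
    ∀ᶠ j in atTop, Disjoint (F j '' L) K

/-- `p` belongs to the Fatou set of `f`. -/
def FatouAt1 (f : Ent) (p : ℂ) : Prop :=
  ∃ U : Set ℂ, IsOpen U ∧ p ∈ U ∧
    ∀ k : ℕ → ℕ, StrictMono k → ∃ l : ℕ → ℕ, StrictMono l ∧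
      ((∃ g : ℂ → ℂ, DifferentiableOn ℂ g U ∧
          TendstoLocallyUniformlyOn (fun j => (eapp1 f)^[k (l j)]) g atTop U) ∨
        DivLocUnifOn1 (fun j => (eapp1 f)^[k (l j)]) U)

/-- The Fatou set of `f`. -/
def Fatou1 (f : Ent) : Set ℂ := {p | FatouAt1 f p}

/-- The minimal period of a periodic point. -/
def minPer1 (f : Ent) (p : ℂ) : ℕ := Function.minimalPeriod (eapp1 f) p

/-- Attracting periodic point of an entire function. -/
def IsAttPer1 (f : Ent) (p : ℂ) : Prop :=
  (∃ m, 1 ≤ m ∧ (eapp1 f)^[m] p = p) ∧ ‖deriv ((eapp1 f)^[minPer1 f p]) p‖ < 1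

/-- The cycle (finite orbit) of a periodic point `p`. -/
def cycleOf1 (f : Ent) (p : ℂ) : Set ℂ := {x | ∃ i < minPer1 f p, (eapp1 f)^[i] p = x}

/-- The basin of attraction of the cycle of `p`. -/
def basinOf1 (f : Ent) (p : ℂ) : Set ℂ :=
  {x | ∃ a ∈ cycleOf1 f p, Tendsto (fun k => (eapp1 f)^[minPer1 f p * k] x) atTop (𝓝 a)}

/-- A set `U` is wandering for `f`: its forward images are pairwise disjoint. -/
def IsWandering1 (f : Ent) (U : Set ℂ) : Prop :=
  Pairwise fun i j : ℕ => Disjoint ((eapp1 f)^[i] '' U) ((eapp1 f)^[j] '' U)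

/-- A set `U` is dynamically bounded for `f`: forward images of each compact subset stay in
a fixed compact set. -/
def DynBounded1 (f : Ent) (U : Set ℂ) : Prop :=
  ∀ L ⊆ U, IsCompact L → ∃ K : Set ℂ, IsCompact K ∧ ∀ k : ℕ, (eapp1 f)^[k] '' L ⊆ K

/-- `U` is biholomorphic to the open unit disc. -/
def BiholoToDisc (U : Set ℂ) : Prop :=
  ∃ φ ψ : ℂ → ℂ, DifferentiableOn ℂ φ U ∧ DifferentiableOn ℂ ψ (Metric.ball (0 : ℂ) 1) ∧
    Set.MapsTo φ U (Metric.ball (0 : ℂ) 1) ∧ Set.MapsTo ψ (Metric.ball (0 : ℂ) 1) U ∧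
    (∀ z ∈ U, ψ (φ z) = z) ∧ (∀ w ∈ Metric.ball (0 : ℂ) 1, φ (ψ w) = w)

lemma lip_of_bdd {G : ℂ → ℂ} {x : ℂ} {r M : ℝ} (hr : 0 < r) (hG : DifferentiableOn ℂ G (ball x r))
    (hM : ∀ z ∈ ball x r, ‖G z‖ ≤ M) {a b : ℂ} (ha : a ∈ ball x (r/2)) (hb : b ∈ ball x (r/2)) :
    ‖G b - G a‖ ≤ M / (r/2) * ‖b - a‖ := by
  have hsub : ∀ y ∈ ball x (r/2), ball y (r/2) ⊆ ball x r := by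
    intro y hy
    apply ball_subset_ball'
    rw [mem_ball] at hy; linarith
  refine Convex.norm_image_sub_le_of_norm_deriv_le (s := ball x (r/2)) (𝕜 := ℂ) ?_ ?_
    (convex_ball _ _) ha hb
  · intro y hy
    exact (hG.differentiableAt (isOpen_ball.mem_nhds (ball_subset_ball (by linarith) hy)))
  · intro y hy
    have hcl : closedBall y (r/2) ⊆ ball x r := by
      intro z hz
      rw [mem_ball] at *
      rw [mem_closedBall] at hz
      linarith [dist_triangle z y x]
    refine Complex.norm_deriv_le_of_forall_mem_sphere_norm_le (by linarith) ?_ ?_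
    · exact (hG.mono hcl).diffContOnCl_ball (le_refl _)
    · intro z hz
      exact hM z (hcl (sphere_subset_closedBall hz))

lemma montel {U : Set ℂ} {F : ℕ → ℂ → ℂ} (hF : ∀ n, DifferentiableOn ℂ (F n) U)
    (hb : ∀ x ∈ U, ∃ r > 0, ∃ M : ℝ, ball x r ⊆ U ∧ ∀ n, ∀ z ∈ ball x r, ‖F n z‖ ≤ M) :
    ∃ φ : ℕ → ℕ, StrictMono φ ∧ ∃ g : ℂ → ℂ,
      TendstoLocallyUniformlyOn (fun j => F (φ j)) g atTop U := by
  classical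
  set d := TopologicalSpace.denseSeq ℂ with hd
  let Φ : ℕ → ℕ → ℂ := fun n i => if d i ∈ U then F n (d i) else 0
  have hΦ : ∀ i, ∃ M : ℝ, ∀ n, ‖Φ n i‖ ≤ M := by
    intro i
    by_cases h : d i ∈ U
    · obtain ⟨r, hr, M, -, hM⟩ := hb _ h
      refine ⟨M, fun n => ?_⟩
      simp only [Φ, h, if_true]
      exact hM n _ (mem_ball_self hr)
    · exact ⟨0, fun n => by simp [Φ, h]⟩
  choose Mi hMi using hΦ
  have hcomp : IsCompact (Set.pi Set.univ fun i => closedBall (0:ℂ) (Mi i)) :=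
    isCompact_univ_pi fun i => isCompact_closedBall _ _
  obtain ⟨a, -, φ, hφ, hlim⟩ := hcomp.tendsto_subseq (x := Φ) (fun n i _ => by
    simpa using hMi i n)
  refine ⟨φ, hφ, ?_⟩
  -- uniform Cauchy
  have key : ∀ x ∈ U, ∃ r > 0, ball x r ⊆ U ∧
      UniformCauchySeqOn (fun j => F (φ j)) atTop (ball x r) := by
    intro x hx
    obtain ⟨r, hr, M, hrU, hM⟩ := hb x hx
    refine ⟨r/4, by positivity, (ball_subset_ball (by linarith)).trans hrU, ?_⟩
    rw [Metric.uniformCauchySeqOn_iff]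
    intro ε hε
    have hM0 : 0 ≤ M := (norm_nonneg _).trans (hM 0 x (mem_ball_self hr))
    set C := M / (r/2) with hC
    have hC0 : 0 ≤ C := by positivity
    obtain ⟨δ, hδ, hδC⟩ : ∃ δ > 0, C * δ < ε/3 := by
      refine ⟨ε/3/(C+1), by positivity, ?_⟩
      rw [mul_div_assoc', div_lt_iff₀ (by positivity)]
      nlinarith
    let I := {i : ℕ // d i ∈ ball x (r/2)}
    have hcov : closedBall x (r/4) ⊆ ⋃ i : I, ball (d i.1) δ := by
      intro z hz
      have hopen : IsOpen (ball x (r/2) ∩ ball z δ) := isOpen_ball.inter isOpen_ball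
      have hne : (ball x (r/2) ∩ ball z δ).Nonempty :=
        ⟨z, by rw [mem_closedBall] at hz; rw [mem_ball]; linarith, mem_ball_self hδ⟩
      obtain ⟨i, hi⟩ := (TopologicalSpace.denseRange_denseSeq ℂ).exists_mem_open hopen hne
      exact Set.mem_iUnion.2 ⟨⟨i, hi.1⟩, by rw [mem_ball_comm]; exact hi.2⟩
    obtain ⟨t, ht⟩ := (isCompact_closedBall x (r/4)).elim_finite_subcover _
      (fun i : I => isOpen_ball) hcov
    have hev : ∀ i ∈ t, ∃ N, ∀ m ≥ N, ∀ n ≥ N, dist (F (φ m) (d i.1)) (F (φ n) (d i.1)) < ε/3 := by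
      intro i _
      have h1 : Tendsto (fun n => Φ (φ n) i.1) atTop (𝓝 (a i.1)) := by
        have := (tendsto_pi_nhds.1 hlim) i.1
        exact this
      have h2 : ∀ n, Φ n i.1 = F n (d i.1) := fun n => by
        have : d i.1 ∈ U := hrU (ball_subset_ball (by linarith) i.2)
        simp [Φ, this]
      simp only [h2] at h1
      exact Metric.cauchySeq_iff.1 h1.cauchySeq (ε/3) (by positivity)
    choose! N hN using hev
    refine ⟨t.sup N, fun m hm n hn z hz => ?_⟩
    obtain ⟨i, hit, hi⟩ : ∃ i ∈ t, z ∈ ball (d i.1) δ := by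
      have := ht (ball_subset_closedBall hz)
      simpa using this
    have hz2 : z ∈ ball x (r/2) := ball_subset_ball (by linarith) hz
    have hl : ∀ k, dist (F k z) (F k (d i.1)) < ε/3 := by
      intro k
      rw [dist_eq_norm]
      refine (lip_of_bdd hr ((hF k).mono hrU) (hM k) i.2 hz2).trans_lt ?_
      refine lt_of_le_of_lt ?_ hδC
      rw [mem_ball, dist_eq_norm] at hi
      exact mul_le_mul_of_nonneg_left hi.le hC0
    have := hN i hit m ((Finset.le_sup hit).trans hm) n ((Finset.le_sup hit).trans hn)
    have h3 := dist_triangle4 (F (φ m) z) (F (φ m) (d i.1)) (F (φ n) (d i.1)) (F (φ n) z)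
    have h4 := hl (φ n)
    rw [dist_comm] at h4
    have h5 := hl (φ m)
    linarith
  have hpt : ∀ x ∈ U, ∃ y, Tendsto (fun j => F (φ j) x) atTop (𝓝 y) := by
    intro x hx
    obtain ⟨r, hr, -, hc⟩ := key x hx
    exact cauchySeq_tendsto_of_complete (hc.cauchySeq (mem_ball_self hr))
  choose! g hg using hpt
  refine ⟨g, ?_⟩
  rw [tendstoLocallyUniformlyOn_iff_forall_tendsto]
  intro x hx
  obtain ⟨r, hr, hrU, hc⟩ := key x hx
  have hu := hc.tendstoUniformlyOn_of_tendsto (f := g) (fun z hz => hg z (hrU hz))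
  rw [tendstoUniformlyOn_iff_tendsto] at hu
  refine hu.mono_left (prod_mono_right _ ?_)
  rw [le_principal_iff]
  exact mem_nhdsWithin_of_mem_nhds (ball_mem_nhds x hr)

/-- Hurwitz-type lemma. -/
lemma hurwitz {ι : Type*} {l : Filter ι} {U : Set ℂ} (hU : IsOpen U) {F : ι → ℂ → ℂ} {g : ℂ → ℂ}
    (hF : ∀ᶠ n in l, DifferentiableOn ℂ (F n) U) (hg : DifferentiableOn ℂ g U)
    (hlim : TendstoLocallyUniformlyOn F g l U) {z₀ : ℂ} (hz₀ : z₀ ∈ U)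
    (hnc : ¬ ∀ᶠ z in 𝓝 z₀, g z = g z₀) {V : Set ℂ} (hV : V ∈ 𝓝 z₀) :
    ∀ᶠ n in l, ∃ z ∈ V, F n z = g z₀ := by
  have han : AnalyticAt ℂ (fun z => g z - g z₀) z₀ :=
    ((hg.analyticAt (hU.mem_nhds hz₀))).sub analyticAt_const
  have hne : ∀ᶠ z in 𝓝[≠] z₀, g z - g z₀ ≠ 0 := by
    rcases han.eventually_eq_zero_or_eventually_ne_zero with h | h
    · exact absurd (h.mono fun z hz => sub_eq_zero.1 hz) hnc
    · exact h
  rw [eventually_nhdsWithin_iff] at hne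
  obtain ⟨r, hr, hrs⟩ : ∃ r > 0, closedBall z₀ r ⊆
      {z | z ∈ ({z₀}ᶜ : Set ℂ) → g z - g z₀ ≠ 0} ∩ (U ∩ V) :=
    nhds_basis_closedBall.mem_iff.1 (inter_mem hne (inter_mem (hU.mem_nhds hz₀) hV))
  have hcU : closedBall z₀ r ⊆ U := fun z hz => (hrs hz).2.1
  obtain ⟨w, hw, hmin⟩ := (isCompact_sphere z₀ r).exists_isMinOn
    (NormedSpace.sphere_nonempty.2 hr.le) (f := fun z => ‖g z - g z₀‖)
    (((hg.continuousOn.mono (sphere_subset_closedBall.trans hcU)).sub continuousOn_const).norm)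
  set e := ‖g w - g z₀‖ with he
  have he0 : 0 < e := by
    refine norm_pos_iff.2 ((hrs (sphere_subset_closedBall hw)).1 ?_)
    intro h
    rw [Set.mem_singleton_iff] at h
    rw [h, mem_sphere, dist_self] at hw
    exact hr.ne hw
  have hun := (tendstoLocallyUniformlyOn_iff_forall_isCompact hU).1 hlim _ hcU
    (isCompact_closedBall z₀ r)
  rw [Metric.tendstoUniformlyOn_iff] at hun
  filter_upwards [hF, hun (e/8) (by positivity)] with n hn hclose
  have hz0c := hclose z₀ (mem_closedBall_self hr.le)
  have hsph : ∀ z ∈ sphere z₀ r, e/2 ≤ ‖F n z - F n z₀‖ := by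
    intro z hz
    have h1 : e ≤ ‖g z - g z₀‖ := hmin hz
    have h2 := hclose z (sphere_subset_closedBall hz)
    rw [← dist_eq_norm] at h1 ⊢
    have := dist_triangle4 (g z) (F n z) (F n z₀) (g z₀)
    rw [dist_comm (F n z₀)] at this
    linarith
  have hfr : ∃ᶠ z in 𝓝 z₀, F n z ≠ F n z₀ := by
    intro hcon
    have hcon' : ∀ᶠ z in 𝓝 z₀, F n z = F n z₀ := hcon.mono fun z hz => not_not.1 hz
    have han1 : AnalyticOnNhd ℂ (F n) (closedBall z₀ r) := fun z hz =>
      hn.analyticAt (hU.mem_nhds (hcU hz))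
    have := han1.eqOn_of_preconnected_of_eventuallyEq (g := fun _ => F n z₀) analyticOnNhd_const
      (convex_closedBall z₀ r).isPreconnected (mem_closedBall_self hr.le) hcon'
    have h3 := hsph w hw
    rw [this (sphere_subset_closedBall hw)] at h3
    simp at h3
    linarith
  have := ((hn.mono hcU).diffContOnCl_ball (le_refl _)).ball_subset_image_closedBall hr hsph hfr
  obtain ⟨z, hz, hzz⟩ := this (show g z₀ ∈ ball (F n z₀) (e/2/2) by rw [mem_ball]; linarith)
  exact ⟨z, (hrs hz).2.2, hzz⟩

def dbar (u : ℂ → ℂ) (w : ℂ) : ℂ := fderiv ℝ u w 1 + Complex.I * fderiv ℝ u w Complex.I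

open MeasureTheory in
lemma pompeiu_aux {u : ℂ → ℂ} (hu : ContDiff ℝ 1 u) (hs : HasCompactSupport u) (z : ℂ) :
    ∫ w, dbar u (z + w) * w⁻¹ = - (2 * Real.pi * u z) := by
  set e : ℝ → ℂ := fun θ => Complex.exp (θ * Complex.I) with he
  have hec : Continuous e := by fun_prop
  let P : ℝ × ℝ → ℂ := fun p => fderiv ℝ u (z + p.1 * e p.2) (e p.2)
  let Q : ℝ × ℝ → ℂ := fun p => fderiv ℝ u (z + p.1 * e p.2) (Complex.I * e p.2)
  have hD : Continuous (fderiv ℝ u) := hu.continuous_fderiv (by norm_num)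
  have hPc : Continuous P := by
    refine Continuous.clm_apply (hD.comp ?_) ?_ <;> fun_prop
  have hQc : Continuous Q := by
    refine Continuous.clm_apply (hD.comp ?_) ?_ <;> fun_prop
  -- support radius
  obtain ⟨R, hR⟩ : ∃ R : ℝ, ∀ w, R < ‖w‖ → fderiv ℝ u (z + w) = 0 ∧ u (z + w) = 0 := by
    obtain ⟨R, hR⟩ := hs.isCompact.isBounded.subset_closedBall z
    refine ⟨R, fun w hw => ?_⟩
    have h1 : z + w ∉ tsupport u := fun h => by
      have := hR h
      rw [mem_closedBall, dist_eq_norm, add_sub_cancel_left] at this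
      linarith
    exact ⟨notMem_support.1 fun h => h1 (support_fderiv_subset ℝ h), image_eq_zero_of_notMem_tsupport h1⟩
  have hne : ∀ θ, ‖e θ‖ = 1 := fun θ => Complex.norm_exp_ofReal_mul_I θ
  have hnn : ∀ r θ : ℝ, ‖(r : ℂ) * e θ‖ = |r| := fun r θ => by simp [hne]
  set S : Set (ℝ × ℝ) := Set.Ioi (0:ℝ) ×ˢ Set.Ioo (-Real.pi) Real.pi with hS
  have hSm : MeasurableSet S := measurableSet_Ioi.prod measurableSet_Ioo
  have hint : ∀ H : ℝ × ℝ → ℂ, Continuous H → (∀ p : ℝ × ℝ, R < |p.1| → H p = 0) →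
      IntegrableOn H S := by
    intro H hH h0
    have h1 : IntegrableOn H (Set.Icc 0 R ×ˢ Set.Icc (-Real.pi) Real.pi) :=
      hH.continuousOn.integrableOn_compact (isCompact_Icc.prod isCompact_Icc)
    refine h1.of_forall_sdiff_eq_zero hSm ?_
    rintro ⟨r, θ⟩ ⟨h2, h3⟩
    apply h0
    simp only [hS, Set.mem_prod, Set.mem_Ioi, Set.mem_Ioo, Set.mem_Icc, not_and, not_le] at h2 h3 ⊢
    by_contra h4
    push Not at h4
    rw [abs_of_pos h2.1] at h4
    exact absurd (h3 ⟨h2.1.le, h4⟩ h2.2.1.le) (not_lt.2 h2.2.2.le)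
  have hPi : IntegrableOn P S := hint P hPc fun p hp => by
    simp only [P]; rw [(hR _ (by rwa [hnn])).1]; simp
  have hQi : IntegrableOn Q S := hint Q hQc fun p hp => by
    simp only [Q]; rw [(hR _ (by rwa [hnn])).1]; simp
  have hder : ∀ (w v : ℂ), HasFDerivAt u (fderiv ℝ u w) w := fun w v =>
    (hu.differentiable (by norm_num) w).hasFDerivAt
  rw [← Complex.integral_comp_polarCoord_symm]
  have hval : ∀ p ∈ polarCoord.target, p.1 • (dbar u (z + Complex.polarCoord.symm p) *
      (Complex.polarCoord.symm p)⁻¹) = P p + Complex.I * Q p := by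
    rintro ⟨r, θ⟩ hp
    have hr : 0 < r := by simpa [polarCoord_target] using hp.1
    have hsym : Complex.polarCoord.symm (r, θ) = r * e θ := by
      rw [Complex.polarCoord_symm_apply, he]; simp only; rw [Complex.exp_mul_I]
      push_cast; ring
    rw [hsym]
    simp only [P, Q, dbar]
    set Lm := fderiv ℝ u (z + r * e θ)
    have hlin : ∀ a b : ℝ, Lm (a + b * Complex.I) = a * Lm 1 + b * Lm Complex.I := by
      intro a b
      have : ((a:ℂ) + b * Complex.I) = a • (1:ℂ) + b • Complex.I := by simp
      rw [this, map_add, map_smul, map_smul]; simp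
    have e1 : e θ = (Real.cos θ : ℝ) + (Real.sin θ : ℝ) * Complex.I := by
      rw [he]; simp only; rw [Complex.exp_mul_I]; push_cast; ring
    have e2 : Complex.I * e θ = ((-Real.sin θ : ℝ) : ℂ) + (Real.cos θ : ℝ) * Complex.I := by
      rw [e1]; push_cast; linear_combination (Complex.sin θ) * Complex.I_mul_I
    have e3 : (e θ)⁻¹ = (Real.cos θ : ℝ) - (Real.sin θ : ℝ) * Complex.I := by
      rw [he]; simp only
      rw [← Complex.exp_neg, show -((θ:ℂ) * Complex.I) = ((-θ : ℝ) : ℂ) * Complex.I by push_cast; ring,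
        Complex.exp_mul_I]
      push_cast; rw [Complex.cos_neg, Complex.sin_neg]; ring
    have hrc : (r:ℂ) ≠ 0 := by exact_mod_cast hr.ne'
    rw [Complex.real_smul, mul_inv, e3, e2, hlin, e1, hlin]
    have : (r:ℂ) * ((Lm 1 + Complex.I * Lm Complex.I) * ((r:ℂ)⁻¹ * (((Real.cos θ : ℝ):ℂ) - (Real.sin θ : ℝ) * Complex.I)))
      = (Lm 1 + Complex.I * Lm Complex.I) * (((Real.cos θ : ℝ):ℂ) - (Real.sin θ : ℝ) * Complex.I) := by
      field_simp
    rw [this]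
    push_cast
    linear_combination (- Complex.sin θ * Lm Complex.I) * Complex.I_mul_I
  rw [setIntegral_congr_fun polarCoord.open_target.measurableSet hval]
  rw [show polarCoord.target = S from rfl]
  rw [integral_add hPi (hQi.const_mul _), integral_const_mul]
  have hQ0 : ∫ p in S, Q p = 0 := by
    rw [hS, Measure.volume_eq_prod, setIntegral_prod _ (by rw [← Measure.volume_eq_prod]; exact hQi)]
    rw [setIntegral_congr_fun (g := fun _ => (0:ℂ)) measurableSet_Ioi, integral_zero]
    intro r hr
    have hr0 : (0:ℝ) < r := hr
    have hrc : (r:ℂ) ≠ 0 := by exact_mod_cast hr0.ne'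
    simp only
    rw [← integral_Ioc_eq_integral_Ioo, ← intervalIntegral.integral_of_le (by linarith [Real.pi_pos])]
    have hd : ∀ θ ∈ Set.uIcc (-Real.pi) Real.pi,
        HasDerivAt (fun θ : ℝ => u (z + r * e θ)) ((r:ℂ) * Q (r, θ)) θ := by
      intro θ _
      have h1 : HasDerivAt (fun θ : ℝ => z + r * e θ) (r * (e θ * Complex.I)) θ := by
        have : HasDerivAt (fun θ : ℝ => (θ:ℂ) * Complex.I) Complex.I θ := by
          simpa using (Complex.ofRealCLM.hasDerivAt (x := θ)).mul_const Complex.I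
        exact (this.cexp.const_mul (r:ℂ)).const_add z
      have h2 := (hder (z + r * e θ) 0).comp_hasDerivAt θ h1
      have h5 : (r:ℂ) * Q (r, θ) = fderiv ℝ u (z + r * e θ) (r * (e θ * Complex.I)) := by
        change (r:ℂ) * fderiv ℝ u (z + r * e θ) (Complex.I * e θ) = _
        rw [← Complex.real_smul, ← map_smul, Complex.real_smul, mul_comm Complex.I]
      rw [h5]; exact h2
    have h3 := intervalIntegral.integral_eq_sub_of_hasDerivAt hd
      ((Continuous.intervalIntegrable (by fun_prop) _ _))
    rw [intervalIntegral.integral_const_mul] at h3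
    have h4 : e (-Real.pi) = e Real.pi := by
      rw [he]; beta_reduce
      rw [Complex.exp_mul_I, Complex.exp_mul_I]; simp
    rw [h4, sub_self] at h3
    exact (mul_eq_zero.1 h3).resolve_left hrc
  have hP0 : ∫ p in S, P p = -(2 * Real.pi * u z) := by
    rw [hS, Measure.volume_eq_prod, ← Measure.prod_restrict, integral_prod_symm _
      (by rw [Measure.prod_restrict, ← Measure.volume_eq_prod]; exact hPi)]
    rw [setIntegral_congr_fun (g := fun _ => - u z) measurableSet_Ioo]
    · simp [Real.pi_pos.le]; ring_nf
      simp
    intro θ hθ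
    simp only
    have hd : ∀ r ∈ Set.Ici (0:ℝ), HasDerivAt (fun r : ℝ => u (z + r * e θ)) (P (r, θ)) r := by
      intro r _
      have h1 : HasDerivAt (fun r : ℝ => z + r * e θ) (e θ) r := by
        simpa using ((Complex.ofRealCLM.hasDerivAt (x := r)).mul_const (e θ)).const_add z
      exact (hder (z + r * e θ) 0).comp_hasDerivAt r h1
    have hi : IntegrableOn (fun r => P (r, θ)) (Set.Ioi 0) := by
      have h1 : IntegrableOn (fun r => P (r, θ)) (Set.Icc 0 R) :=
        (Continuous.continuousOn (by fun_prop)).integrableOn_compact isCompact_Icc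
      refine h1.of_forall_sdiff_eq_zero measurableSet_Ioi ?_
      rintro r ⟨h2, h3⟩
      have : R < r := by
        by_contra h; push Not at h; exact h3 ⟨le_of_lt h2, h⟩
      simp only [P]; rw [(hR _ (by rw [hnn, abs_of_pos h2]; exact this)).1]; simp
    have ht : Tendsto (fun r : ℝ => u (z + r * e θ)) atTop (𝓝 0) := by
      refine tendsto_const_nhds.congr' ?_
      filter_upwards [eventually_gt_atTop R, eventually_gt_atTop 0] with r h1 h2
      exact ((hR _ (by rw [hnn, abs_of_pos h2]; exact h1)).2).symm
    rw [integral_Ioi_of_hasDerivAt_of_tendsto' hd hi ht]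
    simp
  rw [hQ0, hP0]; simp

open MeasureTheory in
lemma pompeiu {u : ℂ → ℂ} (hu : ContDiff ℝ 1 u) (hs : HasCompactSupport u) (z : ℂ) :
    ∫ w, dbar u w * (w - z)⁻¹ = - (2 * Real.pi * u z) := by
  rw [← pompeiu_aux hu hs z, ← integral_add_left_eq_self (μ := volume) _ z]
  simp

def InHull (K : Set ℂ) (z : ℂ) : Prop :=
  ∀ P : Polynomial ℂ, ∀ M : ℝ, (∀ x ∈ K, ‖P.eval x‖ ≤ M) → ‖P.eval z‖ ≤ M

lemma inv_mem_closure {K : Set ℂ} [CompactSpace K] (hne : K.Nonempty)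
    (hhull : ∀ z, InHull K z → z ∈ K) {w : ℂ} (hw : w ∉ K) (h : C(K, ℂ))
    (hh : ∀ z : K, h z = (w - z)⁻¹) : h ∈ (polynomialFunctions K).topologicalClosure := by
  have : Nonempty K := hne.to_subtype
  let A := (polynomialFunctions K).topologicalClosure
  have hAc : IsClosed (A : Set C(K, ℂ)) := Subalgebra.isClosed_topologicalClosure _
  have : CompleteSpace A := hAc.completeSpace_coe
  let x0 : C(K, ℂ) := Polynomial.X.toContinuousMapOn K
  have hx0 : x0 ∈ A := Subalgebra.le_topologicalClosure _ ⟨Polynomial.X, by trivial, rfl⟩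
  let x : A := ⟨x0, hx0⟩
  have : NormOneClass A := ⟨by
    change ‖(1 : C(K, ℂ))‖ = 1
    exact norm_one⟩
  have hsp : w ∉ spectrum ℂ x := by
    intro hmem
    apply hw
    apply hhull
    intro P M hM
    have h1 : P.eval w ∈ spectrum ℂ (Polynomial.aeval x P) :=
      spectrum.subset_polynomial_aeval x P ⟨w, hmem, rfl⟩
    have h2 := spectrum.norm_le_norm_of_mem h1
    refine h2.trans ?_
    change ‖((Polynomial.aeval x P : A) : C(K, ℂ))‖ ≤ M
    have hM0 : 0 ≤ M := by
      obtain ⟨a, ha⟩ := hne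
      exact (norm_nonneg _).trans (hM a ha)
    rw [ContinuousMap.norm_le _ hM0]
    intro a
    have h3 : ((Polynomial.aeval x P : A) : C(K, ℂ)) = Polynomial.aeval x0 P :=
      (Polynomial.aeval_algHom_apply A.val x P).symm
    rw [h3, Polynomial.aeval_continuousMap_apply]
    simpa [x0] using hM a a.2
  rw [spectrum.notMem_iff] at hsp
  obtain ⟨v, hv⟩ := hsp
  have h4 : h = ((v⁻¹ : Aˣ) : A).1 := by
    ext z
    have h5 : ((v : A) * ((v⁻¹ : Aˣ) : A)).1 z = 1 := by rw [v.mul_inv]; rfl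
    rw [hv] at h5
    have h6 : ((algebraMap ℂ A w - x) * ((v⁻¹ : Aˣ) : A)).1 z = (w - z) * (((v⁻¹ : Aˣ) : A).1 z) := by
      change ((algebraMap ℂ C(K, ℂ) w - x0) * ((v⁻¹ : Aˣ) : A).1) z = _
      simp [x0]
    rw [h6] at h5
    rw [hh]
    exact (eq_inv_of_mul_eq_one_right h5).symm
  rw [h4]
  exact ((v⁻¹ : Aˣ) : A).2

open MeasureTheory Manifold in
lemma runge {F K : Set ℂ} {g : ℂ → ℂ} (hF : IsOpen F)
    (hhull : ∀ K ⊆ F, IsCompact K → ∀ z, InHull K z → z ∈ F)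
    (hg : DifferentiableOn ℂ g F) (hKF : K ⊆ F) (hK : IsCompact K) {ε : ℝ} (hε : 0 < ε) :
    ∃ P : Polynomial ℂ, ∀ x ∈ K, ‖g x - P.eval x‖ < ε := by
  rcases K.eq_empty_or_nonempty with rfl | hne
  · exact ⟨0, by simp⟩
  set K1 : Set ℂ := {z | InHull K z} with hK1
  have hKK1 : K ⊆ K1 := fun z hz P M hM => hM z hz
  have hK1F : K1 ⊆ F := fun z hz => hhull K hKF hK z hz
  have hK1c : IsCompact K1 := by
    refine isCompact_of_isClosed_isBounded ?_ ?_
    · have : K1 = ⋂ (P : Polynomial ℂ) (M : ℝ) (_ : ∀ x ∈ K, ‖P.eval x‖ ≤ M), {z | ‖P.eval z‖ ≤ M} := by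
        ext z; simp [hK1, InHull]
      rw [this]
      refine isClosed_iInter fun P => isClosed_iInter fun M => isClosed_iInter fun _ => ?_
      exact isClosed_le (P.continuous.norm) continuous_const
    · obtain ⟨R, hR⟩ := hK.isBounded.exists_norm_le
      refine isBounded_iff_forall_norm_le.2 ⟨R, fun z hz => ?_⟩
      simpa using hz Polynomial.X R (by simpa using hR)
  have hK1h : ∀ z, InHull K1 z → z ∈ K1 := fun z hz P M hM => hz P M fun x hx => hx P M hM
  obtain ⟨K2, hK2c, h12, h2F⟩ := exists_compact_between hK1c hF hK1F
  obtain ⟨χ, hχ1, hχ0, -⟩ := exists_contMDiffMap_one_nhds_of_subset_interior (n := 1) 𝓘(ℝ, ℂ)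
    hK1c.isClosed h12
  have hχc : ContDiff ℝ 1 χ := χ.contMDiff.contDiff
  set u : ℂ → ℂ := fun z => (χ z : ℂ) * g z with hu
  have hu0 : ∀ x ∉ K2, u x = 0 := fun x hx => by simp [hu, hχ0 x hx]
  have huc : ContDiff ℝ 1 u := by
    rw [contDiff_iff_contDiffAt]
    intro x
    by_cases hx : x ∈ F
    · have h1 : ContDiffAt ℂ 1 g x := (hg.analyticAt (hF.mem_nhds hx)).contDiffAt
      exact (Complex.ofRealCLM.contDiff.contDiffAt.comp x hχc.contDiffAt).mul (h1.restrict_scalars ℝ)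
    · have : u =ᶠ[𝓝 x] fun _ => 0 := by
        filter_upwards [hK2c.isClosed.isOpen_compl.mem_nhds (fun h => hx (h2F h))] with y hy
        exact hu0 y hy
      exact contDiffAt_const.congr_of_eventuallyEq this
  have hus : HasCompactSupport u := HasCompactSupport.intro hK2c hu0
  have hdc : Continuous (dbar u) := by
    have := huc.continuous_fderiv (by norm_num)
    unfold dbar; fun_prop
  have hds : HasCompactSupport (dbar u) := by
    refine HasCompactSupport.intro hus.isCompact fun x hx => ?_
    have : fderiv ℝ u x = 0 := notMem_support.1 fun h => hx (support_fderiv_subset ℝ h)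
    simp [dbar, this]
  obtain ⟨O, hO, hKO, hOu⟩ : ∃ O, IsOpen O ∧ K1 ⊆ O ∧ ∀ z ∈ O, u z = g z ∧ dbar u z = 0 := by
    obtain ⟨O, hO, hKO, h1⟩ := (eventually_nhdsSet_iff_exists).1 hχ1
    refine ⟨O ∩ F, hO.inter hF, Set.subset_inter hKO hK1F, fun z hz => ⟨by simp [hu, h1 z hz.1], ?_⟩⟩
    have h2 : u =ᶠ[𝓝 z] g := by
      filter_upwards [hO.mem_nhds hz.1] with y hy
      simp [hu, h1 y hy]
    have h3 := (hg.differentiableAt (hF.mem_nhds hz.2)).hasFDerivAt.restrictScalars ℝ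
    rw [dbar, h2.fderiv_eq, h3.fderiv]
    have h4 : (fderiv ℂ g z) Complex.I = Complex.I * fderiv ℂ g z 1 := by
      rw [← smul_eq_mul, ← map_smul]; simp
    simp only [ContinuousLinearMap.coe_restrictScalars', h4]
    linear_combination (fderiv ℂ g z 1) * Complex.I_mul_I
  have : CompactSpace K1 := isCompact_iff_compactSpace.1 hK1c
  have hj : Continuous (fun p : ℂ × K1 => dbar u p.1 * (p.1 - p.2)⁻¹) := by
    rw [continuous_iff_continuousAt]
    rintro ⟨w, z⟩
    by_cases hw : w ∈ O
    · have : (fun p : ℂ × K1 => dbar u p.1 * (p.1 - p.2)⁻¹) =ᶠ[𝓝 (w, z)] fun _ => 0 := by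
        filter_upwards [continuous_fst.continuousAt.preimage_mem_nhds (hO.mem_nhds hw)] with p hp
        rw [(hOu p.1 hp).2, zero_mul]
      exact continuousAt_const.congr this.symm
    · have hne : w - z ≠ 0 := fun h => hw (by rw [sub_eq_zero.1 h]; exact hKO z.2)
      exact (hdc.continuousAt.comp continuousAt_fst).mul
        (ContinuousAt.inv₀ (by fun_prop) hne)
  let G0 : ℂ → C(K1, ℂ) := fun w => ⟨fun z => dbar u w * (w - z)⁻¹,
    hj.comp (continuous_const.prodMk continuous_id)⟩
  have hG0c : Continuous G0 := ContinuousMap.continuous_of_continuous_uncurry G0 hj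
  let A := (polynomialFunctions K1).topologicalClosure
  have hAc : IsClosed (A : Set C(K1, ℂ)) := Subalgebra.isClosed_topologicalClosure _
  have : CompleteSpace A := hAc.completeSpace_coe
  have hGA : ∀ w, G0 w ∈ A := by
    intro w
    by_cases hw : w ∈ K1
    · have : G0 w = 0 := by
        ext z; simp [G0, (hOu w (hKO hw)).2]
      rw [this]; exact zero_mem _
    · have hc : Continuous (fun z : K1 => (w - z : ℂ)⁻¹) :=
        Continuous.inv₀ (by fun_prop) fun z h => hw (by rw [sub_eq_zero.1 h]; exact z.2)
      have := inv_mem_closure (hne.mono hKK1) hK1h hw ⟨_, hc⟩ fun z => rfl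
      have h2 : G0 w = dbar u w • ⟨_, hc⟩ := by ext z; simp [G0]
      rw [h2]; exact A.smul_mem this _
  let G : ℂ → A := fun w => ⟨G0 w, hGA w⟩
  have hGc : Continuous G := hG0c.subtype_mk _
  have hGi : Integrable G volume := by
    refine hGc.integrable_of_hasCompactSupport (HasCompactSupport.intro hds.isCompact fun w hw => ?_)
    have : dbar u w = 0 := image_eq_zero_of_notMem_tsupport hw
    apply Subtype.ext
    ext z
    simp [G, G0, this]
  have hev : ∀ z : K1, (∫ w, G w : A).1 z = -(2 * Real.pi * g z) := by
    intro z
    let ev : A →L[ℂ] ℂ := (ContinuousMap.evalCLM ℂ z).comp A.toSubmodule.subtypeL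
    have h1 := ev.integral_comp_comm hGi
    change _ = (∫ w, G w : A).1 z at h1
    rw [← h1]
    change ∫ w, dbar u w * (w - z)⁻¹ = _
    rw [pompeiu huc hus, (hOu z (hKO z.2)).1]
  set a : A := (-(2 * Real.pi : ℂ)⁻¹) • (∫ w, G w) with ha
  have ha1 : ∀ z : K1, a.1 z = g z := by
    intro z
    have : a.1 z = (-(2 * Real.pi : ℂ)⁻¹) * (∫ w, G w : A).1 z := rfl
    rw [this, hev]
    have : (Real.pi : ℂ) ≠ 0 := by exact_mod_cast Real.pi_ne_zero
    field_simp
  have hcl : a.1 ∈ closure (polynomialFunctions K1 : Set C(K1, ℂ)) := a.2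
  obtain ⟨b, ⟨P, -, hP⟩, hb⟩ := Metric.mem_closure_iff.1 hcl ε hε
  refine ⟨P, fun x hx => ?_⟩
  have h1 := (ContinuousMap.dist_apply_le_dist (f := a.1) (g := b) ⟨x, hKK1 hx⟩).trans_lt hb
  rw [ha1, ← hP, dist_eq_norm] at h1
  exact h1

lemma comp_diff_open {F : Set ℂ} (hF : IsOpen F) (p : ℂ) :
    IsOpen (F \ connectedComponentIn F p) := by
  rw [isOpen_iff_mem_nhds]
  rintro x ⟨hx, hxp⟩
  filter_upwards [hF.connectedComponentIn.mem_nhds (mem_connectedComponentIn hx)] with y hy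
  refine ⟨connectedComponentIn_subset _ _ hy, fun h => hxp ?_⟩
  rw [connectedComponentIn_eq h, ← connectedComponentIn_eq hy]
  exact mem_connectedComponentIn hx

lemma exists_primitive {F : Set ℂ} {p : ℂ} {g : ℂ → ℂ} (hF : IsOpen F)
    (hhull : ∀ K ⊆ F, IsCompact K → ∀ z, InHull K z → z ∈ F)
    (hg : DifferentiableOn ℂ g (connectedComponentIn F p)) (hp : p ∈ F) :
    ∃ G : ℂ → ℂ, ∀ z ∈ connectedComponentIn F p, HasDerivAt G (g z) z := by
  set V := connectedComponentIn F p with hV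
  have hVo : IsOpen V := hF.connectedComponentIn
  have hVF : V ⊆ F := connectedComponentIn_subset _ _
  have hpV : p ∈ V := mem_connectedComponentIn hp
  classical
  set g' : ℂ → ℂ := V.indicator g with hg'
  have hg'd : DifferentiableOn ℂ g' F := by
    intro x hx
    by_cases hxV : x ∈ V
    · have : g' =ᶠ[𝓝 x] g := by
        filter_upwards [hVo.mem_nhds hxV] with y hy
        simp [hg', hy]
      exact ((hg.differentiableAt (hVo.mem_nhds hxV)).congr_of_eventuallyEq this).differentiableWithinAt
    · have : g' =ᶠ[𝓝 x] fun _ => 0 := by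
        filter_upwards [(comp_diff_open hF p).mem_nhds ⟨hx, hxV⟩] with y hy
        simp [hg', show y ∉ V from hy.2]
      exact ((differentiableAt_const _).congr_of_eventuallyEq this).differentiableWithinAt
  have : LocallyCompactSpace V := hVo.locallyCompactSpace
  let E : CompactExhaustion V := default
  have hE : ∀ n, ∃ P : Polynomial ℂ, ∀ x ∈ (fun z : V => (z:ℂ)) '' E n, ‖g' x - P.eval x‖ < 1 / ((n:ℝ) + 1) := by
    intro n
    refine runge hF hhull hg'd ?_ ((E.isCompact n).image continuous_subtype_val) (by positivity)
    rintro _ ⟨x, -, rfl⟩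
    exact hVF x.2
  choose P hP using hE
  have hQ : ∀ n, ∃ Q : ℂ → ℂ, Q p = 0 ∧ ∀ z, HasDerivAt Q ((P n).eval z) z := by
    intro n
    obtain ⟨Q, h1, h2⟩ := ((P n).differentiable.isExactOn_univ).with_val_at p 0
    exact ⟨Q, h1, fun z => h2 z trivial⟩
  choose Q hQ0 hQd using hQ
  have hlim : TendstoLocallyUniformlyOn (fun n z => (P n).eval z) g atTop V := by
    rw [tendstoLocallyUniformlyOn_iff_forall_isCompact hVo]
    intro K hK hKc
    rw [Metric.tendstoUniformlyOn_iff]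
    intro ε hε
    obtain ⟨N, hN⟩ := E.exists_superset_of_isCompact
      (s := (fun z : V => (z:ℂ)) ⁻¹' K) (by
        rw [Topology.IsInducing.subtypeVal.isCompact_iff, Set.image_preimage_eq_inter_range]
        simpa [Set.inter_eq_left.2 hK] using hKc)
    filter_upwards [eventually_ge_atTop N, (tendsto_one_div_add_atTop_nhds_zero_nat (𝕜 := ℝ)).eventually (gt_mem_nhds hε)] with n hn hn2 x hx
    have h1 := hP n x ⟨⟨x, hK hx⟩, E.subset hn (hN (by simpa using hx)), rfl⟩
    rw [hg', Set.indicator_of_mem (hK hx)] at h1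
    rw [dist_eq_norm]
    exact h1.trans hn2
  have hball : ∀ x ∈ V, ∃ r > 0, ball x r ⊆ V ∧ ∀ a ∈ ball x r, ∀ b ∈ ball x r,
      Cauchy (map (fun n => Q n a) atTop) → Cauchy (map (fun n => Q n b) atTop) := by
    intro x hx
    obtain ⟨r, hr, hrV⟩ := Metric.nhds_basis_closedBall.mem_iff.1 (hVo.mem_nhds hx)
    refine ⟨r, hr, ball_subset_closedBall.trans hrV, fun a ha b hb hc => ?_⟩
    have h1 := ((tendstoLocallyUniformlyOn_iff_forall_isCompact hVo).1 hlim _ hrV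
      (isCompact_closedBall x r)).mono ball_subset_closedBall
    have h2 : UniformCauchySeqOn (fun n z => (ContinuousLinearMap.toSpanSingleton ℂ ((P n).eval z) : ℂ →L[ℂ] ℂ)) atTop (ball x r) := by
      have := h1.uniformCauchySeqOn
      rw [Metric.uniformCauchySeqOn_iff] at this ⊢
      intro ε hε
      obtain ⟨N, hN⟩ := this ε hε
      refine ⟨N, fun m hm n hn z hz => ?_⟩
      have h3 := hN m hm n hn z hz
      rw [dist_eq_norm] at h3 ⊢
      have h4 : ContinuousLinearMap.toSpanSingleton ℂ ((P m).eval z) -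
          ContinuousLinearMap.toSpanSingleton ℂ ((P n).eval z) =
          ContinuousLinearMap.toSpanSingleton ℂ ((P m).eval z - (P n).eval z) := by
        ext; simp
      rw [h4, ContinuousLinearMap.norm_toSpanSingleton]
      exact h3
    exact cauchy_map_of_uniformCauchySeqOn_fderiv isOpen_ball (convex_ball x r).isPreconnected h2
      (fun n y _ => (hQd n y).hasFDerivAt) ha hb hc
  have hS : V ⊆ {z ∈ V | Cauchy (map (fun n => Q n z) atTop)} := by
    refine IsPreconnected.subset_left_of_subset_union (v := {z ∈ V | ¬ Cauchy (map (fun n => Q n z) atTop)})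
      ?_ ?_ ?_ ?_ ?_ isPreconnected_connectedComponentIn
    · rw [isOpen_iff_mem_nhds]
      rintro x ⟨hx, hc⟩
      obtain ⟨r, hr, hrV, h⟩ := hball x hx
      filter_upwards [ball_mem_nhds x hr] with y hy
      exact ⟨hrV hy, h x (mem_ball_self hr) y hy hc⟩
    · rw [isOpen_iff_mem_nhds]
      rintro x ⟨hx, hc⟩
      obtain ⟨r, hr, hrV, h⟩ := hball x hx
      filter_upwards [ball_mem_nhds x hr] with y hy
      exact ⟨hrV hy, fun h' => hc (h y hy x (mem_ball_self hr) h')⟩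
    · rw [Set.disjoint_left]
      rintro x ⟨-, h1⟩ ⟨-, h2⟩
      exact h2 h1
    · intro x hx
      by_cases h : Cauchy (map (fun n => Q n x) atTop)
      · exact Or.inl ⟨hx, h⟩
      · exact Or.inr ⟨hx, h⟩
    · refine ⟨p, hpV, hpV, ?_⟩
      simp only [hQ0]
      exact (tendsto_const_nhds (x := (0:ℂ))).cauchy_map
  have hex : ∀ z, ∃ a, z ∈ V → Tendsto (fun n => Q n z) atTop (𝓝 a) := by
    intro z
    by_cases hz : z ∈ V
    · obtain ⟨a, ha⟩ := CompleteSpace.complete (hS hz).2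
      exact ⟨a, fun _ => ha⟩
    · exact ⟨0, fun h => absurd h hz⟩
  choose G hG using hex
  exact ⟨G, fun z hz => hasDerivAt_of_tendstoLocallyUniformlyOn hVo hlim
    (Eventually.of_forall fun n x _ => hQd n x) (fun x hx => hG x hx) hz⟩

def HasSqrts (V : Set ℂ) : Prop :=
  ∀ g : ℂ → ℂ, DifferentiableOn ℂ g V → (∀ z ∈ V, g z ≠ 0) →
    ∃ s : ℂ → ℂ, DifferentiableOn ℂ s V ∧ ∀ z ∈ V, s z ^ 2 = g z

lemma hasSqrts_comp {F : Set ℂ} {p : ℂ} (hF : IsOpen F)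
    (hhull : ∀ K ⊆ F, IsCompact K → ∀ z, InHull K z → z ∈ F) (hp : p ∈ F) :
    HasSqrts (connectedComponentIn F p) := by
  intro g hg hg0
  set V := connectedComponentIn F p with hV
  have hVo : IsOpen V := hF.connectedComponentIn
  have hpV : p ∈ V := mem_connectedComponentIn hp
  obtain ⟨G, hG⟩ := exists_primitive (g := fun z => deriv g z / g z) hF hhull
    ((hg.deriv hVo).div hg hg0) hp
  have hGd : ∀ z ∈ V, HasDerivAt (fun z => g z * Complex.exp (-G z)) 0 z := by
    intro z hz
    have h1 := (hg.differentiableAt (hVo.mem_nhds hz)).hasDerivAt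
    have h2 := h1.mul (hG z hz).neg.cexp
    convert! h2 using 1
    field_simp [hg0 z hz]
    ring
  have hc : ∀ z ∈ V, g z * Complex.exp (-G z) = g p * Complex.exp (-G p) := fun z hz =>
    hVo.is_const_of_deriv_eq_zero isPreconnected_connectedComponentIn
      (fun x hx => (hGd x hx).differentiableAt.differentiableWithinAt) (fun x hx => (hGd x hx).deriv) hz hpV
  obtain ⟨c, hcc⟩ : ∃ c : ℂ, c ^ 2 = g p * Complex.exp (-G p) :=
    IsAlgClosed.exists_pow_nat_eq _ two_pos
  refine ⟨fun z => c * Complex.exp (G z / 2), fun z hz => ?_, fun z hz => ?_⟩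
  · exact (((hG z hz).differentiableAt.div_const 2).cexp.const_mul c).differentiableWithinAt
  · rw [mul_pow, hcc, ← hc z hz, ← Complex.exp_nat_mul, mul_assoc, ← Complex.exp_add]
    ring_nf; simp

open ComplexConjugate

def mob (a z : ℂ) : ℂ := (a - z) / (1 - conj a * z)

lemma mob_id (a z : ℂ) : ‖1 - conj a * z‖ ^ 2 - ‖a - z‖ ^ 2 = (1 - ‖a‖ ^ 2) * (1 - ‖z‖ ^ 2) := by
  simp only [← Complex.normSq_eq_norm_sq, Complex.normSq_apply]
  simp
  ring

lemma mob_den {a z : ℂ} (ha : ‖a‖ < 1) (hz : ‖z‖ < 1) : 1 - conj a * z ≠ 0 := by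
  intro h
  have h1 : conj a * z = 1 := (sub_eq_zero.1 h).symm
  have h2 : ‖a‖ * ‖z‖ = 1 := by
    rw [← RCLike.norm_conj a, ← norm_mul, h1, norm_one]
  nlinarith [norm_nonneg a, norm_nonneg z]

lemma mob_norm {a z : ℂ} (ha : ‖a‖ < 1) (hz : ‖z‖ < 1) : ‖mob a z‖ < 1 := by
  rw [mob, norm_div, div_lt_one (norm_pos_iff.2 (mob_den ha hz))]
  have h1 := mob_id a z
  have h2 : 0 < (1 - ‖a‖ ^ 2) * (1 - ‖z‖ ^ 2) := by
    apply mul_pos <;> nlinarith [norm_nonneg a, norm_nonneg z]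
  exact lt_of_pow_lt_pow_left₀ 2 (norm_nonneg _) (by linarith)

lemma mob_mob {a z : ℂ} (ha : ‖a‖ < 1) (hz : ‖z‖ < 1) : mob a (mob a z) = z := by
  have h1 := mob_den ha hz
  have h2 := mob_den ha (mob_norm ha hz)
  rw [mob, div_eq_iff h2]
  have h3 : mob a z * (1 - conj a * z) = a - z := div_mul_cancel₀ _ h1
  linear_combination -h3

lemma mob_zero (a : ℂ) : mob a 0 = a := by simp [mob]
lemma mob_self (a : ℂ) : mob a a = 0 := by simp [mob]

lemma mob_hasDerivAt {a z : ℂ} (ha : ‖a‖ < 1) (hz : ‖z‖ < 1) :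
    HasDerivAt (mob a) (-(1 - conj a * a) / (1 - conj a * z) ^ 2) z := by
  have h1 : HasDerivAt (fun z => a - z) (-1) z := by simpa using (hasDerivAt_id z).const_sub a
  have h2 : HasDerivAt (fun z => 1 - conj a * z) (-conj a) z := by
    simpa using ((hasDerivAt_id z).const_mul (conj a)).const_sub 1
  have h3 := h1.div h2 (mob_den ha hz)
  refine h3.congr_deriv ?_
  congr 1
  ring

lemma mob_diff {a : ℂ} (ha : ‖a‖ < 1) : DifferentiableOn ℂ (mob a) (ball 0 1) := fun z hz =>
  (mob_hasDerivAt ha (by simpa using hz)).differentiableAt.differentiableWithinAt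

lemma mob_maps {a : ℂ} (ha : ‖a‖ < 1) : Set.MapsTo (mob a) (ball 0 1) (ball 0 1) := fun z hz => by
  have := mob_norm ha (z := z) (by simpa using hz)
  simpa using this

lemma not_locconst {V : Set ℂ} {g : ℂ → ℂ} (hV : IsOpen V) (hi : Set.InjOn g V) {z : ℂ} (hz : z ∈ V) :
    ¬ ∀ᶠ w in 𝓝 z, g w = g z := by
  intro h
  have h2 : ∀ᶠ w in 𝓝[≠] z, w = z := by
    filter_upwards [h.filter_mono nhdsWithin_le_nhds,
      nhdsWithin_le_nhds (hV.mem_nhds hz)] with w h1 h2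
    exact hi h2 hz h1
  have h3 : ∀ᶠ w in 𝓝[≠] z, w ≠ z := self_mem_nhdsWithin
  obtain ⟨w, h4, h5⟩ := (h2.and h3).exists
  exact h5 h4

lemma open_map {V : Set ℂ} {g : ℂ → ℂ} (hV : IsOpen V) (hg : DifferentiableOn ℂ g V) {z : ℂ} (hz : z ∈ V)
    (hnc : ¬ ∀ᶠ w in 𝓝 z, g w = g z) {N : Set ℂ} (hN : N ∈ 𝓝 z) : g '' (N ∩ V) ∈ 𝓝 (g z) := by
  have h := ((hg.analyticAt (hV.mem_nhds hz)).eventually_constant_or_nhds_le_map_nhds).resolve_left hnc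
  exact h (image_mem_map (inter_mem hN (hV.mem_nhds hz)))

lemma inverse_holo {V : Set ℂ} {g ψ : ℂ → ℂ} (hV : IsOpen V) (hg : DifferentiableOn ℂ g V)
    (hi : Set.InjOn g V) {D : Set ℂ} (hD : IsOpen D) (hm : Set.MapsTo ψ D V)
    (hψ : ∀ w ∈ D, g (ψ w) = w) : DifferentiableOn ℂ ψ D := by
  have hc : ∀ w ∈ D, ContinuousAt ψ w := by
    intro w hw
    rw [ContinuousAt, tendsto_def]
    intro N hN
    have h1 := open_map hV hg (hm hw) (not_locconst hV hi (hm hw)) hN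
    rw [hψ w hw] at h1
    filter_upwards [h1, hD.mem_nhds hw] with y hy hyD
    obtain ⟨x, ⟨hxN, hxV⟩, hx⟩ := hy
    have : ψ y = x := hi (hm hyD) hxV (by rw [hψ y hyD, hx])
    simpa [this] using hxN
  have hd : ∀ w ∈ D, deriv g (ψ w) ≠ 0 → DifferentiableAt ℂ ψ w := by
    intro w hw h
    refine (HasDerivAt.of_local_left_inverse (hc w hw)
      (hg.differentiableAt (hV.mem_nhds (hm hw))).hasDerivAt h ?_).differentiableAt
    filter_upwards [hD.mem_nhds hw] with y hy using hψ y hy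
  intro w hw
  apply DifferentiableAt.differentiableWithinAt
  apply AnalyticAt.differentiableAt
  apply Complex.analyticAt_of_differentiable_on_punctured_nhds_of_continuousAt _ (hc w hw)
  have hda : AnalyticAt ℂ (deriv g) (ψ w) := (hg.analyticAt (hV.mem_nhds (hm hw))).deriv
  rcases hda.eventually_eq_zero_or_eventually_ne_zero with h | h
  · exfalso
    obtain ⟨r, hr, hrV⟩ := Metric.mem_nhds_iff.1 (inter_mem h (hV.mem_nhds (hm hw)))
    apply not_locconst hV hi (hm hw)
    filter_upwards [ball_mem_nhds _ hr] with y hy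
    exact isOpen_ball.is_const_of_deriv_eq_zero (convex_ball _ _).isPreconnected
      (hg.mono fun x hx => (hrV hx).2) (fun x hx => (hrV hx).1) hy (mem_ball_self hr)
  · rw [eventually_nhdsWithin_iff] at h ⊢
    filter_upwards [(hc w hw).eventually h, hD.mem_nhds hw] with y hy hyD hne
    apply hd y hyD
    apply hy
    intro heq
    apply hne
    rw [Set.mem_singleton_iff] at heq ⊢
    rw [← hψ y hyD, heq, hψ w hw]

def Fam (V : Set ℂ) (z0 : ℂ) (φ : ℂ → ℂ) : Prop :=
  DifferentiableOn ℂ φ V ∧ Set.InjOn φ V ∧ Set.MapsTo φ V (ball 0 1) ∧ φ z0 = 0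

lemma fam_norm {V : Set ℂ} {z0 : ℂ} {φ : ℂ → ℂ} (h : Fam V z0 φ) {z : ℂ} (hz : z ∈ V) : ‖φ z‖ < 1 := by
  simpa using h.2.2.1 hz

lemma fam_mob {V : Set ℂ} {z0 : ℂ} (hV : IsOpen V) {φ : ℂ → ℂ} (hz0 : z0 ∈ V) (hd : DifferentiableOn ℂ φ V)
    (hi : Set.InjOn φ V) (hm : ∀ z ∈ V, ‖φ z‖ < 1) :
    Fam V z0 (fun z => mob (φ z0) (φ z)) ∧
    ‖deriv (fun z => mob (φ z0) (φ z)) z0‖ = ‖deriv φ z0‖ / (1 - ‖φ z0‖ ^ 2) := by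
  have ha := hm z0 hz0
  refine ⟨⟨?_, ?_, ?_, ?_⟩, ?_⟩
  · exact (mob_diff ha).comp hd fun z hz => by simpa using hm z hz
  · intro x hx y hy hxy
    apply hi hx hy
    have := congrArg (mob (φ z0)) hxy
    simpa only [mob_mob ha (hm x hx), mob_mob ha (hm y hy)] using this
  · intro z hz
    simpa using mob_norm ha (hm z hz)
  · exact mob_self _
  · have h1 := (mob_hasDerivAt ha ha).comp z0 (hd.differentiableAt (hV.mem_nhds hz0)).hasDerivAt
    have h2 : deriv (fun z => mob (φ z0) (φ z)) z0 = _ := h1.deriv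
    have h3 : (1 - conj (φ z0) * φ z0) = ((1 - ‖φ z0‖ ^ 2 : ℝ) : ℂ) := by
      rw [Complex.conj_mul']; push_cast; ring
    have h4 : 0 < 1 - ‖φ z0‖ ^ 2 := by nlinarith [norm_nonneg (φ z0)]
    rw [h2, norm_mul, norm_div, norm_neg, norm_pow, h3, Complex.norm_real, Real.norm_of_nonneg h4.le]
    field_simp

lemma fam_exists {V : Set ℂ} {z0 : ℂ} (hV : IsOpen V) (hz0 : z0 ∈ V) {a : ℂ} (ha : a ∉ V) (hs : HasSqrts V) :
    ∃ φ, Fam V z0 φ ∧ 0 < ‖deriv φ z0‖ := by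
  obtain ⟨h, hd, hsq⟩ := hs (fun z => z - a) (by fun_prop) (fun z hz h => ha (by rwa [← sub_eq_zero.1 h]))
  have hne : ∀ z ∈ V, h z ≠ 0 := by
    intro z hz h0
    have := hsq z hz
    rw [h0] at this
    simp only [ne_eq, OfNat.ofNat_ne_zero, not_false_eq_true, zero_pow] at this
    exact ha (by rwa [← sub_eq_zero.1 this.symm])
  have hsqi : ∀ z ∈ V, ∀ w ∈ V, h z ^ 2 = h w ^ 2 → z = w := by
    intro z hz w hw hh
    rw [hsq z hz, hsq w hw] at hh
    exact sub_left_injective hh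
  have hi : Set.InjOn h V := fun z hz w hw hh => hsqi z hz w hw (by rw [hh])
  obtain ⟨ρ, hρ, hρs⟩ := Metric.mem_nhds_iff.1 (open_map hV hd hz0 (not_locconst hV hi hz0) univ_mem)
  have hfar : ∀ z ∈ V, ρ ≤ ‖h z + h z0‖ := by
    intro z hz
    by_contra hlt
    push Not at hlt
    have : -h z ∈ ball (h z0) ρ := by
      rw [mem_ball, dist_eq_norm, ← norm_neg]; convert! hlt using 2; ring
    obtain ⟨w, ⟨-, hw⟩, hwz⟩ := hρs this
    have hzw := hsqi w hw z hz (by rw [hwz]; ring)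
    rw [hzw] at hwz
    exact hne z hz (by linear_combination hwz / 2)
  have hnz : ∀ z ∈ V, h z + h z0 ≠ 0 := fun z hz h0 => by
    have := hfar z hz; rw [h0, norm_zero] at this; linarith
  have hρc : (ρ : ℂ) / 2 ≠ 0 := by simp [hρ.ne']
  set φ : ℂ → ℂ := fun z => (ρ / 2) / (h z + h z0) with hφ
  have hφd : DifferentiableOn ℂ φ V := DifferentiableOn.div (by fun_prop) (by fun_prop) hnz
  have hφi : Set.InjOn φ V := by
    intro z hz w hw hh
    apply hi hz hw
    simp only [hφ] at hh
    rw [div_eq_div_iff (hnz z hz) (hnz w hw)] at hh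
    have := mul_left_cancel₀ hρc hh
    linear_combination -this
  have hφm : ∀ z ∈ V, ‖φ z‖ < 1 := by
    intro z hz
    simp only [hφ]
    rw [norm_div, div_lt_one (norm_pos_iff.2 (hnz z hz))]
    have := hfar z hz
    simp only [norm_div, Complex.norm_real, Real.norm_of_nonneg hρ.le, Complex.norm_ofNat]
    linarith
  obtain ⟨h1, h2⟩ := fam_mob hV hz0 hφd hφi hφm
  refine ⟨_, h1, ?_⟩
  rw [h2]
  have h4 : 0 < 1 - ‖φ z0‖ ^ 2 := by nlinarith [norm_nonneg (φ z0), hφm z0 hz0]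
  refine div_pos (norm_pos_iff.2 ?_) h4
  have hda := (hd.differentiableAt (hV.mem_nhds hz0)).hasDerivAt
  have h5 : HasDerivAt φ _ z0 := (hasDerivAt_const z0 ((ρ:ℂ)/2)).div (hda.add_const (h z0)) (hnz z0 hz0)
  rw [h5.deriv]
  have h6 : deriv h z0 ≠ 0 := by
    intro h0
    have h7 := (hda.pow 2)
    have h8 : HasDerivAt (fun z => z - a) 1 z0 := by simpa using (hasDerivAt_id z0).sub_const a
    have h9 : (h ^ 2) =ᶠ[𝓝 z0] fun z => z - a := by
      filter_upwards [hV.mem_nhds hz0] with z hz using hsq z hz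
    have := (h7.congr_of_eventuallyEq h9.symm).unique h8
    rw [h0] at this; simp at this
  simp [h6, hnz z0 hz0, hρ.ne']

lemma injOn_limit {V : Set ℂ} (hV : IsOpen V) {F : ℕ → ℂ → ℂ} {g : ℂ → ℂ}
    (hF : ∀ n, DifferentiableOn ℂ (F n) V) (hFi : ∀ n, Set.InjOn (F n) V)
    (hlim : TendstoLocallyUniformlyOn F g atTop V)
    (hnc : ∀ z ∈ V, ¬ ∀ᶠ w in 𝓝 z, g w = g z) : Set.InjOn g V := by
  have hg : DifferentiableOn ℂ g V := hlim.differentiableOn (Eventually.of_forall hF) hV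
  intro a ha b hb hab
  by_contra hne
  obtain ⟨A, B, hA, hB, haA, hbB, hd⟩ := t2_separation hne
  have h1 := hurwitz hV (Eventually.of_forall hF) hg hlim ha (hnc a ha)
    (inter_mem (hA.mem_nhds haA) (hV.mem_nhds ha))
  have h2 := hurwitz hV (Eventually.of_forall hF) hg hlim hb (hnc b hb)
    (inter_mem (hB.mem_nhds hbB) (hV.mem_nhds hb))
  obtain ⟨n, ⟨z, ⟨hzA, hzV⟩, hz⟩, w, ⟨hwB, hwV⟩, hw⟩ := (h1.and h2).exists
  have : z = w := hFi n hzV hwV (by rw [hz, hw, hab])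
  subst this
  exact Set.disjoint_left.1 hd hzA hwB

lemma locconst_deriv {V : Set ℂ} (hV : IsOpen V) (hc : IsPreconnected V) {g : ℂ → ℂ}
    (hg : DifferentiableOn ℂ g V) {z z0 : ℂ} (hz : z ∈ V) (hz0 : z0 ∈ V)
    (h : ∀ᶠ w in 𝓝 z, g w = g z) : Set.EqOn g (fun _ => g z) V ∧ deriv g z0 = 0 := by
  have h1 : Set.EqOn g (fun _ => g z) V :=
    (hg.analyticOnNhd hV).eqOn_of_preconnected_of_eventuallyEq analyticOnNhd_const hc hz h
  refine ⟨h1, ?_⟩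
  have : g =ᶠ[𝓝 z0] fun _ => g z := by
    filter_upwards [hV.mem_nhds hz0] with y hy using h1 hy
  rw [this.deriv_eq, deriv_const]

lemma fam_improve {V : Set ℂ} {z0 : ℂ} (hV : IsOpen V) (hz0 : z0 ∈ V) (hs : HasSqrts V) {g : ℂ → ℂ}
    (hg : Fam V z0 g) (hpos : 0 < ‖deriv g z0‖) {w : ℂ} (hw : ‖w‖ < 1) (hwg : ∀ z ∈ V, g z ≠ w) :
    ∃ k, Fam V z0 k ∧ ‖deriv g z0‖ < ‖deriv k z0‖ := by
  have hm : ∀ z ∈ V, ‖g z‖ < 1 := fun z hz => fam_norm hg hz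
  have hpd : DifferentiableOn ℂ (fun z => mob w (g z)) V := (mob_diff hw).comp hg.1 hg.2.2.1
  obtain ⟨s, hsd, hsq⟩ := hs (fun z => mob w (g z)) hpd (by
    intro z hz h0
    apply hwg z hz
    rw [← mob_mob hw (hm z hz), h0, mob_zero])
  have hsm : ∀ z ∈ V, ‖s z‖ < 1 := by
    intro z hz
    have h1 : ‖s z‖ ^ 2 < 1 := by
      rw [← norm_pow, hsq z hz]; exact mob_norm hw (hm z hz)
    nlinarith [norm_nonneg (s z)]
  have hsi : Set.InjOn s V := by
    intro x hx y hy hxy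
    apply hg.2.1 hx hy
    have h1 : mob w (g x) = mob w (g y) := by rw [← hsq x hx, ← hsq y hy, hxy]
    have := congrArg (mob w) h1
    rwa [mob_mob hw (hm x hx), mob_mob hw (hm y hy)] at this
  obtain ⟨h1, h2⟩ := fam_mob hV hz0 hsd hsi hsm
  refine ⟨_, h1, ?_⟩
  rw [h2]
  have hs0 : s z0 ^ 2 = w := by
    rw [hsq z0 hz0, hg.2.2.2, mob_zero]
  have hw0 : w ≠ 0 := fun h => hwg z0 hz0 (by rw [hg.2.2.2, h])
  have hsne : 0 < ‖s z0‖ := norm_pos_iff.2 fun h => hw0 (by rw [← hs0, h]; simp)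
  have hsd0 := (hsd.differentiableAt (hV.mem_nhds hz0)).hasDerivAt
  have hgd0 := (hg.1.differentiableAt (hV.mem_nhds hz0)).hasDerivAt
  have h3 := (mob_hasDerivAt hw (hm z0 hz0)).comp z0 hgd0
  have h4 : (s ^ 2) =ᶠ[𝓝 z0] (mob w ∘ g) := by
    filter_upwards [hV.mem_nhds hz0] with z hz using hsq z hz
  have h5 := ((hsd0.pow 2).congr_of_eventuallyEq h4.symm).unique h3
  rw [hg.2.2.2] at h5
  have h6 : 2 * ‖s z0‖ * ‖deriv s z0‖ = (1 - ‖s z0‖ ^ 4) * ‖deriv g z0‖ := by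
    have h7 := congrArg norm h5
    have h8 : (1 - conj w * w) = ((1 - ‖w‖ ^ 2 : ℝ) : ℂ) := by
      rw [Complex.conj_mul']; push_cast; ring
    have h9 : 0 < 1 - ‖w‖ ^ 2 := by nlinarith [norm_nonneg w]
    have h10 : ‖w‖ = ‖s z0‖ ^ 2 := by rw [← hs0, norm_pow]
    simp only [norm_mul, mul_zero, sub_zero, one_pow, div_one, norm_neg, h8, Complex.norm_real,
      Real.norm_of_nonneg h9.le] at h7
    rw [h10] at h7
    simp at h7
    rw [h7]; ring
  set σ := ‖s z0‖
  have hσ1 : σ < 1 := hsm z0 hz0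
  have h7 : 0 < 1 - σ ^ 2 := by nlinarith
  rw [lt_div_iff₀ h7]
  set d := ‖deriv g z0‖
  have h8 : (2 * σ) * (d * (1 - σ ^ 2)) < (2 * σ) * ‖deriv s z0‖ := by
    rw [h6]
    have : (1 - σ ^ 4) * d - 2 * σ * (d * (1 - σ ^ 2)) = d * (1 - σ ^ 2) * (1 - σ) ^ 2 := by ring
    have h9 : 0 < d * (1 - σ ^ 2) * (1 - σ) ^ 2 := by
      have : 0 < 1 - σ := by linarith
      positivity
    linarith
  exact lt_of_mul_lt_mul_left h8 (by positivity)

lemma rmt {V : Set ℂ} (hV : IsOpen V) (hc : IsPreconnected V) {z0 a : ℂ} (hz0 : z0 ∈ V) (ha : a ∉ V)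
    (hs : HasSqrts V) : BiholoToDisc V := by
  obtain ⟨φ0, hφ0, hpos⟩ := fam_exists hV hz0 ha hs
  obtain ⟨r, hr, hrV⟩ := Metric.nhds_basis_closedBall.mem_iff.1 (hV.mem_nhds hz0)
  set S : Set ℝ := {t | ∃ φ, Fam V z0 φ ∧ ‖deriv φ z0‖ = t} with hS
  have hbdd : BddAbove S := by
    refine ⟨1 / r, ?_⟩
    rintro _ ⟨φ, hφ, rfl⟩
    refine Complex.norm_deriv_le_of_forall_mem_sphere_norm_le hr
      ((hφ.1.mono hrV).diffContOnCl_ball (le_refl _)) fun z hz =>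
      (fam_norm hφ (hrV (sphere_subset_closedBall hz))).le
  have hSne : S.Nonempty := ⟨_, φ0, hφ0, rfl⟩
  obtain ⟨u, -, hu, huS⟩ := exists_seq_tendsto_sSup hSne hbdd
  choose Φ hΦ hΦu using huS
  obtain ⟨ν, hν, g, hlim⟩ := montel (U := V) (F := Φ) (fun n => (hΦ n).1) (by
    intro x hx
    obtain ⟨ρ, hρ, hρV⟩ := Metric.mem_nhds_iff.1 (hV.mem_nhds hx)
    exact ⟨ρ, hρ, 1, hρV, fun n z hz => (fam_norm (hΦ n) (hρV hz)).le⟩)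
  have hd : ∀ n, DifferentiableOn ℂ (Φ (ν n)) V := fun n => (hΦ _).1
  have hgd : DifferentiableOn ℂ g V := hlim.differentiableOn (Eventually.of_forall hd) hV
  have hder : ‖deriv g z0‖ = sSup S := by
    have h1 := ((hlim.deriv (Eventually.of_forall hd) hV).tendsto_at hz0).norm
    have h2 : Tendsto (fun n => ‖(deriv ∘ fun j => Φ (ν j)) n z0‖) atTop (𝓝 (sSup S)) := by
      have := hu.comp hν.tendsto_atTop
      refine this.congr fun n => ?_
      simp [hΦu]
    exact tendsto_nhds_unique h1 h2
  have hgpos : 0 < ‖deriv g z0‖ := by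
    rw [hder]; exact hpos.trans_le (le_csSup hbdd ⟨φ0, hφ0, rfl⟩)
  have hnc : ∀ z ∈ V, ¬ ∀ᶠ w in 𝓝 z, g w = g z := by
    intro z hz h
    rw [(locconst_deriv hV hc hgd hz hz0 h).2] at hgpos
    simp at hgpos
  have hgi := injOn_limit hV hd (fun n => (hΦ _).2.1) hlim hnc
  have hgle : ∀ z ∈ V, ‖g z‖ ≤ 1 := fun z hz =>
    le_of_tendsto (hlim.tendsto_at hz).norm (Eventually.of_forall fun n => (fam_norm (hΦ _) hz).le)
  have hgm : Set.MapsTo g V (ball 0 1) := by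
    intro z hz
    have h1 := open_map hV hgd hz (hnc z hz) univ_mem
    have h2 : closedBall (0:ℂ) 1 ∈ 𝓝 (g z) := by
      filter_upwards [h1] with y hy
      obtain ⟨x, ⟨-, hx⟩, rfl⟩ := hy
      simpa using hgle x hx
    rw [← mem_interior_iff_mem_nhds, interior_closedBall _ one_ne_zero] at h2
    exact h2
  have hg0 : g z0 = 0 := tendsto_nhds_unique (hlim.tendsto_at hz0)
    (tendsto_const_nhds.congr fun n => ((hΦ (ν n)).2.2.2).symm)
  have hgF : Fam V z0 g := ⟨hgd, hgi, hgm, hg0⟩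
  have hsurj : ∀ w ∈ ball (0:ℂ) 1, ∃ z, z ∈ V ∧ g z = w := by
    intro w hw
    by_contra hno
    push Not at hno
    obtain ⟨k, hk, hlt⟩ := fam_improve hV hz0 hs hgF hgpos (by simpa using hw) hno
    rw [hder] at hlt
    exact absurd (le_csSup hbdd ⟨k, hk, rfl⟩) (not_le.2 hlt)
  have : ∀ w, ∃ z, w ∈ ball (0:ℂ) 1 → z ∈ V ∧ g z = w := by
    intro w
    by_cases hw : w ∈ ball (0:ℂ) 1
    · obtain ⟨z, hz⟩ := hsurj w hw
      exact ⟨z, fun _ => hz⟩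
    · exact ⟨0, fun h => absurd h hw⟩
  choose ψ hψ using this
  have hψm : Set.MapsTo ψ (ball 0 1) V := fun w hw => (hψ w hw).1
  refine ⟨g, ψ, hgd, inverse_holo hV hgd hgi isOpen_ball hψm fun w hw => (hψ w hw).2, hgm, hψm,
    fun z hz => ?_, fun w hw => (hψ w hw).2⟩
  exact hgi (hψm (hgm hz)) hz (hψ _ (hgm hz)).2

lemma re_inv_ge {t : ℂ} (ht : ‖t‖ ≤ 1) (h1 : 1 - t ≠ 0) : 1 / 2 ≤ ((1 - t)⁻¹).re := by
  rw [Complex.inv_re, div_le_div_iff₀ two_pos (Complex.normSq_pos.2 h1)]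
  have h2 : t.re ^ 2 + t.im ^ 2 ≤ 1 := by
    have : ‖t‖ ^ 2 ≤ 1 := by nlinarith [norm_nonneg t]
    rw [← Complex.normSq_eq_norm_sq, Complex.normSq_apply] at this
    nlinarith
  rw [Complex.normSq_apply]
  simp
  nlinarith

lemma fix_scaled {G : ℂ → ℂ} (hG : DifferentiableOn ℂ G (ball 0 1)) (hm : ∀ z, ‖z‖ < 1 → ‖G z‖ < 1)
    {s : ℝ} (hs : 0 < s) (hs1 : s < 1) : ∃ a : ℂ, ‖a‖ < 1 ∧ (s : ℂ) * G a = a := by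
  by_contra hno
  push Not at hno
  set r : ℝ := (1 + s) / 2 with hr
  have hr1 : r < 1 := by linarith
  have hsr : s < r := by linarith
  have hr0 : 0 < r := by linarith
  have hsub : closedBall (0:ℂ) r ⊆ ball 0 1 := closedBall_subset_ball hr1
  have hnz : ∀ z ∈ closedBall (0:ℂ) r, z - s * G z ≠ 0 := by
    intro z hz h
    exact hno z (by simpa using hsub hz) (sub_eq_zero.1 h).symm
  set q : ℂ → ℂ := fun z => Complex.exp (-(z / (z - s * G z))) with hq
  have hqd : DifferentiableOn ℂ q (closedBall 0 r) := by
    have hG' := hG.mono hsub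
    refine DifferentiableOn.cexp (DifferentiableOn.neg (DifferentiableOn.div (by fun_prop) (by fun_prop) hnz))
  have h1 := Complex.norm_le_of_forall_mem_frontier_norm_le (f := q) (U := ball 0 r) (C := Real.exp (-(1/2)))
    isBounded_ball (hqd.diffContOnCl_ball (le_refl _)) (by
      intro z hz
      rw [frontier_ball _ hr0.ne', mem_sphere_zero_iff_norm] at hz
      simp only [hq]
      rw [Complex.norm_exp]
      apply Real.exp_le_exp.2
      rw [Complex.neg_re]
      apply neg_le_neg
      have hz0 : z ≠ 0 := norm_pos_iff.1 (by rw [hz]; exact hr0)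
      have hzn := hnz z (by simp [hz])
      have h2 : z / (z - s * G z) = (1 - s * G z / z)⁻¹ := by field_simp
      rw [h2]
      apply re_inv_ge
      · rw [norm_div, norm_mul, Complex.norm_real, Real.norm_of_nonneg hs.le, hz, div_le_one hr0]
        have := hm z (by rw [hz]; exact hr1)
        nlinarith [norm_nonneg (G z)]
      · intro h3
        apply hzn
        have : z * (1 - s * G z / z) = 0 := by rw [h3, mul_zero]
        rw [← this]; field_simp)
    (z := 0) (subset_closure (mem_ball_self hr0))
  simp only [hq, zero_div, neg_zero, Complex.exp_zero, norm_one] at h1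
  have := Real.exp_lt_one_iff.2 (show (-(1/2) : ℝ) < 0 by norm_num)
  linarith

lemma schwarz_pick {H : ℂ → ℂ} (hH : DifferentiableOn ℂ H (ball 0 1)) (hm : ∀ z, ‖z‖ < 1 → ‖H z‖ < 1)
    {a : ℂ} (ha : ‖a‖ < 1) (hfix : H a = a) {z : ℂ} (hz : ‖z‖ < 1) :
    ‖1 - conj a * H z‖ ^ 2 * (1 - ‖z‖ ^ 2) ≤ ‖1 - conj a * z‖ ^ 2 * (1 - ‖H z‖ ^ 2) := by
  have hmb : Set.MapsTo H (ball 0 1) (ball 0 1) := fun z hz => by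
    simpa using hm z (by simpa using hz)
  set k : ℂ → ℂ := fun w => mob a (H (mob a w)) with hk
  have hkd : DifferentiableOn ℂ k (ball 0 1) :=
    (mob_diff ha).comp (hH.comp (mob_diff ha) (mob_maps ha)) (hmb.comp (mob_maps ha))
  have hkm : Set.MapsTo k (ball 0 1) (ball 0 1) := (mob_maps ha).comp (hmb.comp (mob_maps ha))
  have hk0 : k 0 = 0 := by simp only [hk]; rw [mob_zero, hfix, mob_self]
  have h1 := Complex.norm_le_norm_of_mapsTo_ball hkd (hkm.mono_right ball_subset_closedBall) hk0 (mob_norm ha hz)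
  simp only [hk] at h1
  rw [mob_mob ha hz] at h1
  have hHz := hm z hz
  have h2 := norm_pos_iff.2 (mob_den ha hz)
  have h3 := norm_pos_iff.2 (mob_den ha hHz)
  have h4 := mob_id a z
  have h5 := mob_id a (H z)
  rw [mob, mob, norm_div, norm_div, div_le_div_iff₀ h3 h2] at h1
  have h6 : (‖a - H z‖ * ‖1 - conj a * z‖) ^ 2 ≤ (‖a - z‖ * ‖1 - conj a * H z‖) ^ 2 := by gcongr
  have h7 : 0 < 1 - ‖a‖ ^ 2 := by nlinarith [norm_nonneg a]
  have h8 : (1 - ‖a‖ ^ 2) * (‖1 - conj a * H z‖ ^ 2 * (1 - ‖z‖ ^ 2)) ≤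
      (1 - ‖a‖ ^ 2) * (‖1 - conj a * z‖ ^ 2 * (1 - ‖H z‖ ^ 2)) := by
    have e1 : (1 - ‖a‖ ^ 2) * (‖1 - conj a * H z‖ ^ 2 * (1 - ‖z‖ ^ 2)) =
      ‖1 - conj a * H z‖ ^ 2 * (‖1 - conj a * z‖ ^ 2 - ‖a - z‖ ^ 2) := by rw [h4]; ring
    have e2 : (1 - ‖a‖ ^ 2) * (‖1 - conj a * z‖ ^ 2 * (1 - ‖H z‖ ^ 2)) =
      ‖1 - conj a * z‖ ^ 2 * (‖1 - conj a * H z‖ ^ 2 - ‖a - H z‖ ^ 2) := by rw [h5]; ring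
    rw [e1, e2]
    nlinarith
  exact le_of_mul_le_mul_left h8 h7

lemma bdry_den {x z : ℂ} (hx : ‖x‖ ≤ 1) (hz : ‖z‖ < 1) : 1 - conj x * z ≠ 0 := by
  intro h
  have h1 : conj x * z = 1 := (sub_eq_zero.1 h).symm
  have h2 : ‖x‖ * ‖z‖ = 1 := by
    rw [← RCLike.norm_conj x, ← norm_mul, h1, norm_one]
  nlinarith [norm_nonneg x, norm_nonneg z]

lemma cayley_re {x z : ℂ} (hx : ‖x‖ = 1) (hz : ‖z‖ < 1) :
    ((1 + conj x * z) / (1 - conj x * z)).re = (1 - ‖z‖ ^ 2) / ‖1 - conj x * z‖ ^ 2 := by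
  have hd := bdry_den hx.le hz
  have h1 : ‖conj x * z‖ ^ 2 = ‖z‖ ^ 2 := by rw [norm_mul, RCLike.norm_conj, hx, one_mul]
  rw [← h1]
  generalize conj x * z = t at *
  have h0 : Complex.normSq (1 - t) ≠ 0 := by simpa [Complex.normSq_eq_zero] using hd
  rw [Complex.div_re, ← Complex.normSq_eq_norm_sq, ← Complex.normSq_eq_norm_sq]
  field_simp
  simp [Complex.normSq_apply]
  ring

lemma wolff {G : ℂ → ℂ} (hG : DifferentiableOn ℂ G (ball 0 1)) (hm : ∀ z, ‖z‖ < 1 → ‖G z‖ < 1)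
    {n : ℕ → ℕ} (hn : ∀ j, 1 ≤ n j) (hrec : ∀ z, ‖z‖ < 1 → Tendsto (fun j => G^[n j] z) atTop (𝓝 z)) :
    ∃ a, ‖a‖ < 1 ∧ G a = a := by
  set s : ℕ → ℝ := fun k => 1 - 1 / ((k:ℝ) + 2) with hs
  have hs0 : ∀ k, 0 < s k := fun k => by
    have : 1 / ((k:ℝ) + 2) < 1 := by rw [div_lt_one (by positivity)]; linarith [Nat.cast_nonneg (α := ℝ) k]
    simp only [hs]; linarith
  have hs1 : ∀ k, s k < 1 := fun k => by
    have : 0 < 1 / ((k:ℝ) + 2) := by positivity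
    simp only [hs]; linarith
  have hslim : Tendsto s atTop (𝓝 1) := by
    have h1 : Tendsto (fun k : ℕ => 1 / ((k:ℝ) + 2)) atTop (𝓝 0) :=
      tendsto_const_nhds.div_atTop (tendsto_atTop_add_const_right _ _ tendsto_natCast_atTop_atTop)
    simpa [hs] using h1.const_sub 1
  choose a ha hfix using fun k => fix_scaled hG hm (hs0 k) (hs1 k)
  obtain ⟨x, hx, ν, hν, hlim⟩ := (isCompact_closedBall (0:ℂ) 1).tendsto_subseq (x := a)
    (fun k => by simpa using (ha k).le)
  have hx1 : ‖x‖ ≤ 1 := by simpa using hx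
  have hsν : Tendsto (fun k => ((s (ν k) : ℝ) : ℂ)) atTop (𝓝 1) := by
    have := (Complex.continuous_ofReal.tendsto 1).comp (hslim.comp hν.tendsto_atTop)
    simpa [Function.comp_def] using this
  have hsp : ∀ z, ‖z‖ < 1 →
      ‖1 - conj x * G z‖ ^ 2 * (1 - ‖z‖ ^ 2) ≤ ‖1 - conj x * z‖ ^ 2 * (1 - ‖G z‖ ^ 2) := by
    intro z hz
    have hca : Tendsto (fun k => conj (a (ν k))) atTop (𝓝 (conj x)) :=
      (Complex.continuous_conj.tendsto x).comp hlim
    have hsG : Tendsto (fun k => ((s (ν k) : ℝ) : ℂ) * G z) atTop (𝓝 (G z)) := by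
      simpa using hsν.mul_const (G z)
    refine le_of_tendsto_of_tendsto
      ((((tendsto_const_nhds.sub (hca.mul hsG)).norm.pow 2).mul_const (1 - ‖z‖ ^ 2)))
      (((tendsto_const_nhds.sub (hca.mul_const z)).norm.pow 2).mul (tendsto_const_nhds.sub (hsG.norm.pow 2)))
      (Eventually.of_forall fun k => ?_)
    refine schwarz_pick (H := fun w => (s (ν k) : ℂ) * G w) (hG.const_mul _) ?_ (ha _) (hfix _) hz
    intro w hw
    rw [norm_mul, Complex.norm_real, Real.norm_of_nonneg (hs0 _).le]
    nlinarith [hm w hw, norm_nonneg (G w), hs0 (ν k), hs1 (ν k)]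
  rcases hx1.lt_or_eq with hlt | heq
  · refine ⟨x, hlt, ?_⟩
    have hGc : ContinuousAt G x := (hG.differentiableAt (isOpen_ball.mem_nhds (by simpa using hlt))).continuousAt
    have h1 : Tendsto (fun k => (s (ν k) : ℂ) * G (a (ν k))) atTop (𝓝 (1 * G x)) :=
      hsν.mul (hGc.tendsto.comp hlim)
    simp only [hfix, one_mul] at h1
    exact tendsto_nhds_unique h1 hlim
  · refine ⟨0, by simp, ?_⟩
    set C : ℂ → ℂ := fun z => (1 + conj x * z) / (1 - conj x * z) with hC
    have hden : ∀ z, ‖z‖ < 1 → 1 - conj x * z ≠ 0 := fun z hz => bdry_den hx1 hz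
    have hCd : DifferentiableOn ℂ C (ball 0 1) :=
      DifferentiableOn.div (by fun_prop) (by fun_prop) fun z hz => hden z (by simpa using hz)
    have hmono : ∀ z, ‖z‖ < 1 → (C z).re ≤ (C (G z)).re := by
      intro z hz
      simp only [hC]
      rw [cayley_re heq hz, cayley_re heq (hm z hz), div_le_div_iff₀
        (pow_pos (norm_pos_iff.2 (hden z hz)) 2) (pow_pos (norm_pos_iff.2 (hden _ (hm z hz))) 2)]
      linarith [hsp z hz]
    have hit : ∀ z, ‖z‖ < 1 → ∀ k, ‖G^[k] z‖ < 1 ∧ (C z).re ≤ (C (G^[k] z)).re := by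
      intro z hz k
      induction k with
      | zero => exact ⟨hz, le_refl _⟩
      | succ k ih =>
        rw [iterate_succ_apply']
        exact ⟨hm _ ih.1, ih.2.trans (hmono _ ih.1)⟩
    have hClim : ∀ z, ‖z‖ < 1 → Tendsto (fun j => C (G^[n j] z)) atTop (𝓝 (C z)) := fun z hz =>
      (hCd.differentiableAt (isOpen_ball.mem_nhds (by simpa using hz))).continuousAt.tendsto.comp (hrec z hz)
    have heqr : ∀ z, ‖z‖ < 1 → (C (G z)).re = (C z).re := by
      intro z hz
      refine le_antisymm ?_ (hmono z hz)
      refine ge_of_tendsto ((Complex.continuous_re.tendsto _).comp (hClim z hz)) (Eventually.of_forall fun j => ?_)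
      obtain ⟨k, hk⟩ := Nat.exists_eq_add_of_le (hn j)
      have := (hit (G z) (hm z hz) k).2
      simp only [Function.comp]
      rw [hk, add_comm, iterate_succ_apply]
      exact this
    set D : ℂ → ℂ := fun z => C (G z) - C z with hD
    have hDd : DifferentiableOn ℂ D (ball 0 1) :=
      (hCd.comp hG fun z hz => by simpa using hm z (by simpa using hz)).sub hCd
    have hDre : ∀ z, ‖z‖ < 1 → (D z).re = 0 := fun z hz => by simp [hD, heqr z hz]
    have h0 : (0:ℂ) ∈ ball (0:ℂ) 1 := by simp
    have hloc : ∀ᶠ w in 𝓝 (0:ℂ), D w = D 0 := by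
      by_contra hnc
      have h1 := open_map isOpen_ball hDd h0 hnc univ_mem
      obtain ⟨ρ, hρ, hρs⟩ := Metric.mem_nhds_iff.1 h1
      have h2 : D 0 + (ρ / 2 : ℝ) ∈ ball (D 0) ρ := by
        rw [mem_ball, dist_eq_norm, add_sub_cancel_left, Complex.norm_real, Real.norm_of_nonneg (by linarith)]
        linarith
      obtain ⟨y, ⟨-, hy⟩, hyy⟩ := hρs h2
      have h3 := congrArg Complex.re hyy
      rw [Complex.add_re, Complex.ofReal_re, hDre y (by simpa using hy), hDre 0 (by simp)] at h3
      linarith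
    have hDc := (locconst_deriv isOpen_ball (convex_ball _ _).isPreconnected hDd h0 h0 hloc).1
    set β := D 0 with hβ
    have hCG : ∀ z, ‖z‖ < 1 → C (G z) = C z + β := fun z hz => by
      have : D z = β := hDc (by simpa using hz)
      rw [← this]; simp [hD]
    have hCit : ∀ k : ℕ, C (G^[k] 0) = C 0 + k * β := by
      intro k
      induction k with
      | zero => simp
      | succ k ih =>
        rw [iterate_succ_apply', hCG _ (hit 0 (by simp) k).1, ih]; push_cast; ring
    have hβ0 : β = 0 := by
      by_contra hne
      have h1 : Tendsto (fun j => ((n j : ℕ) : ℂ) * β) atTop (𝓝 0) := by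
        have := (hClim 0 (by simp)).sub_const (C 0)
        simpa [hCit] using this
      have h2 := h1.norm
      rw [norm_zero] at h2
      have h3 := ge_of_tendsto h2 (b := ‖β‖) (Eventually.of_forall fun j => by
        rw [norm_mul, Complex.norm_natCast]
        have : (1:ℝ) ≤ n j := by exact_mod_cast hn j
        nlinarith [norm_nonneg β])
      exact absurd (norm_pos_iff.2 hne) (not_lt.2 h3)
    have h1 := hCG 0 (by simp)
    rw [hβ0] at h1
    have hd := hden (G 0) (hm 0 (by simp))
    simp only [hC, mul_zero, add_zero, sub_zero, div_one] at h1
    rw [div_eq_one_iff_eq hd] at h1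
    have h2 : conj x * G 0 = 0 := by linear_combination h1 / 2
    have hx0 : conj x ≠ 0 := by
      intro h; have := RCLike.norm_conj x; rw [h, heq] at this; simp at this
    exact (mul_eq_zero.1 h2).resolve_left hx0

lemma deriv_iter {f : ℂ → ℂ} (hf : Differentiable ℂ f) (n : ℕ) (x : ℂ) :
    deriv f^[n] x = ∏ i ∈ Finset.range n, deriv f (f^[i] x) := by
  induction n with
  | zero => simp
  | succ n ih =>
    rw [iterate_succ', deriv_comp x (hf _) (hf.iterate n x), ih, Finset.prod_range_succ, mul_comm]

def citer : ℕ → Ent → C(ℂ, ℂ)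
  | 0 => fun _ => ContinuousMap.id ℂ
  | n + 1 => fun g => (citer n g).comp g.1

lemma citer_cont (n : ℕ) : Continuous (citer n) := by
  induction n with
  | zero => exact continuous_const
  | succ n ih => exact ih.compCM continuous_subtype_val

lemma citer_coe (n : ℕ) (g : Ent) : ⇑(citer n g) = (eapp1 g)^[n] := by
  induction n with
  | zero => rfl
  | succ n ih => rw [iterate_succ, ← ih]; rfl

lemma iter_tendsto (f : Ent) (m : ℕ) :
    TendstoLocallyUniformlyOn (fun g : Ent => (eapp1 g)^[m]) ((eapp1 f)^[m]) (𝓝 f) Set.univ := by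
  rw [tendstoLocallyUniformlyOn_univ]
  have := ContinuousMap.tendsto_iff_tendstoLocallyUniformly.1 ((citer_cont m).tendsto f)
  simpa only [citer_coe] using this

lemma ent_diff (f : Ent) : Differentiable ℂ (eapp1 f) := f.2

def RepSet (B : Set ℂ) (m : ℕ) : Set Ent :=
  {f | ∃ x ∈ B, (eapp1 f)^[m] x = x ∧ 1 < ‖deriv (eapp1 f)^[m] x‖}

lemma repSet_open {B : Set ℂ} (hB : IsOpen B) (m : ℕ) : IsOpen (RepSet B m) := by
  rw [isOpen_iff_mem_nhds]
  rintro f ⟨x, hxB, hx, hd⟩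
  have hdi : ∀ g : Ent, Differentiable ℂ (eapp1 g)^[m] := fun g => (ent_diff g).iterate m
  have hlim := iter_tendsto f m
  have h1 : TendstoLocallyUniformlyOn (fun g : Ent => fun z => (eapp1 g)^[m] z - z)
      (fun z => (eapp1 f)^[m] z - z) (𝓝 f) Set.univ := by
    rw [Metric.tendstoLocallyUniformlyOn_iff] at hlim ⊢
    intro ε hε y hy
    obtain ⟨t, ht, h⟩ := hlim ε hε y hy
    refine ⟨t, ht, h.mono fun g hg z hz => ?_⟩
    rw [dist_sub_right]
    exact hg z hz
  have hnc : ¬ ∀ᶠ z in 𝓝 x, (eapp1 f)^[m] z - z = (eapp1 f)^[m] x - x := by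
    intro h
    have h2 : deriv (fun z => (eapp1 f)^[m] z - z) x = 0 := by
      have : (fun z => (eapp1 f)^[m] z - z) =ᶠ[𝓝 x] fun _ => (eapp1 f)^[m] x - x := h
      rw [this.deriv_eq, deriv_const]
    rw [deriv_fun_sub (hdi f x) differentiableAt_fun_id, deriv_id'', sub_eq_zero] at h2
    rw [h2] at hd; simp at hd
  have hder := hlim.deriv (Eventually.of_forall fun g => (hdi g).differentiableOn) isOpen_univ
  have hcont : Continuous (deriv (eapp1 f)^[m]) := ((hdi f).contDiff (n := 1)).continuous_deriv (le_refl _)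
  set δ := (‖deriv (eapp1 f)^[m] x‖ - 1) / 2 with hδ
  have hδ0 : 0 < δ := by rw [hδ]; linarith
  obtain ⟨t, ht, hev⟩ := Metric.tendstoLocallyUniformlyOn_iff.1 hder δ hδ0 x trivial
  rw [nhdsWithin_univ] at ht
  have hN : {z | 1 + δ < ‖deriv (eapp1 f)^[m] z‖} ∈ 𝓝 x :=
    (isOpen_lt continuous_const hcont.norm).mem_nhds (by simp only [Set.mem_ofPred_eq, hδ]; linarith)
  have hh := hurwitz isOpen_univ (Eventually.of_forall fun g : Ent => ((hdi g).sub differentiable_id).differentiableOn)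
    ((hdi f).sub differentiable_id).differentiableOn h1 (Set.mem_univ x) hnc
    (inter_mem (hB.mem_nhds hxB) (inter_mem ht hN))
  filter_upwards [hh, hev] with g ⟨z, ⟨hzB, hzt, hzN⟩, hz⟩ hg
  refine ⟨z, hzB, ?_, ?_⟩
  · change (eapp1 g)^[m] z - z = (eapp1 f)^[m] x - x at hz
    rw [hx, sub_self] at hz; exact sub_eq_zero.1 hz
  · have h3 := hg z hzt
    simp only [Set.mem_ofPred_eq] at hzN
    rw [dist_eq_norm, Function.comp] at h3
    have := norm_sub_norm_le (deriv (eapp1 f)^[m] z) (deriv (eapp1 g)^[m] z)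
    linarith

lemma nhds_ent {f : Ent} {U : Set Ent} (hU : U ∈ 𝓝 f) :
    ∃ R ε : ℝ, 0 < R ∧ 0 < ε ∧ ∀ g : Ent, (∀ z, ‖z‖ ≤ R → ‖eapp1 g z - eapp1 f z‖ < ε) → g ∈ U := by
  by_contra hno
  push Not at hno
  have hno' := fun n : ℕ => hno ((n:ℝ) + 1) (1 / ((n:ℝ) + 1)) (by positivity) (by positivity)
  choose g hg hgU using hno'
  have : Tendsto g atTop (𝓝 f) := by
    rw [tendsto_subtype_rng, ContinuousMap.tendsto_iff_forall_isCompact_tendstoUniformlyOn]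
    intro K hK
    rw [Metric.tendstoUniformlyOn_iff]
    intro ε hε
    obtain ⟨R, hR⟩ := hK.isBounded.exists_norm_le
    filter_upwards [(tendsto_one_div_add_atTop_nhds_zero_nat (𝕜 := ℝ)).eventually (gt_mem_nhds hε),
      tendsto_natCast_atTop_atTop.eventually (eventually_ge_atTop R)] with n hn1 hn2 x hx
    rw [dist_comm, dist_eq_norm]
    exact (hg n x (by linarith [hR x hx])).trans hn1
  obtain ⟨n, hn⟩ := (this.eventually hU).exists
  exact hgU n hn

/-- doubly vanishing perturbations do not change orbits and multipliers -/
lemma excursion {f : ℂ → ℂ} (hf : Differentiable ℂ f) {R ε : ℝ} (hR : 0 < R) (hε : 0 < ε) {p : ℂ} {n : ℕ}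
    (hn : R < ‖f^[n] p‖) (hd : deriv f^[n] p ≠ 0) :
    ∃ g : ℂ → ℂ, Differentiable ℂ g ∧ (∀ z, ‖z‖ ≤ R → ‖g z - f z‖ < ε) ∧
      ∃ m, 1 ≤ m ∧ g^[m] p = p ∧ 1 < ‖deriv g^[m] p‖ := by
  classical
  have hex : ∃ n, R < ‖f^[n] p‖ ∧ deriv f^[n] p ≠ 0 := ⟨n, hn, hd⟩
  obtain ⟨n, hn, hd, hmin⟩ : ∃ n, R < ‖f^[n] p‖ ∧ deriv f^[n] p ≠ 0 ∧ ∀ i < n, ‖f^[i] p‖ ≤ R := by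
    have h1 := Nat.find_spec hex
    refine ⟨Nat.find hex, h1.1, h1.2, fun i hi => ?_⟩
    have h2 := Nat.find_min hex hi
    rw [not_and', not_lt] at h2
    apply h2
    have h3 := h1.2
    rw [deriv_iter hf, Finset.prod_ne_zero_iff] at h3 ⊢
    exact fun j hj => h3 j (Finset.mem_range.2 ((Finset.mem_range.1 hj).trans hi))
  set q := f^[n] p with hq
  have hq0 : q ≠ 0 := norm_pos_iff.1 (hR.trans hn)
  let S : ℂ → ℂ := fun z => ∏ j ∈ Finset.range n, (z - f^[j] p)
  have hSd : Differentiable ℂ S := by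
    intro z
    exact DifferentiableAt.fun_finsetProd fun j _ => by fun_prop
  have hSq : S q ≠ 0 := by
    simp only [S]
    rw [Finset.prod_ne_zero_iff]
    intro j hj h
    rw [sub_eq_zero] at h
    have := hmin j (Finset.mem_range.1 hj)
    rw [← h] at this; linarith
  have hS0 : ∀ j < n, S (f^[j] p) = 0 := fun j hj =>
    Finset.prod_eq_zero (Finset.mem_range.2 hj) (sub_self _)
  set c : ℂ := 2 / deriv f^[n] p with hc
  set Sq' := deriv (fun z => S z * S z) q
  set α : ℂ := (p - f q) / (S q * S q) with hα
  set β : ℂ := (c - deriv f q - Sq' * α) / (S q * S q) with hβ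
  let k : ℂ → ℂ := fun z => S z * (S z * (α + β * (z - q)))
  have hkd : Differentiable ℂ k := by fun_prop
  have hkq : k q = p - f q := by
    simp only [k, hα]; field_simp; ring
  have hkq' : HasDerivAt k (c - deriv f q) q := by
    have h1 : HasDerivAt (fun z => S z * S z) Sq' q := ((hSd.mul hSd) q).hasDerivAt
    have h2 : HasDerivAt (fun z : ℂ => α + β * (z - q)) β q := by
      simpa using (((hasDerivAt_id q).sub_const q).const_mul β).const_add α
    have h3 := h1.mul h2
    have h4 : k = (fun z => S z * S z) * (fun z : ℂ => α + β * (z - q)) := by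
      ext z; simp only [k, Pi.mul_apply]; ring
    rw [h4]
    refine h3.congr_deriv ?_
    simp only [sub_self, mul_zero, add_zero]
    rw [hβ, mul_div_cancel₀ _ (mul_ne_zero hSq hSq)]
    ring
  -- the cutoff
  let e : ℕ → ℂ → ℂ := fun N z => (z / q) ^ N * (1 + N - N * (z / q))
  have hed : ∀ N, Differentiable ℂ (e N) := fun N => by
    simp only [e]; fun_prop
  have heq : ∀ N, e N q = 1 := fun N => by simp [e, hq0]
  have heq' : ∀ N, HasDerivAt (e N) 0 q := by
    intro N
    have h0 : HasDerivAt (fun z : ℂ => z / q) (1 / q) q := (hasDerivAt_id q).div_const q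
    have h1 := h0.pow N
    have h2 := ((h0.const_mul (N:ℂ)).const_sub (1 + (N:ℂ)))
    have h3 := h1.mul h2
    refine h3.congr_deriv ?_
    simp only [Pi.pow_apply, div_self hq0, one_pow]
    ring
  obtain ⟨C, hC⟩ := (isCompact_closedBall (0:ℂ) R).exists_bound_of_continuousOn hkd.continuous.continuousOn
  have hC0 : 0 ≤ C := (norm_nonneg _).trans (hC 0 (by simp [hR.le]))
  set ρ := R / ‖q‖ with hρ
  have hqp : 0 < ‖q‖ := norm_pos_iff.2 hq0
  have hρ0 : 0 ≤ ρ := by positivity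
  have hρ1 : ρ < 1 := (div_lt_one hqp).2 hn
  have hlim : Tendsto (fun N : ℕ => C * (ρ ^ N * (1 + 2 * N))) atTop (𝓝 0) := by
    have h1 := tendsto_pow_atTop_nhds_zero_of_lt_one hρ0 hρ1
    have h2 := tendsto_self_mul_const_pow_of_lt_one hρ0 hρ1
    have h3 := ((h1.add (h2.const_mul 2)).const_mul C)
    simp only [mul_zero, add_zero] at h3
    refine h3.congr fun N => ?_
    ring
  obtain ⟨N, hN⟩ := (hlim.eventually (gt_mem_nhds hε)).exists
  let g : ℂ → ℂ := fun z => f z + k z * e N z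
  have hgd : Differentiable ℂ g := hf.add (hkd.mul (hed N))
  have hgj : ∀ j < n, g (f^[j] p) = f (f^[j] p) ∧ deriv g (f^[j] p) = deriv f (f^[j] p) := by
    intro j hj
    refine ⟨by simp [g, k, hS0 j hj], ?_⟩
    have h1 := (hSd (f^[j] p)).hasDerivAt
    have h2 : Differentiable ℂ (fun z => S z * ((α + β * (z - q)) * e N z)) := by
      have := hed N
      fun_prop
    have h3 := h1.mul (h2 (f^[j] p)).hasDerivAt
    rw [hS0 j hj] at h3
    simp only [zero_mul, mul_zero, add_zero] at h3
    have h4 := (hf (f^[j] p)).hasDerivAt.add h3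
    rw [add_zero] at h4
    have h5 : g = f + S * (fun z => S z * ((α + β * (z - q)) * e N z)) := by
      ext z; simp only [g, k, Pi.add_apply, Pi.mul_apply]; ring
    rw [h5]; exact h4.deriv
  have hgit : ∀ j ≤ n, g^[j] p = f^[j] p := by
    intro j hj
    induction j with
    | zero => rfl
    | succ j ih =>
      rw [iterate_succ_apply', iterate_succ_apply', ih (by omega), (hgj j (by omega)).1]
  refine ⟨g, hgd, ?_, n + 1, by omega, ?_, ?_⟩
  · intro z hz
    simp only [g, add_sub_cancel_left, norm_mul]
    refine lt_of_le_of_lt ?_ hN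
    gcongr
    · exact hC z (by simpa using hz)
    · simp only [e, norm_mul, norm_pow, norm_div]
      have h1 : ‖z‖ / ‖q‖ ≤ ρ := by rw [hρ]; gcongr
      gcongr
      calc ‖1 + (N:ℂ) - N * (z / q)‖ ≤ ‖1 + (N:ℂ)‖ + ‖(N:ℂ) * (z / q)‖ := norm_sub_le _ _
        _ ≤ (1 + N) + N * 1 := by
          refine add_le_add ((norm_add_le _ _).trans (by simp)) ?_
          rw [norm_mul, norm_div, Complex.norm_natCast]
          gcongr
          linarith
        _ = 1 + 2 * N := by ring
  · rw [iterate_succ_apply', hgit n (le_refl _), ← hq]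
    simp [g, heq, hkq]
  · rw [deriv_iter hgd, Finset.prod_range_succ, hgit n (le_refl _), ← hq]
    have h1 : ∏ i ∈ Finset.range n, deriv g (g^[i] p) = deriv f^[n] p := by
      rw [deriv_iter hf]
      refine Finset.prod_congr rfl fun i hi => ?_
      have := Finset.mem_range.1 hi
      rw [hgit i this.le, (hgj i this).2]
    have h2 : deriv g q = c := by
      have h3 := (hf q).hasDerivAt.add (hkq'.mul (heq' N))
      have : HasDerivAt g _ q := h3
      rw [this.deriv, heq]; ring
    rw [h1, h2, hc, mul_div_cancel₀ _ hd]
    simp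

lemma deriv_iter_pow {f : ℂ → ℂ} (hf : Differentiable ℂ f) {x : ℂ} {m : ℕ} (hx : f^[m] x = x) (n : ℕ) :
    deriv f^[m * n] x = (deriv f^[m] x) ^ n := by
  rw [iterate_mul]
  exact (HasDerivAt.iterate _ (hf.iterate m x).hasDerivAt hx n).deriv

lemma rep_not_fatou {f : Ent} {x : ℂ} {m : ℕ} (hm : 1 ≤ m) (hx : (eapp1 f)^[m] x = x)
    (hd : 1 < ‖deriv (eapp1 f)^[m] x‖) : x ∉ Fatou1 f := by
  rintro ⟨U, hU, hxU, h⟩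
  have hf := ent_diff f
  obtain ⟨l, hl, h⟩ := h (fun j => m * j) (fun a b hab => Nat.mul_lt_mul_of_pos_left hab hm)
  rcases h with ⟨g, hg, h⟩ | h
  · have h2 := ((h.deriv (Eventually.of_forall fun j => (hf.iterate _).differentiableOn) hU).tendsto_at hxU).norm
    have h3 : Tendsto (fun j => ‖deriv (eapp1 f)^[m] x‖ ^ (l j)) atTop atTop :=
      (tendsto_pow_atTop_atTop_of_one_lt hd).comp hl.tendsto_atTop
    refine not_tendsto_nhds_of_tendsto_atTop h3 _ (h2.congr fun j => ?_)
    simp only [comp]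
    rw [deriv_iter_pow hf hx, norm_pow]
  · obtain ⟨j, hj⟩ := (h {x} (by simpa using hxU) isCompact_singleton {x} isCompact_singleton).exists
    rw [Set.image_singleton, Set.disjoint_singleton] at hj
    change (eapp1 f)^[m * l j] x ≠ x at hj
    rw [iterate_mul] at hj
    exact hj (iterate_fixed hx _)

lemma res_aux {A : Set Ent} (hA : IsOpen A) : (frontier A)ᶜ ∈ residual Ent := by
  refine residual_of_dense_open isClosed_frontier.isOpen_compl ?_
  rw [← interior_eq_empty_iff_dense_compl, ← frontier_compl]
  exact interior_frontier hA.isClosed_compl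

lemma mem_of_closure {A : Set Ent} (hA : IsOpen A) {f : Ent} (hf : f ∉ frontier A) (h : f ∈ closure A) : f ∈ A := by
  rw [hA.frontier_eq] at hf
  by_contra h2
  exact hf ⟨h, h2⟩

lemma exists_bump {f : ℂ → ℂ} {a : ℂ} {p0 : ℕ} (hp : minimalPeriod f a = p0) (h0 : 0 < p0) :
    ∃ h : ℂ → ℂ, Differentiable ℂ h ∧ (∀ i, h (f^[i] a) = 0) ∧ deriv h a = 1 ∧
      ∀ i, 1 ≤ i → i < p0 → deriv h (f^[i] a) = 0 := by
  set Q : ℂ → ℂ := fun z => ∏ i ∈ Finset.Ico 1 p0, (z - f^[i] a) with hQ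
  have hQd : Differentiable ℂ Q := by
    rw [hQ]
    refine Differentiable.fun_finsetProd fun i _ => ?_
    fun_prop
  have hQa : Q a ≠ 0 := by
    rw [hQ, Finset.prod_ne_zero_iff]
    intro i hi h
    rw [Finset.mem_Ico] at hi
    have : IsPeriodicPt f i a := (sub_eq_zero.1 h).symm
    have := this.minimalPeriod_le hi.1
    omega
  have hQi : ∀ i, 1 ≤ i → i < p0 → Q (f^[i] a) = 0 := fun i h1 h2 =>
    Finset.prod_eq_zero (Finset.mem_Ico.2 ⟨h1, h2⟩) (sub_self _)
  have hder : ∀ z, HasDerivAt (fun z => (z - a) * (Q z ^ 2 / Q a ^ 2))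
      (1 * (Q z ^ 2 / Q a ^ 2) + (z - a) * ((2 * Q z * deriv Q z) / Q a ^ 2)) z := fun z => by
    have h1 := ((hasDerivAt_id z).sub_const a).mul (((hQd z).hasDerivAt.pow 2).div_const (Q a ^ 2))
    convert! h1 using 1
    simp
  refine ⟨fun z => (z - a) * (Q z ^ 2 / Q a ^ 2), fun z => (hder z).differentiableAt, ?_, ?_, ?_⟩
  · intro i
    rw [← iterate_mod_minimalPeriod_eq, hp]
    rcases Nat.eq_zero_or_pos (i % p0) with h | h
    · simp [h]
    · simp [hQi _ h (Nat.mod_lt _ h0)]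
  · rw [(hder a).deriv]; field_simp; simp
  · intro i h1 h2
    rw [(hder _).deriv, hQi i h1 h2]; simp

lemma neutral_closure {f : Ent} {a : ℂ} {p0 : ℕ} (hp : minimalPeriod (eapp1 f) a = p0) (h0 : 0 < p0)
    (hn : ‖deriv (eapp1 f)^[p0] a‖ = 1) {B : Set ℂ} (haB : a ∈ B) : f ∈ closure (RepSet B p0) := by
  obtain ⟨h, hhd, hh0, hh1, hhi⟩ := exists_bump hp h0
  have hf := ent_diff f
  rw [mem_closure_iff_nhds]
  intro U hU
  obtain ⟨R, ε, hR, hε, hU⟩ := nhds_ent hU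
  set c := deriv (eapp1 f) a
  obtain ⟨M, hM⟩ := ((isCompact_closedBall (0:ℂ) R).image_of_continuousOn
    (hhd.continuous.continuousOn)).isBounded.exists_norm_le
  have hM' : ∀ z, ‖z‖ ≤ R → ‖h z‖ ≤ |M| := fun z hz =>
    (hM _ ⟨z, by simpa using hz, rfl⟩).trans (le_abs_self M)
  set τ : ℝ := ε / (‖c‖ * |M| + 1) / 2 with hτ
  have hτ0 : 0 < τ := by positivity
  set g : ℂ → ℂ := fun z => eapp1 f z + τ * c * h z with hg
  have hgd : Differentiable ℂ g := hf.add (hhd.const_mul _)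
  have hit : ∀ i, g^[i] a = (eapp1 f)^[i] a := by
    intro i
    induction i with
    | zero => rfl
    | succ i ih => rw [iterate_succ_apply', iterate_succ_apply', ih, hg]; simp [hh0]
  have hgder : ∀ z, deriv g z = deriv (eapp1 f) z + τ * c * deriv h z := fun z =>
    ((hf z).hasDerivAt.add ((hhd z).hasDerivAt.const_mul _)).deriv
  let G : Ent := ⟨⟨g, hgd.continuous⟩, hgd⟩
  refine ⟨G, hU G fun z hz => ?_, a, haB, ?_, ?_⟩
  · have : eapp1 G z - eapp1 f z = τ * c * h z := by
      change g z - eapp1 f z = _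
      rw [hg]; ring
    rw [this, norm_mul, norm_mul, Complex.norm_real, Real.norm_of_nonneg hτ0.le]
    have h1 : ‖c‖ * ‖h z‖ ≤ ‖c‖ * |M| := by gcongr; exact hM' z hz
    have h2 : τ * (‖c‖ * |M| + 1) = ε / 2 := by rw [hτ]; field_simp
    nlinarith
  · change g^[p0] a = a
    rw [hit, ← hp, iterate_minimalPeriod]
  · change 1 < ‖deriv g^[p0] a‖
    have : deriv g^[p0] a = (1 + τ) * deriv (eapp1 f)^[p0] a := by
      obtain ⟨q, rfl⟩ : ∃ q, p0 = q + 1 := ⟨p0 - 1, by omega⟩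
      rw [deriv_iter hgd, deriv_iter hf, Finset.prod_range_succ', Finset.prod_range_succ']
      have : ∀ i ∈ Finset.range q, deriv g (g^[i+1] a) = deriv (eapp1 f) ((eapp1 f)^[i+1] a) := by
        intro i hi
        rw [hit, hgder, hhi (i+1) (by omega) (by have := Finset.mem_range.1 hi; omega)]; simp
      rw [Finset.prod_congr rfl this, iterate_zero, iterate_zero, id, hgder, hh1]; ring
    rw [this, norm_mul, hn, mul_one]
    have : (1 + (τ:ℂ)) = ((1 + τ : ℝ) : ℂ) := by push_cast; rfl
    rw [this, Complex.norm_real, Real.norm_of_nonneg (by linarith)]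
    linarith

structure Good (f : Ent) : Prop where
  rep : ∃ y : ℂ, ∃ m, 1 ≤ m ∧ (eapp1 f)^[m] y = y ∧ 1 < ‖deriv (eapp1 f)^[m] y‖
  noneu : ∀ m, 1 ≤ m → ∀ a, (eapp1 f)^[m] a = a → ‖deriv (eapp1 f)^[m] a‖ ≠ 1
  bdd : ∀ p ∈ Fatou1 f, ∃ r > 0, ∃ R : ℝ, ∀ n, ∀ x ∈ ball p r, ‖(eapp1 f)^[n] x‖ ≤ R

lemma no_excursion {f : Ent} {B : Set ℂ} (hf : f ∉ closure (⋃ m ∈ Set.Ici 1, RepSet B m)) :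
    ∃ R : ℝ, ∀ n, ∀ x ∈ B, deriv (eapp1 f)^[n] x ≠ 0 → ‖(eapp1 f)^[n] x‖ ≤ R := by
  obtain ⟨R, ε, hR, hε, hU⟩ := nhds_ent (isClosed_closure.isOpen_compl.mem_nhds hf)
  refine ⟨R, fun n x hx hd => ?_⟩
  by_contra! hn
  obtain ⟨g, hgd, hg, m, hm, hgm, hgm'⟩ := excursion (ent_diff f) hR hε hn hd
  refine hU ⟨⟨g, hgd.continuous⟩, hgd⟩ hg (subset_closure ?_)
  exact Set.mem_iUnion₂.2 ⟨m, hm, x, hx, hgm, hgm'⟩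

lemma good_generic : {f | Good f} ∈ residual Ent := by
  obtain ⟨b, hbc, -, hb⟩ := TopologicalSpace.exists_countable_basis ℂ
  set A : Set ℂ → Set Ent := fun B => ⋃ m ∈ Set.Ici 1, RepSet B m with hA
  have hAo : ∀ B, IsOpen B → IsOpen (A B) := fun B hB => isOpen_biUnion fun m _ => repSet_open hB m
  have h1 : ∀ᶠ f in residual Ent, ∀ B ∈ b, ∀ m, f ∉ frontier (RepSet B m) := by
    refine (eventually_countable_ball hbc).2 fun B hB => eventually_countable_forall.2 fun m => ?_
    exact res_aux (repSet_open (hb.isOpen hB) m)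
  have h2 : ∀ᶠ f in residual Ent, ∀ B ∈ b, f ∉ frontier (A B) :=
    (eventually_countable_ball hbc).2 fun B hB => res_aux (hAo B (hb.isOpen hB))
  have h3 : ∀ᶠ f in residual Ent, f ∉ frontier (A Set.univ) := res_aux (hAo _ isOpen_univ)
  filter_upwards [h1, h2, h3] with f h1 h2 h3
  have hf := ent_diff f
  have hrep : ∃ y : ℂ, ∃ m, 1 ≤ m ∧ (eapp1 f)^[m] y = y ∧ 1 < ‖deriv (eapp1 f)^[m] y‖ := by
    have : f ∈ A Set.univ := by
      refine mem_of_closure (hAo _ isOpen_univ) h3 ?_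
      by_contra h
      obtain ⟨R, hR⟩ := no_excursion h
      have := hR 0 ((|R| + 1 : ℝ) : ℂ) trivial (by simp)
      rw [iterate_zero, id, Complex.norm_real, Real.norm_of_nonneg (by positivity)] at this
      linarith [le_abs_self R]
    obtain ⟨m, hm, x, -, hx⟩ := Set.mem_iUnion₂.1 this
    exact ⟨x, m, hm, hx⟩
  refine ⟨hrep, ?_, ?_⟩
  · intro m hm a ham hn
    have hper : IsPeriodicPt (eapp1 f) m a := ham
    have h0 : 0 < minimalPeriod (eapp1 f) a := hper.minimalPeriod_pos hm
    set p0 := minimalPeriod (eapp1 f) a with hp0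
    obtain ⟨k, hk⟩ := hper.minimalPeriod_dvd
    have hp0a : (eapp1 f)^[p0] a = a := iterate_minimalPeriod
    have hn1 : ‖deriv (eapp1 f)^[p0] a‖ = 1 := by
      rw [hk, deriv_iter_pow hf hp0a, norm_pow] at hn
      refine (pow_eq_one_iff_of_nonneg (norm_nonneg _) ?_).1 hn
      rintro rfl; omega
    have hfr : ∃ᶠ z in 𝓝[≠] a, (eapp1 f)^[p0] z = id z := by
      rw [frequently_nhdsWithin_iff, hb.nhds_hasBasis.frequently_iff]
      rintro B ⟨hB, haB⟩
      obtain ⟨x, hx, hx1, hx2⟩ := mem_of_closure (repSet_open (hb.isOpen hB) p0) (h1 B hB p0)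
        (neutral_closure hp0.symm h0 hn1 haB)
      refine ⟨x, hx, hx1, ?_⟩
      rintro rfl
      linarith
    have hid := AnalyticOnNhd.eq_of_frequently_eq (f := (eapp1 f)^[p0]) (g := id) (z₀ := a)
      ((hf.iterate p0).differentiableOn.analyticOnNhd isOpen_univ)
      (differentiable_id.differentiableOn.analyticOnNhd isOpen_univ) hfr
    obtain ⟨y, l, hl, hy, hy2⟩ := hrep
    obtain ⟨B, hB, haB, -⟩ := hb.exists_subset_of_mem_open (Set.mem_univ a) isOpen_univ
    obtain ⟨x, hx, hx1, hx2⟩ := mem_of_closure (repSet_open (hb.isOpen hB) p0) (h1 B hB p0)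
        (neutral_closure hp0.symm h0 hn1 haB)
    rw [hid, deriv_id] at hx2
    simp at hx2
  · rintro p ⟨U, hU, hpU, h⟩
    obtain ⟨B, hB, hpB, hBU⟩ := hb.exists_subset_of_mem_open hpU hU
    have hnot : f ∉ closure (A B) := by
      intro hc
      obtain ⟨m, hm, x, hx, hx1, hx2⟩ := Set.mem_iUnion₂.1 (mem_of_closure (hAo B (hb.isOpen hB)) (h2 B hB) hc)
      exact rep_not_fatou hm hx1 hx2 ⟨U, hU, hBU hx, h⟩
    obtain ⟨R, hR⟩ := no_excursion hnot
    obtain ⟨r, hr, hrB⟩ := Metric.isOpen_iff.1 (hb.isOpen hB) p hpB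
    refine ⟨r, hr, R, fun n x hx => ?_⟩
    by_contra! hlt
    have hW : ∀ᶠ y in 𝓝 x, y ∈ ball p r ∧ R < ‖(eapp1 f)^[n] y‖ :=
      Filter.Eventually.and (isOpen_ball.mem_nhds hx) ((hf.iterate n).continuous.norm.continuousAt.eventually (lt_mem_nhds hlt))
    have h0 : deriv (eapp1 f)^[n] =ᶠ[𝓝 x] 0 := by
      filter_upwards [hW] with y hy
      by_contra hd
      linarith [hR n y (hrB hy.1) hd]
    have hid := AnalyticOnNhd.eq_of_eventuallyEq (f := deriv (eapp1 f)^[n]) (g := 0) (z₀ := x)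
      ((hf.iterate n).differentiableOn.analyticOnNhd isOpen_univ).deriv
      (fun _ _ => analyticAt_const) h0
    obtain ⟨y, m, hm, hy, hy2⟩ := hrep
    have e1 := deriv_iter_pow hf hy n
    have hne : deriv (eapp1 f)^[m * n] y ≠ 0 := by
      rw [e1]; apply pow_ne_zero; intro h; rw [h] at hy2; simp at hy2; linarith
    apply hne
    have e2 := congrFun hid y
    rw [deriv_iter hf, Pi.zero_apply, Finset.prod_eq_zero_iff] at e2
    obtain ⟨i, hi, hi0⟩ := e2
    rw [deriv_iter hf]
    refine Finset.prod_eq_zero (Finset.mem_range.2 ((Finset.mem_range.1 hi).trans_le ?_)) hi0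
    exact Nat.le_mul_of_pos_left n hm

lemma fatou_of_bdd {f : Ent} {p : ℂ} {r R : ℝ} (hr : 0 < r)
    (h : ∀ n, ∀ x ∈ ball p r, ‖(eapp1 f)^[n] x‖ ≤ R) : p ∈ Fatou1 f := by
  have hf := ent_diff f
  refine ⟨ball p r, isOpen_ball, mem_ball_self hr, fun k hk => ?_⟩
  obtain ⟨l, hl, g, hg⟩ := montel (U := ball p r) (F := fun n => (eapp1 f)^[k n])
    (fun n => (hf.iterate _).differentiableOn) (fun x hx => by
      obtain ⟨s, hs, hsb⟩ := Metric.isOpen_iff.1 isOpen_ball x hx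
      exact ⟨s, hs, R, hsb, fun n z hz => h _ z (hsb hz)⟩)
  refine ⟨l, hl, Or.inl ⟨g, ?_, hg⟩⟩
  exact hg.differentiableOn (Eventually.of_forall fun n => (hf.iterate _).differentiableOn) isOpen_ball

lemma fatou_ball {f : Ent} {p : ℂ} {r R : ℝ}
    (h : ∀ n, ∀ x ∈ ball p r, ‖(eapp1 f)^[n] x‖ ≤ R) : ball p r ⊆ Fatou1 f := by
  intro x hx
  obtain ⟨s, hs, hsb⟩ := Metric.isOpen_iff.1 isOpen_ball x hx
  exact fatou_of_bdd hs fun n z hz => h n z (hsb hz)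

lemma fatou_open {f : Ent} (hG : Good f) : IsOpen (Fatou1 f) := by
  rw [Metric.isOpen_iff]
  intro p hp
  obtain ⟨r, hr, R, h⟩ := hG.bdd p hp
  exact ⟨r, hr, fatou_ball h⟩

lemma fatou_compact {f : Ent} (hG : Good f) {K : Set ℂ} (hK : IsCompact K) (hKF : K ⊆ Fatou1 f) :
    ∃ R : ℝ, ∀ n, ∀ x ∈ K, ‖(eapp1 f)^[n] x‖ ≤ R := by
  refine hK.induction_on (p := fun K => ∃ R : ℝ, ∀ n, ∀ x ∈ K, ‖(eapp1 f)^[n] x‖ ≤ R) ?_ ?_ ?_ ?_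
  · exact ⟨0, by simp⟩
  · rintro s t hst ⟨R, h⟩
    exact ⟨R, fun n x hx => h n x (hst hx)⟩
  · rintro s t ⟨R, h⟩ ⟨R', h'⟩
    refine ⟨max R R', fun n x hx => ?_⟩
    rcases hx with hx | hx
    · exact (h n x hx).trans (le_max_left _ _)
    · exact (h' n x hx).trans (le_max_right _ _)
  · intro x hx
    obtain ⟨r, hr, R, h⟩ := hG.bdd x (hKF hx)
    exact ⟨ball x r, mem_nhdsWithin_of_mem_nhds (ball_mem_nhds x hr), R, h⟩

lemma entire_hull {e : ℂ → ℂ} (he : Differentiable ℂ e) {K : Set ℂ} (hK : IsCompact K) {z : ℂ}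
    (hz : InHull K z) {R : ℝ} (hR : ∀ x ∈ K, ‖e x‖ ≤ R) : ‖e z‖ ≤ R := by
  refine le_of_forall_pos_le_add fun ε hε => ?_
  obtain ⟨ρ, hρ⟩ := hK.isBounded.exists_norm_le
  set s : NNReal := Real.toNNReal (max ρ ‖z‖ + 1) with hs
  have hs' : (s : ℝ) = max ρ ‖z‖ + 1 := Real.coe_toNNReal _ (by positivity)
  have hps := he.hasFPowerSeriesOnBall 0 (R := s + 1) (by positivity)
  have hu := hps.tendstoUniformlyOn (r' := s) ENNReal.coe_lt_top
  rw [Metric.tendstoUniformlyOn_iff] at hu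
  obtain ⟨n, hn⟩ := (hu (ε / 2) (by positivity)).exists
  set p := cauchyPowerSeries e 0 ↑(s + 1) with hp
  set P : Polynomial ℂ := ∑ k ∈ Finset.range n, Polynomial.monomial k (p.coeff k) with hP
  have hPe : ∀ y, P.eval y = p.partialSum n y := by
    intro y
    rw [hP, Polynomial.eval_finsetSum, FormalMultilinearSeries.partialSum]
    refine Finset.sum_congr rfl fun k _ => ?_
    rw [Polynomial.eval_monomial, FormalMultilinearSeries.apply_eq_pow_smul_coeff, smul_eq_mul, mul_comm]
  have hd : ∀ y, ‖y‖ < s → ‖e y - P.eval y‖ < ε / 2 := by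
    intro y hy
    have := hn y (by simpa using hy)
    rw [dist_eq_norm, zero_add] at this
    rw [hPe]; exact this
  have h1 := hz P (R + ε / 2) (fun x hx => by
    have h1 := hd x (by rw [hs']; linarith [hρ x hx, le_max_left ρ ‖z‖])
    have h2 := hR x hx
    have h3 := norm_sub_norm_le (P.eval x) (e x)
    rw [norm_sub_rev] at h3
    linarith)
  have h2 := hd z (by rw [hs']; linarith [le_max_right ρ ‖z‖])
  have h3 := norm_sub_norm_le (e z) (P.eval z)
  linarith

lemma fatou_hull {f : Ent} (hG : Good f) {K : Set ℂ} (hKF : K ⊆ Fatou1 f) (hK : IsCompact K) {z : ℂ}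
    (hz : InHull K z) : z ∈ Fatou1 f := by
  obtain ⟨δ, hδ, hsub⟩ := hK.exists_cthickening_subset_open (fatou_open hG) hKF
  obtain ⟨R, hR⟩ := fatou_compact hG hK.cthickening hsub
  refine fatou_of_bdd hδ (R := R) fun n x hx => ?_
  have he : Differentiable ℂ (fun w => (eapp1 f)^[n] (w + (x - z))) :=
    ((ent_diff f).iterate n).comp (differentiable_id.add_const _)
  have := entire_hull he hK hz (R := R) fun w hw => hR n _ (by
    refine mem_cthickening_of_dist_le _ w _ _ hw ?_
    rw [mem_ball, dist_eq_norm] at hx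
    rw [dist_eq_norm]; simpa using hx.le)
  simpa using this

lemma fatou_ne_univ {f : Ent} (hG : Good f) : ∃ a, a ∉ Fatou1 f := by
  obtain ⟨y, m, hm, h1, h2⟩ := hG.rep
  exact ⟨y, rep_not_fatou hm h1 h2⟩

lemma comp_disc {f : Ent} (hG : Good f) {p : ℂ} (hp : p ∈ Fatou1 f) :
    BiholoToDisc (connectedComponentIn (Fatou1 f) p) := by
  obtain ⟨a, ha⟩ := fatou_ne_univ hG
  exact rmt (fatou_open hG).connectedComponentIn isPreconnected_connectedComponentIn
    (mem_connectedComponentIn hp) (fun h => ha (connectedComponentIn_subset _ _ h))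
    (hasSqrts_comp (fatou_open hG) (fun K h1 h2 z h3 => fatou_hull hG h1 h2 h3) hp)

lemma comp_dynb {f : Ent} (hG : Good f) {p : ℂ} : DynBounded1 f (connectedComponentIn (Fatou1 f) p) := by
  intro L hL hLc
  obtain ⟨R, hR⟩ := fatou_compact hG hLc (hL.trans (connectedComponentIn_subset _ _))
  refine ⟨closedBall 0 R, isCompact_closedBall _ _, ?_⟩
  rintro k _ ⟨x, hx, rfl⟩
  simpa using hR k x hx

lemma fatou_maps {f : Ent} (hG : Good f) {p : ℂ} (hp : p ∈ Fatou1 f) (i : ℕ) : (eapp1 f)^[i] p ∈ Fatou1 f := by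
  have hf := ent_diff f
  induction i with
  | zero => exact hp
  | succ i ih =>
    rw [iterate_succ_apply']
    set q := (eapp1 f)^[i] p
    obtain ⟨r, hr, R, h⟩ := hG.bdd q ih
    have hnc : ¬ ∀ᶠ w in 𝓝 q, eapp1 f w = eapp1 f q := by
      intro hc
      obtain ⟨y, m, hm, h1, h2⟩ := hG.rep
      have := (locconst_deriv isOpen_univ isPreconnected_univ hf.differentiableOn trivial (Set.mem_univ y) hc).2
      rw [deriv_iter hf, Finset.prod_eq_zero (Finset.mem_range.2 hm) this] at h2
      simp at h2
      linarith
    have := open_map isOpen_univ hf.differentiableOn trivial hnc (ball_mem_nhds q hr)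
    rw [Set.inter_univ] at this
    obtain ⟨s, hs, hsb⟩ := Metric.mem_nhds_iff.1 this
    refine fatou_of_bdd hs (R := R) fun n x hx => ?_
    obtain ⟨x', hx', rfl⟩ := hsb hx
    rw [← iterate_succ_apply]
    exact h _ _ hx'

lemma lin_est {F : ℂ → ℂ} {c : ℂ} (hF : Differentiable ℂ F) (hc : F c = c) {ε : ℝ} (hε : 0 < ε) :
    ∀ᶠ x in 𝓝 c, ‖F x - c‖ ≤ (‖deriv F c‖ + ε) * ‖x - c‖ ∧ (‖deriv F c‖ - ε) * ‖x - c‖ ≤ ‖F x - c‖ := by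
  have h := (hasDerivAt_iff_isLittleO.1 (hF c).hasDerivAt).def hε
  filter_upwards [h] with x hx
  rw [hc, smul_eq_mul] at hx
  have h1 := norm_sub_norm_le (F x - c) ((x - c) * deriv F c)
  have h2 := norm_sub_norm_le ((x - c) * deriv F c) (F x - c)
  rw [norm_sub_rev ((x - c) * deriv F c)] at h2
  rw [norm_mul] at h1 h2
  constructor <;> linarith [mul_comm ‖x - c‖ ‖deriv F c‖]

lemma attr_local {F : ℂ → ℂ} {c : ℂ} (hF : Differentiable ℂ F) (hc : F c = c) (hd : ‖deriv F c‖ < 1) :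
    ∃ r > 0, ∀ x ∈ ball c r, Tendsto (fun n => F^[n] x) atTop (𝓝 c) := by
  set κ := (1 + ‖deriv F c‖) / 2 with hκ
  have hκ0 : 0 ≤ κ := by positivity
  have hκ1 : κ < 1 := by rw [hκ]; linarith
  obtain ⟨r, hr, h⟩ := Metric.eventually_nhds_iff_ball.1 (lin_est hF hc (ε := (1 - ‖deriv F c‖) / 2) (by linarith))
  refine ⟨r, hr, fun x hx => ?_⟩
  have hit : ∀ n, F^[n] x ∈ ball c r ∧ ‖F^[n] x - c‖ ≤ κ ^ n * ‖x - c‖ := by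
    intro n
    induction n with
    | zero => simpa using hx
    | succ n ih =>
      rw [iterate_succ_apply']
      have h1 := (h _ ih.1).1
      rw [show ‖deriv F c‖ + (1 - ‖deriv F c‖) / 2 = κ by rw [hκ]; ring] at h1
      have h2 : ‖F^[n] x - c‖ < r := by simpa [dist_eq_norm] using ih.1
      refine ⟨?_, ?_⟩
      · rw [mem_ball, dist_eq_norm]
        nlinarith [norm_nonneg (F^[n] x - c)]
      · rw [pow_succ']
        calc _ ≤ _ := h1
          _ ≤ κ * (κ ^ n * ‖x - c‖) := by gcongr; exact ih.2
          _ = _ := by ring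
  rw [tendsto_iff_norm_sub_tendsto_zero]
  have h0 : Tendsto (fun n => κ ^ n * ‖x - c‖) atTop (𝓝 0) := by
    simpa using (tendsto_pow_atTop_nhds_zero_of_lt_one hκ0 hκ1).mul_const ‖x - c‖
  exact squeeze_zero (fun _ => norm_nonneg _) (fun n => (hit n).2) h0

/-- a repelling fixed point cannot be a cluster point -/
lemma no_rep_cluster {F : ℂ → ℂ} (hF : Differentiable ℂ F) {y c : ℂ}
    (hcl : ∀ d, MapClusterPt d atTop (fun k => F^[k] y) → F d = d) (hc : MapClusterPt c atTop (fun k => F^[k] y))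
    (hd : 1 < ‖deriv F c‖) (hne : ∀ k, F^[k] y ≠ c) : False := by
  have hfc := hcl c hc
  set κ := (1 + ‖deriv F c‖) / 2 with hκ
  have hκ1 : 1 < κ := by rw [hκ]; linarith
  obtain ⟨r0, hr0, h⟩ := Metric.eventually_nhds_iff_ball.1 (lin_est hF hfc (ε := (‖deriv F c‖ - 1) / 2) (by linarith))
  set r := r0 / 2 with hrdef
  have hr : 0 < r := by positivity
  have hexp : ∀ x, ‖x - c‖ ≤ r → κ * ‖x - c‖ ≤ ‖F x - c‖ := by
    intro x hx
    have := (h x (by rw [mem_ball, dist_eq_norm]; linarith)).2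
    rwa [show ‖deriv F c‖ - (‖deriv F c‖ - 1) / 2 = κ by rw [hκ]; ring] at this
  have hFc : Tendsto F (𝓝 c) (𝓝 c) := by
    have := hF.continuous.tendsto c
    rwa [hfc] at this
  obtain ⟨r1, hr1, h1⟩ := Metric.eventually_nhds_iff_ball.1 (hFc.eventually (ball_mem_nhds c hr))
  set r' := min r1 r with hr'
  have hr'0 : 0 < r' := lt_min hr1 hr
  set S : Set ℂ := {x | r' ≤ ‖x - c‖ ∧ ‖x - c‖ ≤ r} with hS
  have hSc : IsCompact S := by
    refine (isCompact_closedBall c r).of_isClosed_subset ?_ ?_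
    · have hcn : Continuous fun x : ℂ => ‖x - c‖ := by fun_prop
      exact (isClosed_le continuous_const hcn).inter (isClosed_le hcn continuous_const)
    · intro x hx; rw [mem_closedBall, dist_eq_norm]; exact hx.2
  have hfreq : ∃ᶠ k in atTop, F^[k] y ∈ S := by
    rw [frequently_atTop]
    intro N
    obtain ⟨k, hkN, hk⟩ := frequently_atTop.1 (hc.frequently (ball_mem_nhds c hr'0)) N
    have hex : ∃ n, r' ≤ ‖F^[k + n] y - c‖ := by
      by_contra! hno
      have hgrow : ∀ n, κ ^ n * ‖F^[k] y - c‖ ≤ ‖F^[k + n] y - c‖ := by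
        intro n
        induction n with
        | zero => simp
        | succ n ih =>
          rw [← add_assoc, iterate_succ_apply', pow_succ']
          have := hexp (F^[k+n] y) ((hno n).le.trans (min_le_right _ _))
          nlinarith
      have h0 : 0 < ‖F^[k] y - c‖ := norm_pos_iff.2 (sub_ne_zero.2 (hne k))
      obtain ⟨n, hn⟩ := pow_unbounded_of_one_lt (r' / ‖F^[k] y - c‖) hκ1
      rw [div_lt_iff₀ h0] at hn
      linarith [hgrow n, hno n]
    classical
    obtain ⟨n, hn, hmin⟩ : ∃ n, r' ≤ ‖F^[k + n] y - c‖ ∧ ∀ i < n, ‖F^[k + i] y - c‖ < r' :=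
      ⟨Nat.find hex, Nat.find_spec hex, fun i hi => not_le.1 (Nat.find_min hex hi)⟩
    rw [dist_eq_norm] at hk
    obtain ⟨i, rfl⟩ : ∃ i, n = i + 1 := by
      cases n with
      | zero => rw [add_zero] at hn; linarith
      | succ i => exact ⟨i, rfl⟩
    refine ⟨k + (i + 1), by omega, hn, ?_⟩
    have h2 := h1 (F^[k+i] y) (by
      rw [mem_ball, dist_eq_norm]; exact (hmin i (by omega)).trans_le (min_le_left _ _))
    rw [← add_assoc, iterate_succ_apply']
    rw [dist_eq_norm] at h2
    exact h2.le
  obtain ⟨d, hdS, hdc⟩ := hSc.exists_mapClusterPt_of_frequently hfreq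
  have hfd := hcl d hdc
  have := hexp d hdS.2
  rw [hfd] at this
  have h3 := hdS.1
  nlinarith

lemma cluster_fixed {F : ℂ → ℂ} {V : Set ℂ} (hV : IsOpen V) (hVc : IsPreconnected V) (hF : Differentiable ℂ F)
    (hmap : Set.MapsTo F V V)
    (hb : ∀ x ∈ V, ∃ r > 0, ∃ M : ℝ, ball x r ⊆ V ∧ ∀ n, ∀ z ∈ ball x r, ‖F^[n] z‖ ≤ M)
    (hdisc : BiholoToDisc V) (hneu : ∀ a, F a = a → ‖deriv F a‖ ≠ 1) {y : ℂ} (hy : y ∈ V) {φ : ℕ → ℕ}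
    (hφ : StrictMono φ) {c : ℂ} (hc : Tendsto (fun j => F^[φ j] y) atTop (𝓝 c)) : F c = c := by
  have hmon : ∀ k : ℕ → ℕ, ∃ ψ : ℕ → ℕ, StrictMono ψ ∧ ∃ g, DifferentiableOn ℂ g V ∧
      TendstoLocallyUniformlyOn (fun j => F^[k (ψ j)]) g atTop V := by
    intro k
    obtain ⟨ψ, hψ, g, hg⟩ := montel (U := V) (F := fun j => F^[k j])
      (fun n => (hF.iterate _).differentiableOn) (fun x hx => by
        obtain ⟨r, hr, M, h1, h2⟩ := hb x hx
        exact ⟨r, hr, M, h1, fun n => h2 _⟩)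
    exact ⟨ψ, hψ, g, hg.differentiableOn (Eventually.of_forall fun n => (hF.iterate _).differentiableOn) hV, hg⟩
  obtain ⟨ψ, hψ, g, hgd, hg⟩ := hmon φ
  have hgy : g y = c := tendsto_nhds_unique (hg.tendsto_at hy) (hc.comp hψ.tendsto_atTop)
  have hit : ∀ n, ∀ z ∈ V, F^[n] z ∈ V := fun n z hz => hmap.iterate n hz
  by_cases hl : ∀ᶠ w in 𝓝 y, g w = g y
  · have h1 := (locconst_deriv hV hVc hgd hy hy hl).1
    have h2 := hg.tendsto_at (hmap hy)
    rw [h1 (hmap hy)] at h2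
    have h3 := (hF.continuous.tendsto _).comp (hg.tendsto_at hy)
    rw [← hgy]
    refine tendsto_nhds_unique h3 (h2.congr fun j => ?_)
    rw [← iterate_succ_apply, iterate_succ_apply']; rfl
  · exfalso
    have hnl : ∀ z ∈ V, ¬ ∀ᶠ w in 𝓝 z, g w = g z := by
      intro z hz h
      apply hl
      have h1 := (locconst_deriv hV hVc hgd hz hz h).1
      filter_upwards [hV.mem_nhds hy] with w hw
      rw [h1 hw, h1 hy]
    have hgV : ∀ z ∈ V, g z ∈ V := by
      intro z hz
      obtain ⟨n, z', hz', h⟩ := (hurwitz hV (Eventually.of_forall fun n => (hF.iterate _).differentiableOn)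
        hgd hg hz (hnl z hz) (hV.mem_nhds hz)).exists
      rw [← h]; exact hit _ _ hz'
    set k : ℕ → ℕ := fun j => φ (ψ j) with hk
    have hkm : StrictMono k := hφ.comp hψ
    obtain ⟨θ, hθ, χ, hχd, hχ⟩ := hmon (fun j => k (2 * j + 1) - k j)
    set N : ℕ → ℕ := fun i => k (2 * θ i + 1) - k (θ i) with hN
    have hN1 : ∀ i, 1 ≤ N i := fun i => by
      have : k (θ i) < k (2 * θ i + 1) := hkm (by omega)
      simp only [hN]; omega
    have hχg : ∀ z ∈ V, χ (g z) = g z := by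
      intro z hz
      have h1 : Tendsto (fun i => F^[k (θ i)] z) atTop (𝓝 (g z)) := (hg.tendsto_at hz).comp hθ.tendsto_atTop
      have h2 : Tendsto (fun i => F^[N i] (F^[k (θ i)] z)) atTop (𝓝 (χ (g z))) := by
        have h1' : Tendsto (fun i => F^[k (θ i)] z) atTop (𝓝[V] (g z)) :=
          tendsto_nhdsWithin_iff.2 ⟨h1, Eventually.of_forall fun i => hit _ _ hz⟩
        exact tendsto_comp_of_locally_uniform_limit_within (hχd.continuousOn _ (hgV z hz)) h1' (hχ · · _ (hgV z hz))
      have h3 : Tendsto (fun i => F^[k (2 * θ i + 1)] z) atTop (𝓝 (g z)) :=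
        (hg.tendsto_at hz).comp (tendsto_atTop_mono (fun i => by have := hθ.le_apply (x := i); show i ≤ _; omega) tendsto_id)
      refine tendsto_nhds_unique (h2.congr fun i => ?_) h3
      rw [← iterate_add_apply]
      congr 2
      have : k (θ i) < k (2 * θ i + 1) := hkm (by omega)
      simp only [hN]; omega
    have hχid : Set.EqOn χ id V := by
      refine AnalyticOnNhd.eqOn_of_preconnected_of_eventuallyEq (hχd.analyticOnNhd hV)
        (differentiableOn_id.analyticOnNhd hV) hVc (hgV y hy) ?_
      filter_upwards [open_map hV hgd hy (hnl y hy) univ_mem] with w hw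
      obtain ⟨z, hz, rfl⟩ := hw
      exact hχg z hz.2
    obtain ⟨Φ, Ψ, hΦ, hΨ, hΦm, hΨm, hΨΦ, hΦΨ⟩ := hdisc
    set G : ℂ → ℂ := fun w => Φ (F (Ψ w)) with hG
    have hb1 : ∀ z : ℂ, ‖z‖ < 1 ↔ z ∈ ball (0:ℂ) 1 := fun z => by simp
    have hGit : ∀ n, ∀ w ∈ ball (0:ℂ) 1, G^[n] w = Φ (F^[n] (Ψ w)) := by
      intro n w hw
      induction n with
      | zero => exact (hΦΨ w hw).symm
      | succ n ih =>
        rw [iterate_succ_apply', iterate_succ_apply', ih, hG]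
        simp only
        rw [hΨΦ _ (hit n _ (hΨm hw))]
    obtain ⟨a, ha, hGa⟩ := wolff (G := G) (n := N)
      (hΦ.comp (hF.comp_differentiableOn hΨ) (fun w hw => hmap (hΨm hw)))
      (fun z hz => (hb1 _).2 (hΦm (hmap (hΨm ((hb1 _).1 hz))))) hN1 (fun z hz => by
        have hz' := (hb1 z).1 hz
        have h1 := hχ.tendsto_at (hΨm hz')
        rw [hχid (hΨm hz')] at h1
        have h2 := ((hΦ.continuousOn.continuousAt (hV.mem_nhds (hΨm hz'))).tendsto).comp h1
        rw [hΦΨ z hz'] at h2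
        exact h2.congr fun j => (hGit _ _ hz').symm)
    have ha' := (hb1 a).1 ha
    have hbV := hΨm ha'
    set b := Ψ a with hbdef
    have hFb : F b = b := by
      rw [← hΨΦ (F b) (hmap hbV)]
      exact congrArg Ψ hGa
    have h1 := ((hχ.deriv (Eventually.of_forall fun n => (hF.iterate _).differentiableOn) hV).tendsto_at hbV).norm
    have h2 : deriv χ b = 1 := by
      have : χ =ᶠ[𝓝 b] id := by filter_upwards [hV.mem_nhds hbV] with w hw using hχid hw
      rw [this.deriv_eq, deriv_id]
    have h3 : Tendsto (fun i => ‖deriv F b‖ ^ (N i)) atTop (𝓝 1) := by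
      rw [h2, norm_one] at h1
      refine h1.congr fun i => ?_
      simp only [comp]
      rw [(HasDerivAt.iterate _ (hF b).hasDerivAt hFb _).deriv, norm_pow]
    rcases lt_or_gt_of_ne (hneu b hFb) with h | h
    · have := le_of_tendsto' h3 (fun i => pow_le_of_le_one (norm_nonneg _) h.le (by have := hN1 i; omega))
      linarith
    · have := ge_of_tendsto' h3 (fun i => le_self_pow₀ h.le (by have := hN1 i; omega))
      linarith

lemma attracted {F : ℂ → ℂ} {V : Set ℂ} (hV : IsOpen V) (hVc : IsPreconnected V) (hF : Differentiable ℂ F)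
    (hmap : Set.MapsTo F V V)
    (hb : ∀ x ∈ V, ∃ r > 0, ∃ M : ℝ, ball x r ⊆ V ∧ ∀ n, ∀ z ∈ ball x r, ‖F^[n] z‖ ≤ M)
    (hdisc : BiholoToDisc V) (hneu : ∀ a, F a = a → ‖deriv F a‖ ≠ 1)
    (hrep : ∀ a ∈ V, F a = a → ¬ 1 < ‖deriv F a‖) {y : ℂ} (hy : y ∈ V) :
    ∃ c, F c = c ∧ ‖deriv F c‖ < 1 ∧ Tendsto (fun k => F^[k] y) atTop (𝓝 c) := by
  have hcl : ∀ d, MapClusterPt d atTop (fun k => F^[k] y) → F d = d := by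
    intro d hd
    obtain ⟨φ, hφ, h⟩ := MapClusterPt.tendsto_subseq hd
    exact cluster_fixed hV hVc hF hmap hb hdisc hneu hy hφ h
  obtain ⟨r, hr, M, -, hM⟩ := hb y hy
  obtain ⟨c, -, hc⟩ := (isCompact_closedBall (0:ℂ) M).exists_mapClusterPt_of_frequently
    (f := fun k => F^[k] y) (l := atTop) (Eventually.frequently (Eventually.of_forall fun k => by
      simpa using hM k y (mem_ball_self hr)))
  have hfc := hcl c hc
  rcases lt_or_gt_of_ne (hneu c hfc) with h | h
  · refine ⟨c, hfc, h, ?_⟩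
    obtain ⟨s, hs, hs2⟩ := attr_local hF hfc h
    obtain ⟨k, hk⟩ := (hc.frequently (ball_mem_nhds c hs)).exists
    rw [← tendsto_add_atTop_iff_nat k]
    refine (hs2 _ hk).congr fun n => ?_
    rw [iterate_add_apply]
  · exfalso
    by_cases hne : ∀ k, F^[k] y ≠ c
    · exact no_rep_cluster hF hcl hc h hne
    · push Not at hne
      obtain ⟨k, rfl⟩ := hne
      exact hrep _ (hmap.iterate k hy) hfc h

lemma nonwandering {f : Ent} (hG : Good f) {p : ℂ} (hp : p ∈ Fatou1 f)
    (hw : ¬ IsWandering1 f (connectedComponentIn (Fatou1 f) p)) :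
    ∃ i m, 1 ≤ m ∧ Set.MapsTo (eapp1 f)^[m] (connectedComponentIn (Fatou1 f) ((eapp1 f)^[i] p))
      (connectedComponentIn (Fatou1 f) ((eapp1 f)^[i] p)) := by
  have hf := ent_diff f
  have himg : ∀ q ∈ Fatou1 f, ∀ n, (eapp1 f)^[n] '' connectedComponentIn (Fatou1 f) q ⊆
      connectedComponentIn (Fatou1 f) ((eapp1 f)^[n] q) := by
    intro q hq n
    refine (isPreconnected_connectedComponentIn.image _ (hf.iterate n).continuous.continuousOn).subset_connectedComponentIn
      ⟨q, mem_connectedComponentIn hq, rfl⟩ ?_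
    rintro _ ⟨x, hx, rfl⟩
    exact fatou_maps hG (connectedComponentIn_subset _ _ hx) n
  have key : ∀ i j, i < j → ¬ Disjoint ((eapp1 f)^[i] '' connectedComponentIn (Fatou1 f) p)
      ((eapp1 f)^[j] '' connectedComponentIn (Fatou1 f) p) →
      ∃ i m, 1 ≤ m ∧ Set.MapsTo (eapp1 f)^[m] (connectedComponentIn (Fatou1 f) ((eapp1 f)^[i] p))
      (connectedComponentIn (Fatou1 f) ((eapp1 f)^[i] p)) := by
    intro i j hij hd
    obtain ⟨w, hwi, hwj⟩ := Set.not_disjoint_iff.1 hd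
    have e1 := connectedComponentIn_eq (himg p hp i hwi)
    have e2 := connectedComponentIn_eq (himg p hp j hwj)
    have h := himg _ (fatou_maps hG hp i) (j - i)
    rw [← iterate_add_apply, Nat.sub_add_cancel hij.le, e2, ← e1] at h
    exact ⟨i, j - i, by omega, Set.mapsTo_iff_image_subset.2 h⟩
  unfold IsWandering1 Pairwise at hw
  push Not at hw
  obtain ⟨i, j, hij, hd⟩ := hw
  rcases lt_or_gt_of_ne hij with h | h
  · exact key i j h hd
  · exact key j i h fun h' => hd h'.symm

lemma attr_or_wand {f : Ent} (hG : Good f) {p : ℂ} (hp : p ∈ Fatou1 f)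
    (hw : ¬ IsWandering1 f (connectedComponentIn (Fatou1 f) p)) :
    ∃ q : ℂ, IsAttPer1 f q ∧ p ∈ basinOf1 f q := by
  have hf := ent_diff f
  obtain ⟨i, m, hm, hmaps⟩ := nonwandering hG hp hw
  have hyF := fatou_maps hG hp i
  have hVo : IsOpen (connectedComponentIn (Fatou1 f) ((eapp1 f)^[i] p)) := (fatou_open hG).connectedComponentIn
  obtain ⟨c, hc, hcd, hlim⟩ := attracted hVo isPreconnected_connectedComponentIn (hf.iterate m) hmaps
    (fun x hx => by
      obtain ⟨r, hr, R, h⟩ := hG.bdd x (connectedComponentIn_subset _ _ hx)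
      obtain ⟨s, hs, hsb⟩ := Metric.isOpen_iff.1 hVo x hx
      refine ⟨min r s, lt_min hr hs, R, (ball_subset_ball (min_le_right _ _)).trans hsb, fun n z hz => ?_⟩
      rw [← iterate_mul]
      exact h _ z (ball_subset_ball (min_le_left _ _) hz))
    (comp_disc hG hyF) (fun a ha => hG.noneu m hm a ha)
    (fun a haV ha hd => rep_not_fatou hm ha hd (connectedComponentIn_subset _ _ haV))
    (mem_connectedComponentIn hyF)
  have hper : IsPeriodicPt (eapp1 f) m c := hc
  have h0 : 0 < minimalPeriod (eapp1 f) c := hper.minimalPeriod_pos hm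
  obtain ⟨k, hk⟩ := hper.minimalPeriod_dvd
  set p0 := minimalPeriod (eapp1 f) c with hp0
  have hp0c : (eapp1 f)^[p0] c = c := iterate_minimalPeriod
  have hd : ‖deriv (eapp1 f)^[p0] c‖ < 1 := by
    by_contra! h
    rw [hk, deriv_iter_pow hf hp0c, norm_pow] at hcd
    exact absurd (one_le_pow₀ h) (not_le.2 hcd)
  refine ⟨c, ⟨⟨m, hm, hc⟩, hd⟩, ?_⟩
  obtain ⟨r, hr, hat⟩ := attr_local (hf.iterate p0) hp0c hd
  obtain ⟨t, ht⟩ := (hlim.eventually (ball_mem_nhds c hr)).exists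
  have h1 := hat _ ht
  have h2 := (((hf.iterate ((p0 - 1) * i)).continuous.tendsto c).comp h1)
  refine ⟨(eapp1 f)^[(p0 - 1) * i] c, ⟨((p0 - 1) * i) % p0, Nat.mod_lt _ h0, ?_⟩, ?_⟩
  · exact iterate_mod_minimalPeriod_eq
  · rw [← tendsto_add_atTop_iff_nat (k * t + i)]
    refine h2.congr fun n => ?_
    change (eapp1 f)^[(p0 - 1) * i] (((eapp1 f)^[p0])^[n] (((eapp1 f)^[m])^[t] ((eapp1 f)^[i] p))) = _
    rw [← iterate_mul, ← iterate_mul, ← iterate_add_apply, ← iterate_add_apply, ← iterate_add_apply]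
    congr 2
    change _ = p0 * _
    obtain ⟨q, hq⟩ : ∃ q, p0 = q + 1 := ⟨p0 - 1, by omega⟩
    rw [hk, hq, Nat.add_sub_cancel]
    ring

/-- For a generic entire function `f`: every point of the Fatou set is attracted to an
attracting cycle or lies in a dynamically bounded wandering Fatou component, and every Fatou
component is a disc. -/
theorem stmt_18 :
    {f : Ent | (∀ p ∈ Fatou1 f,
        (∃ q : ℂ, IsAttPer1 f q ∧ p ∈ basinOf1 f q) ∨
        (IsWandering1 f (connectedComponentIn (Fatou1 f) p) ∧
          DynBounded1 f (connectedComponentIn (Fatou1 f) p))) ∧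
      (∀ p ∈ Fatou1 f, BiholoToDisc (connectedComponentIn (Fatou1 f) p))}
      ∈ residual Ent := by
  filter_upwards [good_generic] with f hG
  refine ⟨fun p hp => ?_, fun p hp => comp_disc hG hp⟩
  by_cases hw : IsWandering1 f (connectedComponentIn (Fatou1 f) p)
  · exact Or.inr ⟨hw, comp_dynb hG⟩
  · exact Or.inl (attr_or_wand hG hp hw)
end
end

section
/- For a generic endomorphism f of ℂⁿ (n ≥ 1): (a) any two points of the Julia set J_f are chain-equivalent for f (J_f lies in a single chain-recurrence class); (b) every point of an attracting cycle A of f is chain-recurrent and any two points of A are chain-equivalent; (c) no point of the basin of attraction of an attracting cycle A other than the points of A itself is chain-recurrent. (Theorem 4.1(a)–(c) of the paper, proved for Oka-Stein manifolds; specialized to ℂⁿ.) -/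
open Function Topology Filter Metric

noncomputable section

/-- `ℂⁿ` as a Euclidean space. -/
abbrev Cn (n : ℕ) := EuclideanSpace ℂ (Fin n)

/-- The space `End(ℂⁿ)` of holomorphic self-maps of `ℂⁿ`, topologized as a subspace of
the continuous maps `C(ℂⁿ, ℂⁿ)` with the compact-open topology. -/
abbrev Endo (n : ℕ) := {f : C(Cn n, Cn n) // Differentiable ℂ ⇑f}

variable {n : ℕ}

/-- The underlying function of an endomorphism. -/
def eapp (f : Endo n) : Cn n → Cn n := ⇑f.1

/-- `p` is a periodic point of `f`. -/
def IsPer (f : Endo n) (p : Cn n) : Prop := ∃ m, 1 ≤ m ∧ (eapp f)^[m] p = p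

/-- The minimal period of a periodic point. -/
def minPer (f : Endo n) (p : Cn n) : ℕ := Function.minimalPeriod (eapp f) p

/-- The eigenvalues at a periodic point `p`: the spectrum of the derivative of the
`minPer f p`-th iterate at `p`. -/
def eigs (f : Endo n) (p : Cn n) : Set ℂ := spectrum ℂ (fderiv ℂ ((eapp f)^[minPer f p]) p)

/-- Hyperbolic periodic point: no eigenvalue of absolute value 1. -/
def IsHypPer (f : Endo n) (p : Cn n) : Prop := IsPer f p ∧ ∀ z ∈ eigs f p, ‖z‖ ≠ 1

/-- Attracting periodic point: all eigenvalues of absolute value < 1. -/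
def IsAttPer (f : Endo n) (p : Cn n) : Prop := IsPer f p ∧ ∀ z ∈ eigs f p, ‖z‖ < 1

/-- Repelling periodic point: all eigenvalues of absolute value > 1. -/
def IsRepPer (f : Endo n) (p : Cn n) : Prop := IsPer f p ∧ ∀ z ∈ eigs f p, 1 < ‖z‖

/-- Saddle periodic point: hyperbolic with eigenvalues of absolute value both < 1 and > 1. -/
def IsSadPer (f : Endo n) (p : Cn n) : Prop :=
  IsHypPer f p ∧ (∃ z ∈ eigs f p, ‖z‖ < 1) ∧ (∃ z ∈ eigs f p, 1 < ‖z‖)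

/-- Super-attracting periodic point: the derivative of the `minPer`-th iterate vanishes. -/
def IsSuperAttPer (f : Endo n) (p : Cn n) : Prop :=
  IsPer f p ∧ fderiv ℂ ((eapp f)^[minPer f p]) p = 0

/-- The set of attracting periodic points of `f`. -/
def attSet (f : Endo n) : Set (Cn n) := {p | IsAttPer f p}

/-- The set of repelling periodic points of `f`. -/
def repSet (f : Endo n) : Set (Cn n) := {p | IsRepPer f p}

/-- The set of saddle periodic points of `f`. -/
def sadSet (f : Endo n) : Set (Cn n) := {p | IsSadPer f p}

/-- The robustly non-expelling set of `f`. -/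
def rne (f : Endo n) : Set (Cn n) :=
  {p | ∃ U : Set (Cn n), IsOpen U ∧ p ∈ U ∧ ∃ V ∈ 𝓝 f, ∃ K : Set (Cn n),
        IsCompact K ∧ ∀ g ∈ V, ∀ j : ℕ, (eapp g)^[j] '' U ⊆ K}

/-- A sequence of maps diverges locally uniformly to infinity on `U`. -/
def DivLocUnifOn (F : ℕ → Cn n → Cn n) (U : Set (Cn n)) : Prop :=
  ∀ L ⊆ U, IsCompact L → ∀ K : Set (Cn n), IsCompact K →
    ∀ᶠ j in atTop, Disjoint (F j '' L) K

/-- `p` belongs to the Fatou set of `f`: the iterates form a normal family near `p`. -/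
def FatouAt (f : Endo n) (p : Cn n) : Prop :=
  ∃ U : Set (Cn n), IsOpen U ∧ p ∈ U ∧
    ∀ k : ℕ → ℕ, StrictMono k → ∃ l : ℕ → ℕ, StrictMono l ∧
      ((∃ g : Cn n → Cn n, DifferentiableOn ℂ g U ∧
          TendstoLocallyUniformlyOn (fun j => (eapp f)^[k (l j)]) g atTop U) ∨
        DivLocUnifOn (fun j => (eapp f)^[k (l j)]) U)

/-- The Fatou set of `f`. -/
def Fatou (f : Endo n) : Set (Cn n) := {p | FatouAt f p}

/-- The Julia set of `f`. -/
def Julia (f : Endo n) : Set (Cn n) := (Fatou f)ᶜ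

/-- The cycle (finite orbit) of a periodic point `p`. -/
def cycleOf (f : Endo n) (p : Cn n) : Set (Cn n) := {x | ∃ i < minPer f p, (eapp f)^[i] p = x}

/-- The basin of attraction of the cycle of `p`. -/
def basinOf (f : Endo n) (p : Cn n) : Set (Cn n) :=
  {x | ∃ a ∈ cycleOf f p, Tendsto (fun k => (eapp f)^[minPer f p * k] x) atTop (𝓝 a)}

/-- The non-wandering set of `f`. -/
def nonWandering (f : Endo n) : Set (Cn n) :=
  {p | ∀ U ∈ 𝓝 p, ∃ k, 1 ≤ k ∧ (U ∩ (eapp f)^[k] '' U).Nonempty}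

/-- The set of points whose orbit can be closed in the weak sense. -/
def cloSet (f : Endo n) : Set (Cn n) :=
  {p | ∀ U ∈ 𝓝 p, ∀ V ∈ 𝓝 f, ∃ g ∈ V, ∃ q ∈ U, IsPer g q}

/-- `𝒯(m,K)`: endomorphisms all of whose periodic points in `K` of minimal period at most `m`
are transverse. -/
def TransSet (n : ℕ) (m : ℕ) (K : Set (Cn n)) : Set (Endo n) :=
  {f | ∀ p ∈ K, IsPer f p → minPer f p ≤ m → (1 : ℂ) ∉ eigs f p}

/-- `ℋ(m,K)`: endomorphisms all of whose periodic points in `K` of minimal period at most `m`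
are hyperbolic. -/
def HypSet (n : ℕ) (m : ℕ) (K : Set (Cn n)) : Set (Endo n) :=
  {f | ∀ p ∈ K, IsPer f p → minPer f p ≤ m → ∀ z ∈ eigs f p, ‖z‖ ≠ 1}

/-- The `m`-th iterate of an endomorphism as an endomorphism. -/
def iterEndo (f : Endo n) (m : ℕ) : Endo n :=
  ⟨⟨(eapp f)^[m], f.1.continuous.iterate m⟩, f.2.iterate m⟩

/-- The set of points with relatively compact forward orbit. -/
def boundedOrb (f : Endo n) : Set (Cn n) :=
  {p | ∃ K : Set (Cn n), IsCompact K ∧ ∀ k : ℕ, (eapp f)^[k] p ∈ K}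

/-- An `ε`-chain (pseudo-orbit) of `f` from `x` to `y`. -/
def EpsChain (f : Endo n) (ε : Cn n → ℝ) (x y : Cn n) : Prop :=
  ∃ N : ℕ, 1 ≤ N ∧ ∃ c : ℕ → Cn n, c 0 = x ∧ c N = y ∧
    ∀ j < N, dist (eapp f (c j)) (c (j + 1)) < ε (eapp f (c j))

/-- `x` and `y` are chain-equivalent for `f`. -/
def ChainEquiv (f : Endo n) (x y : Cn n) : Prop :=
  ∀ ε : Cn n → ℝ, Continuous ε → (∀ z, 0 < ε z) → EpsChain f ε x y ∧ EpsChain f ε y x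

/-- `x` is chain-recurrent for `f`. -/
def ChainRec (f : Endo n) (x : Cn n) : Prop :=
  ∀ ε : Cn n → ℝ, Continuous ε → (∀ z, 0 < ε z) → EpsChain f ε x x

/-- Attracting fixed point. -/
def IsAttFix (f : Endo n) (p : Cn n) : Prop :=
  eapp f p = p ∧ ∀ z ∈ spectrum ℂ (fderiv ℂ (eapp f) p), ‖z‖ < 1

/-- Repelling fixed point. -/
def IsRepFix (f : Endo n) (p : Cn n) : Prop :=
  eapp f p = p ∧ ∀ z ∈ spectrum ℂ (fderiv ℂ (eapp f) p), 1 < ‖z‖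

/-- Saddle fixed point. -/
def IsSadFix (f : Endo n) (p : Cn n) : Prop :=
  eapp f p = p ∧ (∀ z ∈ spectrum ℂ (fderiv ℂ (eapp f) p), ‖z‖ ≠ 1) ∧
    (∃ z ∈ spectrum ℂ (fderiv ℂ (eapp f) p), ‖z‖ < 1) ∧
    (∃ z ∈ spectrum ℂ (fderiv ℂ (eapp f) p), 1 < ‖z‖)

/-- `f` is a local biholomorphism at `p`: `f` agrees near `p` with a homeomorphism onto an
open set whose inverse is holomorphic. -/
def LocalBiholoAt (f : Endo n) (p : Cn n) : Prop :=
  ∃ φ : PartialHomeomorph (Cn n) (Cn n), p ∈ φ.source ∧ Set.EqOn (eapp f) φ φ.source ∧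
    DifferentiableOn ℂ φ.symm φ.target


lemma aux_montel {n : ℕ} (F : ℕ → Cn n → Cn n) (hF : ∀ k, Differentiable ℂ (F k)) (c : Cn n)
    {R B : ℝ} (hR : 0 < R) (hB : ∀ k, ∀ z ∈ ball c R, F k z ∈ closedBall (0 : Cn n) B) :
    ∃ l : ℕ → ℕ, StrictMono l ∧ ∃ g : Cn n → Cn n, DifferentiableOn ℂ g (ball c (R/4)) ∧
      TendstoUniformlyOn (fun j => F (l j)) g atTop (ball c (R/4)) := by
  have hB0 : 0 ≤ B := by
    have := hB 0 c (mem_ball_self hR)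
    rw [mem_closedBall] at this
    exact dist_nonneg.trans this
  have hcs : CompactSpace (closedBall c (R/2)) :=
    isCompact_iff_compactSpace.1 (isCompact_closedBall c (R/2))
  let Φ : ℕ → BoundedContinuousFunction (closedBall c (R/2)) (Cn n) := fun k =>
    BoundedContinuousFunction.mkOfCompact
      ⟨fun z => F k z, (hF k).continuous.comp continuous_subtype_val⟩
  have hΦ : ∀ k z, Φ k z = F k z := fun k z => rfl
  have hlip : ∀ k, ∀ z ∈ closedBall c (R/2), ∀ w, dist w z < R/2 →
      dist (F k w) (F k z) ≤ (2*B)/(R/2) * dist w z := by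
    intro k z hz w hw
    have hsub : ball z (R/2) ⊆ ball c R := by
      apply ball_subset_ball'
      rw [mem_closedBall] at hz
      linarith
    refine Complex.dist_le_div_mul_dist_of_mapsTo_ball (hF k).differentiableOn ?_ hw
    intro y hy
    have h1 := hB k y (hsub hy)
    have h2 := hB k z (hsub (mem_ball_self (by linarith)))
    rw [mem_closedBall] at h1 h2 ⊢
    have := dist_triangle_right (F k y) (F k z) 0
    linarith
  have hcomp : IsCompact (closure (Set.range Φ)) := by
    refine BoundedContinuousFunction.arzela_ascoli (closedBall (0 : Cn n) B)
      (isCompact_closedBall _ _) _ ?_ ?_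
    · rintro _ x ⟨k, rfl⟩
      rw [hΦ]
      refine hB k _ (closedBall_subset_ball (by linarith) x.2)
    · intro z
      rw [Metric.equicontinuousAt_iff_right]
      intro ε hε
      have hC : 0 < (2*B)/(R/2) + 1 := by positivity
      have h1 : ∀ᶠ w in 𝓝 z, dist w z < min (R/2) (ε / ((2*B)/(R/2) + 1)) :=
        Metric.ball_mem_nhds z (lt_min (by linarith) (by positivity))
      filter_upwards [h1] with w hw
      rintro ⟨_, k, rfl⟩
      show dist (F k z) (F k w) < ε
      have h2 := hlip k z z.2 w (lt_of_lt_of_le hw (min_le_left _ _))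
      have h3 : dist (w : Cn n) z < ε / ((2*B)/(R/2) + 1) := lt_of_lt_of_le hw (min_le_right _ _)
      rw [lt_div_iff₀ hC] at h3
      have h4 := dist_nonneg (x := (w : Cn n)) (y := z)
      rw [dist_comm]
      nlinarith
  obtain ⟨G, -, l, hl, hlim⟩ := hcomp.tendsto_subseq (x := Φ) (fun k => subset_closure ⟨k, rfl⟩)
  classical
  let g : Cn n → Cn n := fun z => if h : z ∈ closedBall c (R/2) then G ⟨z, h⟩ else 0
  have hgu : TendstoUniformlyOn (fun j => F (l j)) g atTop (closedBall c (R/2)) := by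
    rw [Metric.tendstoUniformlyOn_iff]
    intro ε hε
    filter_upwards [(Metric.tendsto_nhds.1 hlim) ε hε] with j hj z hz
    have : g z = G ⟨z, hz⟩ := dif_pos hz
    rw [this, dist_comm]
    exact lt_of_le_of_lt (BoundedContinuousFunction.dist_coe_le_dist (f := Φ (l j)) (g := G) ⟨z, hz⟩) hj
  have hsub4 : ball c (R/4) ⊆ closedBall c (R/2) := by
    intro z hz
    rw [mem_ball] at hz
    rw [mem_closedBall]
    linarith
  have hgu4 := hgu.mono hsub4
  have hder : UniformCauchySeqOn (fun j => fderiv ℂ (F (l j))) atTop (ball c (R/4)) := by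
    rw [Metric.uniformCauchySeqOn_iff]
    intro ε hε
    obtain ⟨N, hN⟩ := Metric.uniformCauchySeqOn_iff.1 hgu.uniformCauchySeqOn (ε * R / 16)
      (by positivity)
    refine ⟨N, fun a ha b hb z hz => ?_⟩
    have hsub : ball z (R/4) ⊆ closedBall c (R/2) := by
      intro y hy
      rw [mem_ball] at hy hz
      rw [mem_closedBall]
      have := dist_triangle y z c
      linarith
    have hD : Differentiable ℂ (F (l a) - F (l b)) := (hF _).sub (hF _)
    have h := Complex.norm_fderiv_le_div_of_mapsTo_ball (f := F (l a) - F (l b)) (c := z)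
      (R₁ := R/4) (R₂ := 2 * (ε * R/16)) hD.differentiableOn ?_ (by positivity)
    · rw [fderiv_sub (hF _ z) (hF _ z)] at h
      rw [dist_eq_norm]
      refine lt_of_le_of_lt h ?_
      rw [div_lt_iff₀ (by positivity)]
      nlinarith [mul_pos hε hR]
    · intro y hy
      have h1 := hN a ha b hb y (hsub hy)
      have h2 := hN a ha b hb z (hsub (mem_ball_self (by linarith)))
      rw [dist_eq_norm] at h1 h2
      rw [mem_closedBall]
      rw [dist_eq_norm]
      have := norm_sub_le ((F (l a) - F (l b)) y) ((F (l a) - F (l b)) z)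
      simp only [Pi.sub_apply] at this ⊢
      linarith
  have hpt : ∀ z ∈ ball c (R/4), ∃ L, Tendsto (fun j => fderiv ℂ (F (l j)) z) atTop (𝓝 L) := by
    intro z hz
    exact cauchySeq_tendsto_of_complete (hder.cauchySeq hz)
  choose! g' hg' using hpt
  have hdu := hder.tendstoUniformlyOn_of_tendsto hg'
  refine ⟨l, hl, g, fun z hz => ?_, hgu4⟩
  refine (hasFDerivAt_of_tendstoUniformlyOn isOpen_ball hdu (fun j x _ => (hF _ x).hasFDerivAt)
    (fun x hx => hgu4.tendsto_at hx) hz).differentiableAt.differentiableWithinAt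

lemma aux_bdd_fatou {n : ℕ} (f : Endo n) (U : Set (Cn n)) (hU : IsOpen U) {B : ℝ}
    (hB : ∀ k, ∀ z ∈ U, (eapp f)^[k] z ∈ closedBall (0 : Cn n) B) (p : Cn n) (hp : p ∈ U) :
    p ∈ Fatou f := by
  obtain ⟨R, hR, hRU⟩ := Metric.isOpen_iff.1 hU p hp
  refine ⟨ball p (R/4), isOpen_ball, mem_ball_self (by linarith), fun k hk => ?_⟩
  obtain ⟨l, hl, g, hg, hgt⟩ := aux_montel (fun j => (eapp f)^[k j])
    (fun j => Differentiable.iterate f.2 _) p hR (fun j z hz => hB _ z (hRU hz))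
  exact ⟨l, hl, Or.inl ⟨g, hg, hgt.tendstoLocallyUniformlyOn⟩⟩

lemma aux_julia_forward {n : ℕ} (f : Endo n) (p : Cn n) (hp : p ∈ Julia f) :
    eapp f p ∈ Julia f := by
  intro hF
  apply hp
  have hc : Continuous (eapp f) := f.1.continuous
  have hd : Differentiable ℂ (eapp f) := f.2
  obtain ⟨U, hU, hpU, h⟩ := hF
  refine ⟨eapp f ⁻¹' U, hU.preimage hc, hpU, fun k hk => ?_⟩
  have hk1 : ∀ j, k (j+1) = (k (j+1) - 1) + 1 := fun j => by
    have := hk.le_apply (x := j+1)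
    omega
  obtain ⟨l, hl, hlim⟩ := h (fun j => k (j+1) - 1) (fun a b hab => by
    have h1 := hk (Nat.add_lt_add_right hab 1)
    have h2 := hk1 a
    show k (a+1) - 1 < k (b+1) - 1
    omega)
  refine ⟨fun j => l j + 1, fun a b hab => Nat.add_lt_add_right (hl hab) 1, ?_⟩
  have key : (fun j => (eapp f)^[k (l j + 1)]) = fun j => (eapp f)^[k (l j + 1) - 1] ∘ eapp f := by
    funext j
    conv_lhs => rw [hk1 (l j)]
    rw [Function.iterate_succ]
  rcases hlim with ⟨g, hg, hgt⟩ | hdiv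
  · left
    refine ⟨g ∘ eapp f, hg.comp hd.differentiableOn (fun x hx => hx), ?_⟩
    show TendstoLocallyUniformlyOn (fun j => (eapp f)^[k (l j + 1)]) _ _ _
    rw [key]
    exact hgt.comp (eapp f) (fun x hx => hx) hc.continuousOn
  · right
    show DivLocUnifOn (fun j => (eapp f)^[k (l j + 1)]) _
    rw [key]
    intro L hL hLc K hK
    filter_upwards [hdiv (eapp f '' L) (Set.image_subset_iff.2 hL) (hLc.image hc) K hK] with j hj
    rwa [Set.image_comp]

lemma aux_nhds {n : ℕ} (f : Endo n) (W : Set (Endo n)) (hW : W ∈ 𝓝 f) :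
    ∃ R : ℝ, ∃ δ > 0, ∀ g : Endo n,
      (∀ z ∈ closedBall (0 : Cn n) R, dist (eapp f z) (eapp g z) < δ) → g ∈ W := by
  obtain ⟨W', hW', hsub⟩ := (mem_nhds_induced Subtype.val f W).1 hW
  rw [UniformSpace.mem_nhds_iff] at hW'
  obtain ⟨X, hX, hXW⟩ := hW'
  obtain ⟨K, V, hK, hV, hKV⟩ := (ContinuousMap.mem_compactConvergence_entourage_iff X).1 hX
  obtain ⟨δ, hδ, hδV⟩ := Metric.mem_uniformity_dist.1 hV
  obtain ⟨R, hR⟩ := hK.isBounded.subset_closedBall (0 : Cn n)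
  refine ⟨R, δ, hδ, fun g hg => hsub (hXW ?_)⟩
  exact hKV (fun z hz => hδV (hg z (hR hz)))

lemma aux_bump {n : ℕ} (q : Cn n) {R : ℝ} (hR0 : 0 ≤ R) (hR : R < ‖q‖) (k : ℕ) (s : ℕ → Cn n)
    (hs : ∀ j < k, s j ∈ closedBall (0 : Cn n) R) {η : ℝ} (hη : 0 < η) :
    ∃ h : Cn n → ℂ, Differentiable ℂ h ∧ h q = 1 ∧ (∀ j < k, h (s j) = 0) ∧
      ∀ z ∈ closedBall (0 : Cn n) R, ‖h z‖ < η := by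
  have hq : 0 < ‖q‖ := lt_of_le_of_lt hR0 hR
  let ℓ : Cn n →L[ℂ] ℂ := innerSL ℂ q
  have hℓq : ℓ q = (‖q‖ : ℂ)^2 := by
    simp [ℓ, inner_self_eq_norm_sq_to_K]
  have hℓ : ∀ z ∈ closedBall (0 : Cn n) R, ‖ℓ z‖ ≤ ‖q‖ * R := by
    intro z hz
    rw [mem_closedBall_zero_iff] at hz
    calc ‖ℓ z‖ ≤ ‖q‖ * ‖z‖ := norm_inner_le_norm q z
      _ ≤ _ := by gcongr
  have hℓqn : ‖ℓ q‖ = ‖q‖ * ‖q‖ := by rw [hℓq]; simp [sq]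
  have hℓ0 : ℓ q ≠ 0 := by
    rw [← norm_pos_iff, hℓqn]; positivity
  have hne : ∀ j < k, ℓ q - ℓ (s j) ≠ 0 := by
    intro j hj h0
    have h1 := hℓ _ (hs j hj)
    rw [sub_eq_zero] at h0
    rw [← h0, hℓqn] at h1
    nlinarith
  let P : Cn n → ℂ := fun z => ∏ j ∈ Finset.range k, ((ℓ z - ℓ (s j)) / (ℓ q - ℓ (s j)))
  have hP : Differentiable ℂ P := by
    have h1 : Differentiable ℂ
        (fun t : ℂ => ∏ j ∈ Finset.range k, ((t - ℓ (s j)) / (ℓ q - ℓ (s j)))) := by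
      apply Differentiable.fun_finsetProd
      intro j _
      fun_prop
    exact h1.comp ℓ.differentiable
  obtain ⟨C, hC⟩ := (isCompact_closedBall (0 : Cn n) R).exists_bound_of_continuousOn
    hP.continuous.continuousOn
  have hC0 : 0 ≤ C := (norm_nonneg _).trans (hC 0 (mem_closedBall_self hR0))
  have hlt : R / ‖q‖ < 1 := by rwa [div_lt_one hq]
  obtain ⟨M, hM⟩ := exists_pow_lt_of_lt_one (show 0 < η / (C + 1) by positivity) hlt
  refine ⟨fun z => (ℓ z / ℓ q)^M * P z, ?_, ?_, ?_, ?_⟩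
  · fun_prop
  · have : P q = 1 := Finset.prod_eq_one (fun j hj => div_self (hne j (Finset.mem_range.1 hj)))
    simp [this, div_self hℓ0]
  · intro j hj
    have : P (s j) = 0 := Finset.prod_eq_zero (Finset.mem_range.2 hj) (by simp)
    simp [this]
  · intro z hz
    have h1 : ‖ℓ z / ℓ q‖ ≤ R / ‖q‖ := by
      rw [norm_div, hℓqn, div_le_div_iff₀ (by positivity) hq]
      nlinarith [hℓ z hz]
    have h2 : ‖(ℓ z / ℓ q)^M‖ ≤ (R / ‖q‖)^M := by
      rw [norm_pow]; gcongr
    show ‖(ℓ z / ℓ q)^M * P z‖ < η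
    rw [norm_mul]
    calc _ ≤ (R / ‖q‖)^M * C := by gcongr; exact hC z hz
      _ ≤ (R / ‖q‖)^M * (C + 1) := by gcongr; linarith
      _ < η := by rwa [← lt_div_iff₀ (by positivity)]

lemma aux_perturb {n : ℕ} (f : Endo n) (W : Set (Endo n)) (hW : W ∈ 𝓝 f) :
    ∃ R₀ : ℝ, ∀ R ≥ R₀, 0 ≤ R → ∀ (p v : Cn n) (k : ℕ),
      (∀ j < k, (eapp f)^[j] p ∈ closedBall (0 : Cn n) R) → R < ‖(eapp f)^[k] p‖ →
      ∃ g ∈ W, (eapp g)^[k+1] p = v := by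
  obtain ⟨R₀, δ, hδ, hg⟩ := aux_nhds f W hW
  refine ⟨R₀, fun R hR hR0 p v k hj hk => ?_⟩
  set q := (eapp f)^[k] p with hq
  obtain ⟨h, hd, hhq, hs, hsm⟩ := aux_bump q hR0 hk k (fun j => (eapp f)^[j] p) hj
    (show 0 < δ / (‖v - eapp f q‖ + 1) by positivity)
  have hfd : Differentiable ℂ (eapp f) := f.2
  have hGd : Differentiable ℂ (fun z => eapp f z + h z • (v - eapp f q)) := by fun_prop
  let g : Endo n := ⟨⟨fun z => eapp f z + h z • (v - eapp f q), hGd.continuous⟩, hGd⟩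
  have hgz : ∀ z, eapp g z = eapp f z + h z • (v - eapp f q) := fun z => rfl
  refine ⟨g, hg g (fun z hz => ?_), ?_⟩
  · rw [hgz, dist_self_add_right, norm_smul]
    have h1 := hsm z (closedBall_subset_closedBall hR hz)
    rw [lt_div_iff₀ (by positivity)] at h1
    nlinarith [norm_nonneg (h z)]
  · have hit : ∀ j ≤ k, (eapp g)^[j] p = (eapp f)^[j] p := by
      intro j
      induction j with
      | zero => intro _; rfl
      | succ j ih =>
        intro hjk
        rw [Function.iterate_succ_apply', Function.iterate_succ_apply', ih (by omega), hgz,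
          hs j (by omega)]
        simp
    rw [Function.iterate_succ_apply', hit k le_rfl, hgz, hhq]
    simp [← hq]

lemma aux_eval_cont {n : ℕ} (p : Cn n) (k : ℕ) :
    Continuous (fun f : Endo n => (eapp f)^[k] p) := by
  induction k with
  | zero => exact continuous_const
  | succ k ih =>
    simp only [Function.iterate_succ_apply']
    exact (continuous_subtype_val (p := fun f : C(Cn n, Cn n) => Differentiable ℂ ⇑f)).eval ih

def auxO {n : ℕ} (U V : Set (Cn n)) : Set (Endo n) :=
  {f | ∃ k : ℕ, ∃ p ∈ U, (eapp f)^[k+1] p ∈ V}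

lemma auxO_open {n : ℕ} (U V : Set (Cn n)) (hV : IsOpen V) : IsOpen (auxO U V) := by
  have : auxO U V = ⋃ k : ℕ, ⋃ p ∈ U, (fun f : Endo n => (eapp f)^[k+1] p) ⁻¹' V := by
    ext f; simp [auxO]
  rw [this]
  exact isOpen_iUnion fun k => isOpen_biUnion fun p _ => hV.preimage (aux_eval_cont p _)

lemma aux_residual {n : ℕ} (U V : Set (Cn n)) (hV : IsOpen V) :
    auxO U V ∪ (closure (auxO U V))ᶜ ∈ residual (Endo n) := by
  refine residual_of_dense_open ((auxO_open U V hV).union isClosed_closure.isOpen_compl) ?_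
  intro f
  rw [closure_union]
  by_cases h : f ∈ closure (auxO U V)
  · exact Or.inl h
  · exact Or.inr (subset_closure h)

lemma aux_notclosure {n : ℕ} (f : Endo n) (U V : Set (Cn n)) (hU : IsOpen U)
    (hUb : Bornology.IsBounded U)
    (hV : V.Nonempty) (hf : f ∉ closure (auxO U V)) : U ⊆ Fatou f := by
  have hW : (closure (auxO U V))ᶜ ∈ 𝓝 f := isClosed_closure.isOpen_compl.mem_nhds hf
  obtain ⟨R₀, hR₀⟩ := aux_perturb f _ hW
  obtain ⟨R₁, hR₁⟩ := hUb.subset_closedBall (0 : Cn n)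
  obtain ⟨v, hv⟩ := hV
  set R := max (max R₀ R₁) 0
  intro x hx
  refine aux_bdd_fatou f U hU (B := R) ?_ x hx
  intro k z hz
  induction k using Nat.strong_induction_on with
  | _ k ih =>
    by_contra hcon
    obtain ⟨g, hg, hgk⟩ := hR₀ R ((le_max_left _ _).trans (le_max_left _ _)) (le_max_right _ _)
      z v k ih (by simpa using hcon)
    exact hg (subset_closure ⟨k, z, hz, by rw [hgk]; exact hv⟩)

lemma aux_partA (n : ℕ) :
    ∀ᶠ f : Endo n in residual (Endo n), ∀ x ∈ Julia f, ∀ y, ∀ ε : Cn n → ℝ, Continuous ε →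
      (∀ z, 0 < ε z) → EpsChain f ε x y := by
  obtain ⟨b, hbc, -, hb⟩ := TopologicalSpace.exists_countable_basis (Cn n)
  have h1 : ∀ᶠ f : Endo n in residual (Endo n), ∀ U ∈ b, ∀ V ∈ b,
      f ∈ auxO U V ∪ (closure (auxO U V))ᶜ := by
    rw [eventually_countable_ball hbc]
    intro U hU
    rw [eventually_countable_ball hbc]
    intro V hV
    exact aux_residual U V (hb.isOpen hV)
  filter_upwards [h1] with f hf x hx y ε hε hε0
  have hfx := aux_julia_forward f x hx
  obtain ⟨U, hUb, hxU, hU⟩ := hb.exists_subset_of_mem_open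
    (mem_ball_self (hε0 (eapp f x))) isOpen_ball
  have hVo : IsOpen {z | dist z y < ε z} :=
    isOpen_lt (continuous_id.dist continuous_const) hε
  obtain ⟨V, hVb, hyV, hV⟩ := hb.exists_subset_of_mem_open
    (show y ∈ {z | dist z y < ε z} by simpa using hε0 y) hVo
  have hmem : f ∈ auxO U V := by
    rcases hf U hUb V hVb with h | h
    · exact h
    · exact absurd (aux_notclosure f U V (hb.isOpen hUb) (isBounded_ball.subset hU) ⟨y, hyV⟩ h hxU)
        hfx
  obtain ⟨k, u, hu, huV⟩ := hmem
  refine ⟨k + 2, by omega,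
    fun j => if j = 0 then x else if j ≤ k + 1 then (eapp f)^[j - 1] u else y, by simp, by simp, ?_⟩
  intro j hj
  rcases j with _ | j
  · simp only [if_true]
    have := hU hu
    rw [mem_ball, dist_comm] at this
    simpa using this
  · have e1 : j + 1 ≤ k + 1 := by omega
    have e2 : eapp f ((eapp f)^[j] u) = (eapp f)^[j+1] u := (Function.iterate_succ_apply' _ _ _).symm
    simp only [Nat.add_eq_zero_iff, one_ne_zero, and_false, if_false, e1, if_true,
      Nat.add_sub_cancel, e2]
    by_cases hjk : j + 1 + 1 ≤ k + 1
    · simp [hjk, hε0]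
    · have : j = k := by omega
      subst this
      simp only [hjk, if_false]
      exact hV huV

lemma aux_shadow {n : ℕ} (F : Cn n → Cn n) (hF : Continuous F) (C : Set (Cn n)) (hC : IsCompact C)
    (M : ℕ) : ∀ η > 0, ∃ δ > 0, ∀ c : ℕ → Cn n, c 0 ∈ C →
      (∀ j, dist (F (c j)) (c (j+1)) < δ) → ∀ j ≤ M, dist (c j) (F^[j] (c 0)) < η := by
  induction M with
  | zero =>
    intro η hη
    refine ⟨1, one_pos, fun c _ _ j hj => ?_⟩
    obtain rfl : j = 0 := by omega
    simpa using hη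
  | succ M ih =>
    intro η hη
    have hK : IsCompact (F^[M] '' C) := hC.image (hF.iterate M)
    obtain ⟨r, hr, hru⟩ : ∃ r > 0, ∀ a ∈ F^[M] '' C, ∀ b, dist b a < r → dist (F b) (F a) < η/2 := by
      obtain ⟨r, hr, h⟩ := Metric.uniformContinuousOn_iff.1
        ((hK.cthickening (r := 1)).uniformContinuousOn_of_continuous hF.continuousOn) (η/2)
        (by linarith)
      refine ⟨min r 1, lt_min hr one_pos, fun a ha b hb => h b ?_ a
        (self_subset_cthickening _ ha) (lt_of_lt_of_le hb (min_le_left _ _))⟩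
      exact mem_cthickening_of_dist_le b a 1 _ ha (hb.le.trans (min_le_right _ _))
    obtain ⟨δ, hδ, h⟩ := ih (min r η) (lt_min hr hη)
    refine ⟨min δ (η/2), lt_min hδ (by linarith), fun c hc hch j hj => ?_⟩
    have h' := h c hc (fun j => lt_of_lt_of_le (hch j) (min_le_left _ _))
    rcases Nat.lt_or_ge j (M+1) with hlt | hge
    · exact lt_of_lt_of_le (h' j (by omega)) (min_le_right _ _)
    · obtain rfl : j = M + 1 := by omega
      have h1 := hru _ ⟨c 0, hc, rfl⟩ (c M) (lt_of_lt_of_le (h' M le_rfl) (min_le_left _ _))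
      have h2 := lt_of_lt_of_le (hch M) (min_le_right _ _)
      rw [Function.iterate_succ_apply']
      have := dist_triangle_left (c (M+1)) (F (F^[M] (c 0))) (F (c M))
      linarith

lemma aux_contract {n : ℕ} (hn : 1 ≤ n) (f : Endo n) (p : Cn n) (hp : IsAttPer f p) :
    ∃ M, 1 ≤ M ∧ ∃ r₀ > 0, ∃ θ : ℝ, 0 ≤ θ ∧ θ < 1 ∧ ∀ z, dist z p < r₀ → dist ((eapp f)^[M] z) p ≤ θ * dist z p := by
  obtain ⟨⟨m₀, hm₀, hper⟩, hspec⟩ := hp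
  have : Nonempty (Fin n) := ⟨⟨0, hn⟩⟩
  have : Nontrivial (Cn n) := inferInstance
  have hmp : 0 < minPer f p :=
    Function.IsPeriodicPt.minimalPeriod_pos (f := eapp f) hm₀ hper
  have hfix : (eapp f)^[minPer f p] p = p := Function.iterate_minimalPeriod
  set L := fderiv ℂ ((eapp f)^[minPer f p]) p with hL
  have hrad : spectralRadius ℂ L < 1 := by
    have := spectrum.spectralRadius_lt_of_forall_lt L (r := 1) (fun z hz => hspec z hz)
    simpa using this
  have hgel := spectrum.pow_nnnorm_pow_one_div_tendsto_nhds_spectralRadius L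
  obtain ⟨N, hN, hN1⟩ := ((hgel.eventually (gt_mem_nhds hrad)).and (eventually_ge_atTop 1)).exists
  have hnorm : ‖L^N‖ < 1 := by
    have h1 : (‖L^N‖₊ : ENNReal) < 1 := by
      by_contra hcon
      push Not at hcon
      exact absurd hN (not_lt.2 (ENNReal.one_le_rpow hcon (by positivity)))
    exact_mod_cast h1
  obtain ⟨θ, hθ1, hθ⟩ := exists_between hnorm
  have hd : Differentiable ℂ ((eapp f)^[minPer f p]) := Differentiable.iterate f.2 _
  have hder : HasFDerivAt ((eapp f)^[minPer f p])^[N] (L^N) p := (hd p).hasFDerivAt.iterate hfix N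
  have hfixN : ((eapp f)^[minPer f p])^[N] p = p := Function.iterate_fixed hfix N
  have hev : ∀ᶠ z in 𝓝 p, dist (((eapp f)^[minPer f p])^[N] z) p ≤ θ * dist z p := by
    have h1 := hder.isLittleO.def (sub_pos.2 hθ1)
    filter_upwards [h1] with z hz
    rw [hfixN] at hz
    rw [dist_eq_norm, dist_eq_norm]
    have h2 := (L^N).le_opNorm (z - p)
    have h3 := norm_sub_norm_le (((eapp f)^[minPer f p])^[N] z - p) ((L^N) (z - p))
    linarith
  obtain ⟨r₀, hr₀, h⟩ := Metric.eventually_nhds_iff.1 hev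
  refine ⟨minPer f p * N, Nat.mul_pos hmp hN1, r₀, hr₀, θ, (norm_nonneg _).trans hθ1.le, hθ, fun z hz => ?_⟩
  rw [Function.iterate_mul]
  exact h hz

lemma aux_partC {n : ℕ} (hn : 1 ≤ n) (f : Endo n) (p : Cn n) (hp : IsAttPer f p) (x : Cn n)
    (hx : x ∈ basinOf f p \ cycleOf f p) : ¬ ChainRec f x := by
  obtain ⟨⟨a, ⟨i, hi, hia⟩, hlim⟩, hxA⟩ := hx
  have hc : Continuous (eapp f) := f.1.continuous
  have hfix : (eapp f)^[minPer f p] p = p := Function.iterate_minimalPeriod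
  have hmp : 0 < minPer f p := by omega
  -- points of the forward orbit of `p` lie in the cycle
  have hcyc : ∀ j, (eapp f)^[j] p ∈ cycleOf f p := fun j =>
    ⟨j % minPer f p, Nat.mod_lt _ hmp, Function.iterate_mod_minimalPeriod_eq⟩
  have hne : ∀ j, (eapp f)^[j] p ≠ x := fun j h => hxA (h ▸ hcyc j)
  -- x is not periodic
  have hnper : ∀ j, 1 ≤ j → (eapp f)^[j] x ≠ x := by
    intro j hj h
    have h1 : Tendsto (fun k : ℕ => j * k) atTop atTop :=
      tendsto_id.const_mul_atTop' hj
    have h2 := hlim.comp h1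
    have h3 : (fun k => (eapp f)^[minPer f p * k] x) ∘ (fun k : ℕ => j * k) = fun _ => x := by
      funext k
      show (eapp f)^[minPer f p * (j * k)] x = x
      have : minPer f p * (j * k) = j * (minPer f p * k) := by ring
      rw [this, Function.iterate_mul]
      exact Function.iterate_fixed h _
    rw [h3] at h2
    have : x = a := tendsto_nhds_unique tendsto_const_nhds h2
    exact hxA (this ▸ ⟨i, hi, hia⟩)
  obtain ⟨M, hM, r₀, hr₀, θ, hθ0, hθ, hcon⟩ := aux_contract hn f p hp
  -- choice of the radius
  have hrad : ∃ r > 0, r < r₀ ∧ ∀ j ≤ M, ∃ η > 0, ∀ z, dist z p ≤ r → η ≤ dist x ((eapp f)^[j] z) := by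
    have hev : ∀ᶠ z in 𝓝 p, ∀ j ∈ Set.Iic M,
        dist x ((eapp f)^[j] p) / 2 < dist x ((eapp f)^[j] z) := by
      rw [eventually_all_finite (Set.finite_Iic M)]
      intro j _
      have hcont : Continuous fun z => dist x ((eapp f)^[j] z) :=
        continuous_const.dist (hc.iterate j)
      have hpos : 0 < dist x ((eapp f)^[j] p) := dist_pos.2 (hne j).symm
      exact hcont.continuousAt.eventually (lt_mem_nhds (by linarith))
    obtain ⟨r, hr, h⟩ := Metric.eventually_nhds_iff.1 hev
    have hmin : 0 < min r r₀ := lt_min hr hr₀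
    have hm1 := min_le_left r r₀
    have hm2 := min_le_right r r₀
    refine ⟨min r r₀ / 2, by linarith, by linarith, fun j hj =>
      ⟨dist x ((eapp f)^[j] p) / 2, half_pos (dist_pos.2 (hne j).symm), fun z hz => ?_⟩⟩
    exact (h (show dist z p < r by linarith) j hj).le
  obtain ⟨r, hr, hrr, hη⟩ := hrad
  choose! η hη0 hη using hη
  obtain ⟨η₁, hη₁, hη₁'⟩ : ∃ η₁ > 0, ∀ j ≤ M, η₁ ≤ η j := by
    refine ⟨(Finset.range (M+1)).inf' ⟨0, by simp⟩ η, ?_, fun j hj => ?_⟩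
    · refine (Finset.lt_inf'_iff _).2 fun j hj => ?_
      exact hη0 j (by simpa [Nat.lt_succ_iff] using hj)
    · exact Finset.inf'_le _ (by simpa [Nat.lt_succ_iff] using hj)
  have hθr : 0 < (1 - θ) * r := mul_pos (by linarith) hr
  obtain ⟨δ₁, hδ₁, hsh₁⟩ := aux_shadow (eapp f) hc (closedBall p r) (isCompact_closedBall _ _) M
    (min η₁ ((1 - θ) * r)) (lt_min hη₁ hθr)
  -- entrance time
  obtain ⟨k, hk⟩ : ∃ k, dist ((eapp f)^[k] x) p < r := by
    have h1 : Tendsto (fun k => (eapp f)^[minPer f p - i] ((eapp f)^[minPer f p * k] x)) atTop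
        (𝓝 ((eapp f)^[minPer f p - i] a)) :=
      ((hc.iterate _).tendsto a).comp hlim
    have h2 : (eapp f)^[minPer f p - i] a = p := by
      rw [← hia, ← Function.iterate_add_apply]
      have : minPer f p - i + i = minPer f p := by omega
      rw [this, hfix]
    rw [h2] at h1
    obtain ⟨k, hk⟩ := (h1.eventually (Metric.ball_mem_nhds p hr)).exists
    refine ⟨minPer f p - i + minPer f p * k, ?_⟩
    rw [Function.iterate_add_apply]
    exact hk
  obtain ⟨η₂, hη₂, hη₂'⟩ : ∃ η₂ > 0, ∀ j, 1 ≤ j → j ≤ k → η₂ ≤ dist x ((eapp f)^[j] x) := by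
    by_cases hk0 : 1 ≤ k
    · refine ⟨(Finset.Icc 1 k).inf' ⟨1, by simp [hk0]⟩ (fun j => dist x ((eapp f)^[j] x)), ?_,
        fun j hj hj' => ?_⟩
      · refine (Finset.lt_inf'_iff _).2 fun j hj => ?_
        exact dist_pos.2 (hnper j (Finset.mem_Icc.1 hj).1).symm
      · exact Finset.inf'_le (fun j => dist x ((eapp f)^[j] x)) (Finset.mem_Icc.2 ⟨hj, hj'⟩)
    · exact ⟨1, one_pos, fun j hj hj' => by omega⟩
  obtain ⟨δ₂, hδ₂, hsh₂⟩ := aux_shadow (eapp f) hc {x} isCompact_singleton k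
    (min η₂ (r - dist ((eapp f)^[k] x) p)) (lt_min hη₂ (by linarith))
  intro hrec
  obtain ⟨N, hN, c, hc0, hcN, hch⟩ := hrec (fun _ => min δ₁ δ₂) continuous_const
    (fun _ => lt_min hδ₁ hδ₂)
  -- extend the chain by the true orbit
  let e : ℕ → Cn n := fun j => if j ≤ N then c j else (eapp f)^[j - N] (c N)
  have he : ∀ j, dist (eapp f (e j)) (e (j+1)) < min δ₁ δ₂ := by
    intro j
    rcases Nat.lt_or_ge j N with hj | hj
    · have h1 : e j = c j := if_pos hj.le
      have h2 : e (j+1) = c (j+1) := if_pos hj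
      rw [h1, h2]
      exact hch j hj
    · have h1 : e j = (eapp f)^[j - N] (c N) := by
        rcases hj.eq_or_lt with h | h
        · subst h; simp [e]
        · exact if_neg (by omega)
      have h2 : e (j+1) = (eapp f)^[j + 1 - N] (c N) := if_neg (by omega)
      rw [h1, h2, show j + 1 - N = (j - N) + 1 by omega, Function.iterate_succ_apply', dist_self]
      exact lt_min hδ₁ hδ₂
  have he0 : e 0 = x := by simp [e, hc0]
  have heN : e N = x := by simp [e, hcN]
  have hA := hsh₂ e (by simp [he0]) (fun j => (he j).trans_le (min_le_right _ _))
  rw [he0] at hA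
  have hB : ∀ t, e (k + t * M) ∈ closedBall p r := by
    intro t
    induction t with
    | zero =>
      have h1 := (hA k le_rfl).trans_le (min_le_right _ _)
      have := dist_triangle (e k) ((eapp f)^[k] x) p
      simp only [Nat.zero_mul, Nat.add_zero, mem_closedBall]
      linarith
    | succ t ih =>
      have h1 := hsh₁ (fun j => e (k + t * M + j)) ih
        (fun j => (he (k + t * M + j)).trans_le (min_le_left _ _)) M le_rfl
      have h1 := h1.trans_le (min_le_right _ _)
      simp only [Nat.add_zero] at h1
      rw [mem_closedBall] at ih
      have h2 := hcon (e (k + t * M)) (by linarith)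
      have h3 := dist_triangle (e (k + t * M + M)) ((eapp f)^[M] (e (k + t * M))) p
      have h4 : θ * dist (e (k + t * M)) p ≤ θ * r := mul_le_mul_of_nonneg_left ih hθ0
      rw [show k + (t+1) * M = k + t * M + M by ring, mem_closedBall]
      linarith
  rcases Nat.lt_or_ge N k with hNk | hNk
  · have h1 := (hA N hNk.le).trans_le (min_le_left _ _)
    rw [heN] at h1
    exact absurd (hη₂' N hN hNk.le) (not_le.2 h1)
  · have h1 := hsh₁ (fun j => e (k + ((N-k)/M) * M + j)) (hB _)
      (fun j => (he (k + ((N-k)/M) * M + j)).trans_le (min_le_left _ _)) ((N-k) % M)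
      (Nat.mod_lt _ hM).le
    have h2 := h1.trans_le (min_le_left _ _)
    have h3 : k + ((N-k)/M) * M + (N-k) % M = N := by
      have := Nat.div_add_mod' (N-k) M
      omega
    simp only [h3, heN, Nat.add_zero] at h2
    have hj : (N-k) % M ≤ M := (Nat.mod_lt _ hM).le
    have h4 := hη _ hj _ (hB ((N-k)/M))
    have h5 := hη₁' _ hj
    linarith

lemma aux_orbit_chain {n : ℕ} (f : Endo n) (p : Cn n) (a b : Cn n) (ha : a ∈ cycleOf f p)
    (hb : b ∈ cycleOf f p) (ε : Cn n → ℝ) (hε : ∀ z, 0 < ε z) : EpsChain f ε a b := by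
  obtain ⟨i, hi, rfl⟩ := ha
  obtain ⟨j, hj, rfl⟩ := hb
  have hfix : (eapp f)^[minPer f p] p = p := Function.iterate_minimalPeriod
  refine ⟨j + minPer f p - i, by omega, fun t => (eapp f)^[t + i] p, by simp, ?_, ?_⟩
  · show (eapp f)^[j + minPer f p - i + i] p = (eapp f)^[j] p
    rw [show j + minPer f p - i + i = j + minPer f p by omega, Function.iterate_add_apply, hfix]
  · intro t _
    show dist (eapp f ((eapp f)^[t + i] p)) ((eapp f)^[t + 1 + i] p) < _
    rw [show t + 1 + i = (t + i) + 1 by omega, Function.iterate_succ_apply', dist_self]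
    exact hε _

/-- For a generic endomorphism `f` of `ℂⁿ`: (a) any two points of `J_f` are chain-equivalent;
(b) points of an attracting cycle are chain-recurrent and pairwise chain-equivalent;
(c) no point of the basin of an attracting cycle other than the cycle itself is
chain-recurrent. -/
theorem stmt_19 (n : ℕ) (hn : 1 ≤ n) :
    {f : Endo n |
        (∀ x ∈ Julia f, ∀ y ∈ Julia f, ChainEquiv f x y) ∧
        (∀ p : Cn n, IsAttPer f p →
          (∀ a ∈ cycleOf f p, ChainRec f a) ∧
          (∀ a ∈ cycleOf f p, ∀ b ∈ cycleOf f p, ChainEquiv f a b) ∧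
          (∀ x ∈ basinOf f p \ cycleOf f p, ¬ ChainRec f x))} ∈ residual (Endo n) := by
  filter_upwards [aux_partA n] with f hf
  refine ⟨fun x hx y hy ε hε hε0 => ⟨hf x hx y ε hε hε0, hf y hy x ε hε hε0⟩, fun p hp => ⟨?_, ?_, ?_⟩⟩
  · intro a ha ε _ hε
    exact aux_orbit_chain f p a a ha ha ε hε
  · intro a ha b hb ε _ hε
    exact ⟨aux_orbit_chain f p a b ha hb ε hε, aux_orbit_chain f p b a hb ha ε hε⟩
  · intro x hx
    exact aux_partC hn f p hp x hx
end
end
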